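/- arXiv:0809.1640 — 2 statements merged into one kernel-verified Lean document; each statement's English description precedes it below -/
import Mathlib

section
/- For every integer m ≥ 1 and every real ε with 0 < ε < 1 there exist a constant C > 0 and a threshold x₀ (depending only on m and ε) such that the following holds. Let λ₁, λ₂ : ℕ₊ → ℂ be multiplicative functions satisfying |λᵢ(n)| ≤ τ_m(n) for all n ≥ 1 and i = 1, 2. Then for every real x ≥ x₀ and every nonzero integer ℓ with |ℓ| ≤ x, one has Σ_{1 ≤ n ≤ x, n + ℓ ≥ 1} |λ₁(n) λ₂(n + ℓ)| ≤ C · x · (log x)^ε · M(x) · τ(|ℓ|), where M(x) := (log x)^{-2} · Π_{p ≤ z, p prime} (1 + |λ₁(p)|/p)(1 + |λ₂(p)|/p) and z := exp(log x / (ε log log x)). -/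
open scoped Classical

/-- `tauM m n` is `τ_m(n)`: the number of ordered `m`-tuples `(d₁, …, d_m)` of positive
integers with `d₁ ⋯ d_m = n`. -/
def tauM (m n : ℕ) : ℕ :=
  ((Fintype.piFinset fun _ : Fin m => Finset.Icc 1 n).filter fun t => ∏ i, t i = n).card

abbrev pr (n : ℕ) : Finset ℕ := (Finset.Icc 2 n).filter Nat.Prime

lemma mem_pr {n p : ℕ} : p ∈ pr n ↔ p.Prime ∧ p ≤ n := by
  simp only [pr, Finset.mem_filter, Finset.mem_Icc]
  exact ⟨fun h => ⟨h.2, h.1.2⟩, fun h => ⟨⟨h.1.two_le, h.2⟩, h.1⟩⟩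

/-- Chebyshev-type bound. -/
lemma sum_log_div (n : ℕ) : ∑ p ∈ pr n, Real.log p / p ≤ 2 * Real.log n := by
  rcases Nat.eq_zero_or_pos n with rfl | hn
  · simp [pr]
  have hdvd : ∏ p ∈ pr n, p ^ (n / p) ∣ n.factorial := by
    apply Finset.prod_dvd_of_isRelPrime
    · intro p hp q hq hpq
      have hp' := (mem_pr.1 hp).1
      have hq' := (mem_pr.1 hq).1
      exact (Nat.coprime_iff_isRelPrime.1 (Nat.Coprime.pow _ _ ((Nat.coprime_primes hp' hq').2 hpq)))
    · intro p hp
      have hp' := (mem_pr.1 hp).1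
      rw [Nat.Prime.pow_dvd_factorial_iff hp' (b := Nat.log p n + 1 + 1) (by omega)]
      have := Finset.single_le_sum (f := fun i => n / p ^ i)
        (s := Finset.Ico 1 (Nat.log p n + 1 + 1)) (fun i _ => Nat.zero_le _)
        (Finset.mem_Ico.2 ⟨le_refl 1, by omega⟩)
      simpa using this
  have hle : ∏ p ∈ pr n, p ^ (n / p) ≤ n ^ n :=
    (Nat.le_of_dvd (Nat.factorial_pos n) hdvd).trans (Nat.factorial_le_pow n)
  have hle' : ∑ p ∈ pr n, ((n / p : ℕ) : ℝ) * Real.log p ≤ n * Real.log n := by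
    have h1 : Real.log ((∏ p ∈ pr n, p ^ (n / p) : ℕ) : ℝ) ≤ Real.log ((n ^ n : ℕ) : ℝ) := by
      apply Real.log_le_log
      · have : 0 < ∏ p ∈ pr n, p ^ (n / p) :=
          Finset.prod_pos fun p hp => pow_pos (mem_pr.1 hp).1.pos _
        exact_mod_cast this
      · exact_mod_cast hle
    push_cast at h1
    rw [Real.log_prod (fun p hp => by
      have := (mem_pr.1 hp).1.ne_zero
      positivity), Real.log_pow] at h1
    simpa [Real.log_pow] using h1
  have hnR : (0 : ℝ) < n := by exact_mod_cast hn
  have h2 : ∑ p ∈ pr n, (n : ℝ) * (Real.log p / p) ≤ ∑ p ∈ pr n, 2 * (((n / p : ℕ) : ℝ) * Real.log p) := by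
    apply Finset.sum_le_sum
    intro p hp
    obtain ⟨hp1, hp2⟩ := mem_pr.1 hp
    have hpR : (0 : ℝ) < p := by exact_mod_cast hp1.pos
    have hl : 0 ≤ Real.log p := Real.log_natCast_nonneg p
    have h3 : (n : ℝ) / p ≤ 2 * ((n / p : ℕ) : ℝ) := by
      rw [div_le_iff₀ hpR]
      have h4 : n ≤ 2 * (n / p) * p := by
        have h5 : 1 ≤ n / p := (Nat.one_le_div_iff hp1.pos).2 hp2
        have h6 := Nat.div_add_mod n p
        have h7 := Nat.mod_lt n hp1.pos
        nlinarith
      exact_mod_cast h4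
    calc (n : ℝ) * (Real.log p / p) = (n / p) * Real.log p := by ring
      _ ≤ (2 * ((n / p : ℕ) : ℝ)) * Real.log p := by gcongr
      _ = _ := by ring
  rw [← Finset.mul_sum, ← Finset.mul_sum] at h2
  have h3 : (n : ℝ) * ∑ p ∈ pr n, Real.log p / p ≤ n * (2 * Real.log n) := by linarith
  exact le_of_mul_le_mul_left h3 hnR

lemma pr_mono {a b : ℕ} (h : a ≤ b) : pr a ⊆ pr b := by
  intro p hp
  rw [mem_pr] at *
  exact ⟨hp.1, hp.2.trans h⟩

/-- sums of reciprocals of primes in a range -/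
lemma sum_inv_range (a b : ℕ) (ha : 2 ≤ a) :
    ∑ p ∈ pr b \ pr a, (1 : ℝ) / p ≤ 2 * Real.log b / Real.log a := by
  have hla : 0 < Real.log a := Real.log_pos (by exact_mod_cast ha)
  rw [le_div_iff₀ hla, Finset.sum_mul]
  refine le_trans ?_ (sum_log_div b)
  refine le_trans ?_ (Finset.sum_le_sum_of_subset_of_nonneg (Finset.sdiff_subset (t := pr a))
    (fun p hp _ => div_nonneg (Real.log_natCast_nonneg p) (Nat.cast_nonneg _)))
  apply Finset.sum_le_sum
  intro p hp
  rw [Finset.mem_sdiff, mem_pr, mem_pr] at hp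
  have hpa : a ≤ p := by
    by_contra h
    exact hp.2 ⟨hp.1.1, by omega⟩
  have hpR : (0 : ℝ) < p := by exact_mod_cast hp.1.1.pos
  rw [div_mul_eq_mul_div, one_mul]
  have : Real.log a ≤ Real.log p := Real.log_le_log (by positivity) (by exact_mod_cast hpa)
  gcongr

lemma sum_inv_pow (j : ℕ) : ∑ p ∈ pr (2 ^ 2 ^ j), (1 : ℝ) / p ≤ 4 * j + 1 := by
  induction j with
  | zero =>
    have : pr (2 ^ 2 ^ 0) = {2} := by
      ext p
      rw [mem_pr, Finset.mem_singleton]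
      constructor
      · rintro ⟨h1, h2⟩
        have := h1.two_le
        norm_num at h2
        omega
      · rintro rfl
        exact ⟨Nat.prime_two, by norm_num⟩
    rw [this]
    norm_num
  | succ j ih =>
    have hsub : pr (2 ^ 2 ^ j) ⊆ pr (2 ^ 2 ^ (j + 1)) :=
      pr_mono (Nat.pow_le_pow_right (by norm_num) (Nat.pow_le_pow_right (by norm_num) (by omega)))
    rw [← Finset.sum_sdiff hsub]
    have h1 := sum_inv_range (2 ^ 2 ^ j) (2 ^ 2 ^ (j + 1))
      (by calc 2 = 2 ^ 1 := by norm_num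
            _ ≤ _ := Nat.pow_le_pow_right (by norm_num) Nat.one_le_two_pow)
    have h2 : 2 * Real.log ((2 ^ 2 ^ (j + 1) : ℕ) : ℝ) / Real.log ((2 ^ 2 ^ j : ℕ) : ℝ) = 4 := by
      push_cast
      rw [Real.log_pow, Real.log_pow]
      have : Real.log 2 ≠ 0 := (Real.log_pos (by norm_num)).ne'
      push_cast
      field_simp
      ring
    rw [h2] at h1
    push_cast
    linarith

lemma sum_inv_le (x : ℝ) (hx : 3 ≤ x) :
    ∑ p ∈ pr ⌊x⌋₊, (1 : ℝ) / p ≤ 8 * Real.log (Real.log x) + 16 := by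
  have hlx : 1 ≤ Real.log x := by
    rw [Real.le_log_iff_exp_le (by linarith)]
    linarith [Real.exp_one_lt_d9]
  have hll : 0 ≤ Real.log (Real.log x) := Real.log_nonneg hlx
  have hl2 : 0.69 < Real.log 2 := by linarith [Real.log_two_gt_d9]
  have hl2' : Real.log 2 < 0.7 := by linarith [Real.log_two_lt_d9]
  set t := Real.log (Real.log x / Real.log 2) / Real.log 2 with ht
  have hq : 1 ≤ Real.log x / Real.log 2 := by
    rw [le_div_iff₀ (by linarith)]; linarith
  have ht0 : 0 ≤ t := div_nonneg (Real.log_nonneg hq) (by linarith)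
  set j := ⌈t⌉₊ with hj
  have hjt : t ≤ j := Nat.le_ceil t
  have hjt' : (j : ℝ) < t + 1 := Nat.ceil_lt_add_one ht0
  have h1 : Real.log x / Real.log 2 ≤ 2 ^ j := by
    rw [← Real.log_le_log_iff (by linarith) (by positivity), Real.log_pow]
    rw [ht, div_le_iff₀ (by linarith)] at hjt
    exact hjt
  have h2 : x ≤ 2 ^ 2 ^ j := by
    rw [← Real.log_le_log_iff (by linarith) (by positivity), Real.log_pow]
    rw [div_le_iff₀ (by linarith)] at h1
    exact_mod_cast h1
  have h3 : ⌊x⌋₊ ≤ 2 ^ 2 ^ j := by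
    apply Nat.floor_le_of_le
    exact_mod_cast h2
  have h4 : ∑ p ∈ pr ⌊x⌋₊, (1 : ℝ) / p ≤ 4 * j + 1 :=
    (Finset.sum_le_sum_of_subset_of_nonneg (pr_mono h3) (fun p _ _ => by positivity)).trans
      (sum_inv_pow j)
  have h5 : Real.log (Real.log x / Real.log 2) ≤ Real.log (Real.log x) + 1 := by
    rw [Real.log_div (by linarith) (by linarith)]
    have : -1 ≤ Real.log (Real.log 2) := by
      rw [Real.le_log_iff_exp_le (by linarith), Real.exp_neg]
      have : (2 : ℝ) ≤ Real.exp 1 := by linarith [Real.exp_one_gt_d9]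
      calc (Real.exp 1)⁻¹ ≤ 2⁻¹ := by gcongr
        _ ≤ _ := by linarith
    linarith
  have h6 : t ≤ 1.5 * (Real.log (Real.log x) + 1) := by
    rw [ht, div_le_iff₀ (by linarith)]
    nlinarith
  linarith

/-- Euler product upper bound -/
lemma sum_le_euler (f : ℕ → ℝ) (h1 : f 1 = 1) (h0 : ∀ n, 0 ≤ f n)
    (hmul : ∀ {a b : ℕ}, Nat.Coprime a b → f (a * b) = f a * f b)
    (hsum : ∀ {p : ℕ}, p.Prime → Summable (fun k : ℕ => f (p ^ k)))
    (s : Finset ℕ) (T : Finset ℕ) (hT : ∀ t ∈ T, t ∈ Nat.factoredNumbers s) :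
    ∑ t ∈ T, f t ≤ ∏ p ∈ s.filter Nat.Prime, ∑' k : ℕ, f (p ^ k) := by
  have hE := EulerProduct.summable_and_hasSum_factoredNumbers_prod_filter_prime_tsum h1 hmul
    (fun hp => (hsum hp).congr (fun k => by rw [Real.norm_of_nonneg (h0 _)])) s
  have := sum_le_hasSum (T.subtype (· ∈ Nat.factoredNumbers s)) (fun i _ => h0 _) hE.2
  refine le_trans (le_of_eq ?_) this
  rw [Finset.sum_subtype_of_mem (f := f)]
  exact hT

lemma prod_one_sub_inv_le (W : ℕ) (hW : 1 ≤ W) :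
    Real.log W * ∏ p ∈ pr W, (1 - 1 / (p : ℝ)) ≤ 1 := by
  have hg : ∀ {p : ℕ}, p.Prime → HasSum (fun k : ℕ => (1 : ℝ) / ((p ^ k : ℕ) : ℝ)) (1 - 1 / (p : ℝ))⁻¹ := by
    intro p hp
    have h2 : (2 : ℝ) ≤ p := by exact_mod_cast hp.two_le
    have := hasSum_geometric_of_lt_one (r := 1 / (p : ℝ)) (by positivity)
      (by rw [div_lt_one (by linarith)]; linarith)
    refine this.congr_fun ?_ |> id
    intro k
    simp
  have h := sum_le_euler (fun n => 1 / (n : ℝ)) (by simp) (fun n => by positivity)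
    (fun {a b} _ => by push_cast; rw [one_div_mul_one_div]) (fun hp => (hg hp).summable)
    (pr W) (Finset.Icc 1 W) (by
      intro t ht
      rw [Finset.mem_Icc] at ht
      rw [Nat.mem_factoredNumbers']
      intro p hp hpt
      exact mem_pr.2 ⟨hp, (Nat.le_of_dvd (by omega) hpt).trans ht.2⟩)
  have hfil : (pr W).filter Nat.Prime = pr W := by
    ext p; simp
  rw [hfil, Finset.prod_congr rfl (fun p hp => (hg (mem_pr.1 hp).1).tsum_eq), Finset.prod_inv_distrib] at h
  have hpos : 0 < ∏ p ∈ pr W, (1 - 1 / (p : ℝ)) := by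
    apply Finset.prod_pos
    intro p hp
    have h2 : (2 : ℝ) ≤ p := by exact_mod_cast (mem_pr.1 hp).1.two_le
    rw [sub_pos, div_lt_one (by linarith)]; linarith
  have h3 : Real.log W ≤ ∑ t ∈ Finset.Icc 1 W, 1 / (t : ℝ) := by
    have := log_add_one_le_harmonic W
    rw [harmonic_eq_sum_Icc] at this
    push_cast at this
    simp only [one_div]
    refine le_trans (Real.log_le_log (by exact_mod_cast hW) (by linarith)) this
  calc _ ≤ (∏ p ∈ pr W, (1 - 1 / (p : ℝ)))⁻¹ * ∏ p ∈ pr W, (1 - 1 / (p : ℝ)) := by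
        gcongr; exact h3.trans h
    _ = 1 := inv_mul_cancel₀ hpos.ne'

lemma bonferroni (B : Finset ℕ) (r : ℕ) (hr : Even r) :
    (if B = ∅ then (1 : ℝ) else 0) ≤
      ∑ D ∈ B.powerset.filter (fun D => D.card ≤ r), (-1 : ℝ) ^ D.card := by
  have h1 : ∑ D ∈ B.powerset.filter (fun D => D.card ≤ r), (-1 : ℝ) ^ D.card =
      ∑ j ∈ Finset.range (r + 1), ((-1 : ℝ) ^ j * (B.card.choose j : ℝ)) := by
    rw [← Finset.sum_fiberwise_of_maps_to (g := Finset.card) (t := Finset.range (r + 1))]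
    · apply Finset.sum_congr rfl
      intro j hj
      rw [Finset.mem_range] at hj
      have : (B.powerset.filter (fun D => D.card ≤ r)).filter (fun D => D.card = j) =
          B.powersetCard j := by
        ext D
        simp only [Finset.mem_filter, Finset.mem_powerset, Finset.mem_powersetCard]
        constructor
        · rintro ⟨⟨h1, h2⟩, h3⟩
          exact ⟨h1, h3⟩
        · rintro ⟨h1, h2⟩
          exact ⟨⟨h1, by omega⟩, h2⟩
      rw [this, Finset.sum_congr rfl (g := fun _ => (-1 : ℝ) ^ j)
        (fun D hD => by rw [(Finset.mem_powersetCard.1 hD).2])]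
      rw [Finset.sum_const, Finset.card_powersetCard, nsmul_eq_mul, mul_comm]
    · intro D hD
      rw [Finset.mem_filter] at hD
      rw [Finset.mem_range]
      omega
  rw [h1]
  split_ifs with hB
  · subst hB
    rw [Finset.sum_range_succ']
    simp
  · have hc : B.card ≠ 0 := by simpa using hB
    obtain ⟨n, hn⟩ := Nat.exists_eq_succ_of_ne_zero hc
    have h2 := Int.alternating_sum_range_choose_eq_choose (n := n) (m := r)
    have h3 : ∑ j ∈ Finset.range (r + 1), ((-1 : ℝ) ^ j * (B.card.choose j : ℝ)) =
      (((-1) ^ r * (n.choose r : ℤ) : ℤ) : ℝ) := by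
      rw [← h2, hn]
      push_cast
      rfl
    rw [h3, hr.neg_one_pow]
    positivity

/-- counting with two congruences -/
lemma count_two (u v N : ℕ) (hu : 1 ≤ u) (hv : 1 ≤ v) (l : ℤ) (hl : ((Nat.gcd u v : ℕ) : ℤ) ∣ l) :
    |(((Finset.Icc 1 N).filter fun n : ℕ => u ∣ n ∧ (v : ℤ) ∣ (n : ℤ) + l).card : ℝ)
      - N / (Nat.lcm u v : ℝ)| ≤ 1 := by
  have hL : 0 < Nat.lcm u v := Nat.lcm_pos hu hv
  -- a solution
  obtain ⟨w, hw1, hw2⟩ : ∃ w : ℤ, (u : ℤ) ∣ w ∧ (v : ℤ) ∣ w + l := by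
    obtain ⟨c, hc⟩ := hl
    refine ⟨-(u * Nat.gcdA u v * c), ⟨-(Nat.gcdA u v * c), by ring⟩, ⟨Nat.gcdB u v * c, ?_⟩⟩
    rw [hc, Nat.gcd_eq_gcd_ab]
    ring
  have hiff : ∀ n : ℤ, ((u : ℤ) ∣ n ∧ (v : ℤ) ∣ n + l) ↔ n ≡ w [ZMOD (Nat.lcm u v : ℕ)] := by
    intro n
    rw [Int.modEq_comm, Int.modEq_iff_dvd]
    have hcast : ((Nat.lcm u v : ℕ) : ℤ) = ((Int.lcm u v : ℕ) : ℤ) := by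
      simp [Int.lcm]
    rw [hcast, Int.coe_lcm_dvd_iff]
    constructor
    · rintro ⟨h1, h2⟩
      refine ⟨dvd_sub h1 hw1, ?_⟩
      have := dvd_sub h2 hw2
      simpa using this
    · rintro ⟨h1, h2⟩
      refine ⟨?_, ?_⟩
      · have := dvd_add h1 hw1
        simpa using this
      · have := dvd_add h2 hw2
        have e : n - w + (w + l) = n + l := by ring
        rwa [e] at this
  have hcard : ((Finset.Icc 1 N).filter fun n : ℕ => u ∣ n ∧ (v : ℤ) ∣ (n : ℤ) + l).card =
      ((Finset.Ioc (0 : ℤ) N).filter fun n => n ≡ w [ZMOD (Nat.lcm u v : ℕ)]).card := by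
    apply Finset.card_bij (fun (n : ℕ) _ => (n : ℤ))
    · intro n hn
      simp only [Finset.mem_filter, Finset.mem_Icc, Finset.mem_Ioc] at hn ⊢
      refine ⟨⟨by omega, by omega⟩, (hiff n).1 ⟨by exact_mod_cast hn.2.1, hn.2.2⟩⟩
    · intro a _ b _ h
      exact_mod_cast h
    · intro b hb
      simp only [Finset.mem_filter, Finset.mem_Ioc] at hb
      obtain ⟨h1, h2⟩ := (hiff b).2 hb.2
      refine ⟨b.toNat, ?_, by omega⟩
      have hb' : ((b.toNat : ℕ) : ℤ) = b := by omega
      simp only [Finset.mem_filter, Finset.mem_Icc]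
      refine ⟨⟨by omega, by omega⟩, ?_, ?_⟩
      · rw [← hb'] at h1
        exact_mod_cast h1
      · rw [hb']; exact h2
  have hc2 := Int.Ioc_filter_modEq_card 0 N (r := (Nat.lcm u v : ℕ)) (by exact_mod_cast hL) w
  rw [hcard]
  set c := ((Finset.Ioc (0 : ℤ) N).filter fun n => n ≡ w [ZMOD (Nat.lcm u v : ℕ)]).card with hcdef
  have hLQ : (0 : ℚ) < ((Nat.lcm u v : ℕ) : ℚ) := by exact_mod_cast hL
  have e1 := Int.floor_le ((((N : ℤ) : ℚ) - w) / (((Nat.lcm u v : ℕ) : ℤ) : ℚ))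
  have e2 := Int.lt_floor_add_one ((((N : ℤ) : ℚ) - w) / (((Nat.lcm u v : ℕ) : ℤ) : ℚ))
  have e3 := Int.floor_le ((((0 : ℤ) : ℚ) - w) / (((Nat.lcm u v : ℕ) : ℤ) : ℚ))
  have e4 := Int.lt_floor_add_one ((((0 : ℤ) : ℚ) - w) / (((Nat.lcm u v : ℕ) : ℤ) : ℚ))
  have e5 : ⌊(((0 : ℤ) : ℚ) - w) / (((Nat.lcm u v : ℕ) : ℤ) : ℚ)⌋ ≤
      ⌊(((N : ℤ) : ℚ) - w) / (((Nat.lcm u v : ℕ) : ℤ) : ℚ)⌋ := by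
    apply Int.floor_le_floor
    gcongr
    positivity
  rw [max_eq_left (by linarith)] at hc2
  have hc3 : (c : ℚ) = (⌊(((N : ℤ) : ℚ) - w) / (((Nat.lcm u v : ℕ) : ℤ) : ℚ)⌋ : ℚ) -
    (⌊(((0 : ℤ) : ℚ) - w) / (((Nat.lcm u v : ℕ) : ℤ) : ℚ)⌋ : ℚ) := by exact_mod_cast hc2
  have key : |(c : ℚ) - N / ((Nat.lcm u v : ℕ) : ℚ)| ≤ 1 := by
    push_cast at *
    rw [sub_div] at e1 e2 e3 e4
    rw [zero_div] at e3 e4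
    rw [hc3, abs_le]
    constructor <;> simp only [sub_div, zero_div] <;> linarith
  have key2 := (Rat.cast_le (K := ℝ)).2 key
  push_cast at key2
  exact key2

/-- Number of `n ≤ N` divisible by `a`, `a ∣ n + l`, and all `p ∈ D` dividing `n (n+l)`. -/
lemma count_D (a b N : ℕ) (ha : 1 ≤ a) (hb : 1 ≤ b) (l : ℤ) (hl : ((Nat.gcd a b : ℕ) : ℤ) ∣ l)
    (D : Finset ℕ) (hD : ∀ p ∈ D, p.Prime ∧ ¬ p ∣ a ∧ ¬ p ∣ b ∧ ¬ (p : ℤ) ∣ l) :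
    |(((Finset.Icc 1 N).filter fun n : ℕ => (a ∣ n ∧ (b : ℤ) ∣ (n : ℤ) + l) ∧
        ∀ p ∈ D, p ∣ n ∨ (p : ℤ) ∣ (n : ℤ) + l).card : ℝ)
      - (N / (Nat.lcm a b : ℝ)) * ∏ p ∈ D, (2 / (p : ℝ))| ≤ 2 ^ D.card := by
  set S := (Finset.Icc 1 N).filter fun n : ℕ => a ∣ n ∧ (b : ℤ) ∣ (n : ℤ) + l with hS
  have hcop : ∀ E : Finset ℕ, E ⊆ D → ∀ c : ℕ, (∀ p ∈ E, ¬ p ∣ c) → Nat.Coprime c (∏ p ∈ E, p) := by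
    intro E hE c hc
    apply Nat.Coprime.prod_right
    intro p hp
    exact ((hD p (hE hp)).1.coprime_iff_not_dvd.2 (hc p hp)).symm
  -- pointwise
  have hpt : ∀ n : ℕ, (if ∀ p ∈ D, p ∣ n ∨ (p : ℤ) ∣ (n : ℤ) + l then (1 : ℝ) else 0) =
      ∑ E ∈ D.powerset, (if (∏ p ∈ E, p) ∣ n ∧ ((∏ p ∈ D \ E, p : ℕ) : ℤ) ∣ (n : ℤ) + l then (1 : ℝ) else 0) := by
    intro n
    have h1 : (if ∀ p ∈ D, p ∣ n ∨ (p : ℤ) ∣ (n : ℤ) + l then (1 : ℝ) else 0) =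
        ∏ p ∈ D, ((if p ∣ n then (1 : ℝ) else 0) + (if (p : ℤ) ∣ (n : ℤ) + l then (1 : ℝ) else 0)) := by
      have : ∀ p ∈ D, ((if p ∣ n then (1 : ℝ) else 0) + (if (p : ℤ) ∣ (n : ℤ) + l then (1 : ℝ) else 0))
          = if p ∣ n ∨ (p : ℤ) ∣ (n : ℤ) + l then (1 : ℝ) else 0 := by
        intro p hp
        by_cases h1 : p ∣ n
        · have h2 : ¬ (p : ℤ) ∣ (n : ℤ) + l := by
            intro h2
            apply (hD p hp).2.2.2
            exact (Int.dvd_add_right (by exact_mod_cast h1)).1 h2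
          simp [h1, h2]
        · simp [h1]
      rw [Finset.prod_congr rfl this, Finset.prod_ite_zero]
      simp
    rw [h1, Finset.prod_add]
    apply Finset.sum_congr rfl
    intro E hE
    rw [Finset.mem_powerset] at hE
    rw [Finset.prod_ite_zero, Finset.prod_ite_zero]
    have hA : (∀ p ∈ E, p ∣ n) ↔ (∏ p ∈ E, p) ∣ n := by
      constructor
      · intro h
        apply Finset.prod_dvd_of_isRelPrime _ h
        intro p hp q hq hpq
        exact Nat.coprime_iff_isRelPrime.1 ((Nat.coprime_primes (hD p (hE hp)).1 (hD q (hE hq)).1).2 hpq)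
      · intro h p hp
        exact (Finset.dvd_prod_of_mem _ hp).trans h
    have hB : (∀ p ∈ D \ E, (p : ℤ) ∣ (n : ℤ) + l) ↔ ((∏ p ∈ D \ E, p : ℕ) : ℤ) ∣ (n : ℤ) + l := by
      constructor
      · intro h
        push_cast
        apply Finset.prod_dvd_of_coprime _ h
        intro p hp q hq hpq
        have hp' := (hD p (Finset.sdiff_subset hp)).1
        have hq' := (hD q (Finset.sdiff_subset hq)).1
        exact Nat.isCoprime_iff_coprime.2 ((Nat.coprime_primes hp' hq').2 hpq)
      · intro h p hp
        refine dvd_trans ?_ h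
        exact_mod_cast Finset.dvd_prod_of_mem (fun p => p) hp
    simp only [hA, hB, Finset.prod_const_one]
    by_cases h1 : (∏ p ∈ E, p) ∣ n
    · by_cases h2 : ((∏ p ∈ D \ E, p : ℕ) : ℤ) ∣ (n : ℤ) + l
      · rw [if_pos h1, if_pos h2, if_pos ⟨h1, h2⟩, one_mul]
      · rw [if_neg h2, if_neg (fun h : _ ∧ _ => h2 h.2), mul_zero]
    · rw [if_neg h1, if_neg (fun h : _ ∧ _ => h1 h.1), zero_mul]
  have hcount : (((Finset.Icc 1 N).filter fun n : ℕ => (a ∣ n ∧ (b : ℤ) ∣ (n : ℤ) + l) ∧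
        ∀ p ∈ D, p ∣ n ∨ (p : ℤ) ∣ (n : ℤ) + l).card : ℝ) =
      ∑ E ∈ D.powerset, (((Finset.Icc 1 N).filter fun n : ℕ => (a * ∏ p ∈ E, p) ∣ n ∧
        ((b * ∏ p ∈ D \ E, p : ℕ) : ℤ) ∣ (n : ℤ) + l).card : ℝ) := by
    rw [← Finset.filter_filter, Finset.natCast_card_filter, ← hS]
    rw [Finset.sum_congr rfl (fun n _ => hpt n), Finset.sum_comm]
    apply Finset.sum_congr rfl
    intro E hE
    rw [Finset.mem_powerset] at hE
    rw [← Finset.natCast_card_filter, hS, Finset.filter_filter]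
    congr 2
    apply Finset.filter_congr
    intro n _
    have c1 := hcop E hE a (fun p hp => (hD p (hE hp)).2.1)
    have c2 := hcop (D \ E) Finset.sdiff_subset b (fun p hp => (hD p (Finset.sdiff_subset hp)).2.2.1)
    constructor
    · rintro ⟨⟨h1, h2⟩, h3, h4⟩
      refine ⟨c1.mul_dvd_of_dvd_of_dvd h1 h3, ?_⟩
      rw [Nat.cast_mul]
      exact IsCoprime.mul_dvd (Nat.isCoprime_iff_coprime.2 c2) h2 h4
    · rintro ⟨h1, h2⟩
      rw [Nat.cast_mul] at h2
      exact ⟨⟨(dvd_mul_right _ _).trans h1, (dvd_mul_right _ _).trans h2⟩,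
        (dvd_mul_left _ _).trans h1, (dvd_mul_left _ _).trans h2⟩
  have hmain : (N / (Nat.lcm a b : ℝ)) * ∏ p ∈ D, (2 / (p : ℝ)) =
      ∑ E ∈ D.powerset, (N : ℝ) / (Nat.lcm (a * ∏ p ∈ E, p) (b * ∏ p ∈ D \ E, p) : ℕ) := by
    rw [Finset.prod_div_distrib, Finset.prod_const]
    have : ∀ E ∈ D.powerset, (N : ℝ) / (Nat.lcm (a * ∏ p ∈ E, p) (b * ∏ p ∈ D \ E, p) : ℕ) =
        N / (Nat.lcm a b : ℝ) * (1 / ∏ p ∈ D, (p : ℝ)) := by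
      intro E hE
      rw [Finset.mem_powerset] at hE
      have c1 := hcop E hE a (fun p hp => (hD p (hE hp)).2.1)
      have c1' := hcop E hE b (fun p hp => (hD p (hE hp)).2.2.1)
      have c2 := hcop (D \ E) Finset.sdiff_subset b (fun p hp => (hD p (Finset.sdiff_subset hp)).2.2.1)
      have c2' := hcop (D \ E) Finset.sdiff_subset a (fun p hp => (hD p (Finset.sdiff_subset hp)).2.1)
      have c3 : Nat.Coprime (∏ p ∈ E, p) (∏ p ∈ D \ E, p) := by
        apply hcop _ Finset.sdiff_subset
        intro p hp hdvd
        rw [Finset.mem_sdiff] at hp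
        rw [(hD p hp.1).1.prime.dvd_finsetProd_iff] at hdvd
        obtain ⟨q, hq, hpq⟩ := hdvd
        rw [Nat.prime_dvd_prime_iff_eq (hD p hp.1).1 (hD q (hE hq)).1] at hpq
        exact hp.2 (hpq ▸ hq)
      have hlcm : Nat.lcm (a * ∏ p ∈ E, p) (b * ∏ p ∈ D \ E, p) = Nat.lcm a b * ∏ p ∈ D, p := by
        have hg : Nat.gcd (a * ∏ p ∈ E, p) (b * ∏ p ∈ D \ E, p) = Nat.gcd a b := by
          rw [Nat.Coprime.gcd_mul_right_cancel_right]
          · rw [Nat.Coprime.gcd_mul_right_cancel]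
            exact c1'.symm
          · exact (Nat.Coprime.mul_left c2' c3).symm
        have e1 := Nat.gcd_mul_lcm (a * ∏ p ∈ E, p) (b * ∏ p ∈ D \ E, p)
        have e2 := Nat.gcd_mul_lcm a b
        have e3 := Finset.prod_sdiff (f := fun p : ℕ => p) hE
        have hgpos : 0 < Nat.gcd a b := Nat.gcd_pos_of_pos_left _ ha
        rw [hg] at e1
        apply Nat.eq_of_mul_eq_mul_left hgpos
        rw [e1, ← e3]
        calc _ = (a * b) * ((∏ x ∈ D \ E, x) * ∏ x ∈ E, x) := by ring
          _ = _ := by rw [← e2]; ring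
      rw [hlcm]
      push_cast
      field_simp
    rw [Finset.sum_congr rfl this, Finset.sum_const, Finset.card_powerset, nsmul_eq_mul]
    push_cast
    ring
  rw [hcount, hmain, ← Finset.sum_sub_distrib]
  refine (Finset.abs_sum_le_sum_abs _ _).trans ?_
  refine (Finset.sum_le_sum (g := fun _ => (1 : ℝ)) ?_).trans ?_
  · intro E hE
    rw [Finset.mem_powerset] at hE
    have pos : ∀ F ⊆ D, 1 ≤ ∏ p ∈ F, p := fun F hF =>
      Finset.prod_pos (fun p hp => (hD p (hF hp)).1.pos)
    apply count_two
    · exact Nat.mul_pos ha (pos E hE)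
    · exact Nat.mul_pos hb (pos _ Finset.sdiff_subset)
    · have c1' := hcop E hE b (fun p hp => (hD p (hE hp)).2.2.1)
      have c2' := hcop (D \ E) Finset.sdiff_subset a (fun p hp => (hD p (Finset.sdiff_subset hp)).2.1)
      have c3 : Nat.Coprime (∏ p ∈ E, p) (∏ p ∈ D \ E, p) := by
        apply hcop _ Finset.sdiff_subset
        intro p hp hdvd
        rw [Finset.mem_sdiff] at hp
        rw [(hD p hp.1).1.prime.dvd_finsetProd_iff] at hdvd
        obtain ⟨q, hq, hpq⟩ := hdvd
        rw [Nat.prime_dvd_prime_iff_eq (hD p hp.1).1 (hD q (hE hq)).1] at hpq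
        exact hp.2 (hpq ▸ hq)
      have hg : Nat.gcd (a * ∏ p ∈ E, p) (b * ∏ p ∈ D \ E, p) = Nat.gcd a b := by
        rw [Nat.Coprime.gcd_mul_right_cancel_right]
        · rw [Nat.Coprime.gcd_mul_right_cancel]
          exact c1'.symm
        · exact (Nat.Coprime.mul_left c2' c3).symm
      rw [hg]; exact hl
  · simp

/-- Brun's pure sieve. -/
lemma brun (a b N : ℕ) (ha : 1 ≤ a) (hb : 1 ≤ b) (l : ℤ) (hl : ((Nat.gcd a b : ℕ) : ℤ) ∣ l)
    (P : Finset ℕ) (hP : ∀ p ∈ P, p.Prime ∧ ¬ p ∣ a ∧ ¬ p ∣ b ∧ ¬ (p : ℤ) ∣ l)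
    (r : ℕ) (hr : Even r) (T : ℝ) (hT : 1 ≤ T) :
    (((Finset.Icc 1 N).filter fun n : ℕ => (a ∣ n ∧ (b : ℤ) ∣ (n : ℤ) + l) ∧
        ∀ p ∈ P, ¬ p ∣ n ∧ ¬ (p : ℤ) ∣ (n : ℤ) + l).card : ℝ) ≤
      (N / (Nat.lcm a b : ℝ)) * (∏ p ∈ P, (1 - 2 / (p : ℝ)) +
        Real.exp (-(r : ℝ)) * ∏ p ∈ P, (1 + Real.exp 1 * (2 / (p : ℝ)))) +
      T ^ r * ∏ p ∈ P, (1 + 2 / T) := by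
  set X : ℝ := N / (Nat.lcm a b : ℝ) with hX
  have hX0 : 0 ≤ X := by positivity
  set F := P.powerset.filter (fun D => D.card ≤ r) with hF
  set cnt : Finset ℕ → ℝ := fun D => (((Finset.Icc 1 N).filter fun n : ℕ => (a ∣ n ∧ (b : ℤ) ∣ (n : ℤ) + l) ∧
        ∀ p ∈ D, p ∣ n ∨ (p : ℤ) ∣ (n : ℤ) + l).card : ℝ) with hcnt
  have hcD : ∀ D ∈ F, |cnt D - X * ∏ p ∈ D, (2 / (p : ℝ))| ≤ 2 ^ D.card := by
    intro D hD
    rw [hF, Finset.mem_filter, Finset.mem_powerset] at hD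
    exact count_D a b N ha hb l hl D (fun p hp => hP p (hD.1 hp))
  -- step 1
  have h1 : (((Finset.Icc 1 N).filter fun n : ℕ => (a ∣ n ∧ (b : ℤ) ∣ (n : ℤ) + l) ∧
        ∀ p ∈ P, ¬ p ∣ n ∧ ¬ (p : ℤ) ∣ (n : ℤ) + l).card : ℝ) ≤ ∑ D ∈ F, (-1 : ℝ) ^ D.card * cnt D := by
    have e : ∀ D, cnt D = ∑ n ∈ (Finset.Icc 1 N).filter (fun n : ℕ => a ∣ n ∧ (b : ℤ) ∣ (n : ℤ) + l),
        (if ∀ p ∈ D, p ∣ n ∨ (p : ℤ) ∣ (n : ℤ) + l then (1 : ℝ) else 0) := by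
      intro D
      rw [hcnt]
      simp only
      rw [← Finset.filter_filter, Finset.natCast_card_filter]
    simp only [e, Finset.mul_sum]
    rw [Finset.sum_comm, ← Finset.filter_filter, Finset.natCast_card_filter]
    apply Finset.sum_le_sum
    intro n _
    have hb := bonferroni (P.filter fun p => p ∣ n ∨ (p : ℤ) ∣ (n : ℤ) + l) r hr
    have e2 : (P.filter fun p => p ∣ n ∨ (p : ℤ) ∣ (n : ℤ) + l) = ∅ ↔
        ∀ p ∈ P, ¬ p ∣ n ∧ ¬ (p : ℤ) ∣ (n : ℤ) + l := by
      rw [Finset.filter_eq_empty_iff]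
      simp only [not_or]
    simp only [e2] at hb
    refine hb.trans (le_of_eq ?_)
    simp only [mul_ite, mul_one, mul_zero]
    rw [← Finset.sum_filter]
    apply Finset.sum_congr _ (fun _ _ => rfl)
    ext D
    simp only [hF, Finset.mem_filter, Finset.mem_powerset, Finset.subset_iff]
    constructor
    · rintro ⟨h1, h2⟩
      exact ⟨⟨fun p hp => (h1 hp).1, h2⟩, fun p hp => (h1 hp).2⟩
    · rintro ⟨⟨h1, h2⟩, h3⟩
      exact ⟨fun p hp => ⟨h1 hp, h3 p hp⟩, h2⟩
  -- step 2
  have h2 : ∑ D ∈ F, (-1 : ℝ) ^ D.card * cnt D ≤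
      X * ∑ D ∈ F, (-1 : ℝ) ^ D.card * ∏ p ∈ D, (2 / (p : ℝ)) + ∑ D ∈ F, (2 : ℝ) ^ D.card := by
    rw [Finset.mul_sum, ← Finset.sum_add_distrib]
    apply Finset.sum_le_sum
    intro D hD
    have := abs_le.1 (hcD D hD)
    rcases neg_one_pow_eq_or ℝ D.card with h | h <;> rw [h] <;> linarith
  -- step 3
  have h3 : ∑ D ∈ F, (2 : ℝ) ^ D.card ≤ T ^ r * ∏ p ∈ P, (1 + 2 / T) := by
    rw [Finset.prod_one_add, Finset.mul_sum]
    refine le_trans ?_ (Finset.sum_le_sum_of_subset_of_nonneg (Finset.filter_subset (fun D => D.card ≤ r) P.powerset)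
      (fun D _ _ => by positivity))
    apply Finset.sum_le_sum
    intro D hD
    rw [Finset.mem_filter] at hD
    rw [Finset.prod_const, div_pow, ← mul_div_assoc, le_div_iff₀ (by positivity), mul_comm]
    gcongr
    exact hD.2
  -- step 4
  have h4 : ∑ D ∈ F, (-1 : ℝ) ^ D.card * ∏ p ∈ D, (2 / (p : ℝ)) ≤ ∏ p ∈ P, (1 - 2 / (p : ℝ)) +
        Real.exp (-(r : ℝ)) * ∏ p ∈ P, (1 + Real.exp 1 * (2 / (p : ℝ))) := by
    have e1 : ∏ p ∈ P, (1 - 2 / (p : ℝ)) = ∑ D ∈ P.powerset, (-1 : ℝ) ^ D.card * ∏ p ∈ D, (2 / (p : ℝ)) := by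
      simp only [sub_eq_add_neg]
      rw [Finset.prod_one_add]
      apply Finset.sum_congr rfl
      intro D _
      rw [Finset.prod_neg]
    have e2 : Real.exp (-(r : ℝ)) * ∏ p ∈ P, (1 + Real.exp 1 * (2 / (p : ℝ))) =
      ∑ D ∈ P.powerset, Real.exp ((D.card : ℝ) - r) * ∏ p ∈ D, (2 / (p : ℝ)) := by
      rw [Finset.prod_one_add, Finset.mul_sum]
      apply Finset.sum_congr rfl
      intro D _
      rw [Finset.prod_mul_distrib, Finset.prod_const, ← Real.exp_nat_mul, sub_eq_add_neg,
        Real.exp_add, mul_one]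
      ring
    rw [e1, e2, ← Finset.sum_add_distrib, hF, Finset.sum_filter]
    apply Finset.sum_le_sum
    intro D _
    have hp : 0 ≤ ∏ p ∈ D, (2 / (p : ℝ)) := by positivity
    split_ifs with h
    · have := Real.exp_nonneg ((D.card : ℝ) - r)
      nlinarith
    · have h5 : 1 ≤ Real.exp ((D.card : ℝ) - r) := by
        apply Real.one_le_exp
        rw [sub_nonneg]
        exact_mod_cast (not_le.1 h).le
      rcases neg_one_pow_eq_or ℝ D.card with h | h <;> rw [h] <;> nlinarith
  calc _ ≤ _ := h1
    _ ≤ _ := h2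
    _ ≤ _ := add_le_add (mul_le_mul_of_nonneg_left h4 hX0) h3

lemma tauM_le (m n : ℕ) (hn : 1 ≤ n) : tauM m n ≤ n.divisors.card ^ m := by
  have : n.divisors.card ^ m = (Fintype.piFinset fun _ : Fin m => n.divisors).card := by
    simp
  rw [this, tauM]
  apply Finset.card_le_card
  intro t ht
  rw [Finset.mem_filter] at ht
  rw [Fintype.mem_piFinset]
  intro i
  rw [Nat.mem_divisors]
  refine ⟨?_, by omega⟩
  rw [← ht.2]
  exact Finset.dvd_prod_of_mem _ (Finset.mem_univ i)

lemma tau_mul_le (a b : ℕ) : (a * b).divisors.card ≤ a.divisors.card * b.divisors.card := by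
  rw [Nat.divisors_mul]
  exact Finset.card_mul_le

lemma tau_prime_pow {p : ℕ} (hp : p.Prime) (k : ℕ) : (p ^ k).divisors.card = k + 1 := by
  rw [Nat.divisors_prime_pow hp]; simp

lemma local_series (M : ℕ) : ∃ C : ℝ, 0 ≤ C ∧ ∀ y : ℝ, 0 ≤ y → y ≤ 3 / 4 →
    Summable (fun k : ℕ => ((k : ℝ) + 1) ^ M * y ^ k) ∧
    ∑' k : ℕ, ((k : ℝ) + 1) ^ M * y ^ k ≤ 1 + 2 ^ M * y + C * y ^ 2 := by
  have hs : ∀ j : ℕ, Summable (fun k : ℕ => ((k : ℝ) + j) ^ M * (3 / 4 : ℝ) ^ k) := by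
    intro j
    have h := (summable_pow_mul_geometric_of_norm_lt_one (R := ℝ) M (r := 3 / 4)
      (by rw [Real.norm_of_nonneg (by norm_num)]; norm_num))
    have h2 := (summable_nat_add_iff j).2 h
    have h3 := h2.mul_right ((3 / 4 : ℝ) ^ j)⁻¹
    refine h3.congr ?_
    intro k
    push_cast
    rw [pow_add]
    field_simp
  have hs' : ∀ j : ℕ, ∀ y : ℝ, 0 ≤ y → y ≤ 3 / 4 → Summable (fun k : ℕ => ((k : ℝ) + j) ^ M * y ^ k) := by
    intro j y h0 h1
    refine Summable.of_nonneg_of_le (fun k => by positivity) (fun k => ?_) (hs j)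
    gcongr
  refine ⟨∑' k : ℕ, ((k : ℝ) + 3) ^ M * (3 / 4 : ℝ) ^ k, tsum_nonneg (fun k => by positivity), ?_⟩
  intro y h0 h1
  have hy := hs' 1 y h0 h1
  push_cast at hy
  refine ⟨hy, ?_⟩
  rw [← hy.sum_add_tsum_nat_add 2]
  have e : ∀ k : ℕ, (((k + 2 : ℕ) : ℝ) + 1) ^ M * y ^ (k + 2) = (((k : ℝ) + 3) ^ M * y ^ k) * y ^ 2 := by
    intro k
    push_cast
    rw [pow_add]
    ring
  simp only [e]
  rw [tsum_mul_right, Finset.sum_range_succ, Finset.sum_range_one]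
  have h3 := hs' 3 y h0 h1
  have h4 := hs 3
  push_cast at h3 h4
  have h5 : ∑' k : ℕ, ((k : ℝ) + 3) ^ M * y ^ k ≤ ∑' k : ℕ, ((k : ℝ) + 3) ^ M * (3 / 4 : ℝ) ^ k := by
    apply h3.tsum_le_tsum _ h4
    intro k
    gcongr
  have h6 := mul_le_mul_of_nonneg_right h5 (sq_nonneg y)
  norm_num
  linarith

lemma sum_inv_sq : ∃ K : ℝ, 0 ≤ K ∧ ∀ s : Finset ℕ, ∑ p ∈ s, (1 : ℝ) / (p : ℝ) ^ 2 ≤ K := by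
  have h : Summable (fun n : ℕ => (1 : ℝ) / (n : ℝ) ^ 2) := Real.summable_one_div_nat_pow.2 (by norm_num)
  exact ⟨∑' n : ℕ, (1 : ℝ) / (n : ℝ) ^ 2, tsum_nonneg (fun _ => by positivity),
    fun s => h.sum_le_tsum s (fun _ _ => by positivity)⟩

lemma prod_le_exp (s : Finset ℕ) (g : ℕ → ℝ) (hg : ∀ p ∈ s, 0 ≤ g p) :
    ∏ p ∈ s, (1 + g p) ≤ Real.exp (∑ p ∈ s, g p) := by
  rw [Real.exp_sum]
  apply Finset.prod_le_prod
  · intro p hp; linarith [hg p hp]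
  · intro p _; linarith [Real.add_one_le_exp (g p)]

/-- divisor bound -/
lemma tau_pow_le (J : ℕ) : ∃ C : ℝ, 0 < C ∧ ∀ n : ℕ, 1 ≤ n → (n.divisors.card : ℝ) ^ J ≤ C * n := by
  obtain ⟨C, hC, hloc⟩ := local_series (2 * J)
  obtain ⟨K, hK, hsq⟩ := sum_inv_sq
  have hy : ∀ p : ℕ, p.Prime → (1 : ℝ) / (p : ℝ) ^ 2 ≤ 3 / 4 := by
    intro p hp
    have h2 : (2 : ℝ) ≤ p := by exact_mod_cast hp.two_le
    rw [div_le_iff₀ (by positivity)]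
    nlinarith
  set B := Real.exp ((2 ^ (2 * J) + C) * K) with hB
  have hBpos : 0 < B := Real.exp_pos _
  refine ⟨Real.sqrt B, Real.sqrt_pos.2 hBpos, ?_⟩
  intro n hn
  set f : ℕ → ℝ := fun n => (n.divisors.card : ℝ) ^ (2 * J) / (n : ℝ) ^ 2 with hf
  have hfp : ∀ p : ℕ, p.Prime → ∀ k : ℕ, f (p ^ k) = ((k : ℝ) + 1) ^ (2 * J) * (1 / (p : ℝ) ^ 2) ^ k := by
    intro p hp k
    rw [hf]
    simp only
    rw [tau_prime_pow hp]
    push_cast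
    rw [one_div, inv_pow, div_eq_mul_inv, ← pow_mul, ← pow_mul, mul_comm k 2]
  have h := sum_le_euler f (by simp [hf]) (fun n => by positivity)
    (by
      intro a b hab
      simp only [hf]
      rw [Nat.Coprime.card_divisors_mul hab]
      push_cast
      rw [mul_pow, mul_pow, mul_div_mul_comm])
    (by
      intro p hp
      simp only [hfp p hp]
      exact (hloc _ (by positivity) (hy p hp)).1) n.primeFactors {n}
    (by
      intro t ht
      rw [Finset.mem_singleton] at ht
      subst ht
      rw [Nat.mem_factoredNumbers_iff_primeFactors_subset]
      exact ⟨by omega, le_refl _⟩)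
  rw [Finset.sum_singleton] at h
  have h2 : f n ≤ B := by
    refine h.trans ?_
    calc _ ≤ ∏ p ∈ n.primeFactors.filter Nat.Prime, (1 + (2 ^ (2 * J) + C) * (1 / (p : ℝ) ^ 2)) := by
          apply Finset.prod_le_prod
          · intro p hp
            exact tsum_nonneg (fun k => by positivity)
          · intro p hp
            have hp' := (Finset.mem_filter.1 hp).2
            simp only [hfp p hp']
            refine (hloc _ (by positivity) (hy p hp')).2.trans ?_
            have h3 : (1 / (p : ℝ) ^ 2) ^ 2 ≤ 1 / (p : ℝ) ^ 2 := by
              have := hy p hp'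
              have h0 : 0 ≤ 1 / (p : ℝ) ^ 2 := by positivity
              nlinarith
            have := mul_le_mul_of_nonneg_left h3 hC
            linarith
      _ ≤ Real.exp (∑ p ∈ n.primeFactors.filter Nat.Prime, (2 ^ (2 * J) + C) * (1 / (p : ℝ) ^ 2)) :=
          prod_le_exp _ _ (fun p _ => by positivity)
      _ ≤ B := by
          rw [hB, ← Finset.mul_sum]
          gcongr
          exact hsq _
  have hnR : (0 : ℝ) < n := by exact_mod_cast hn
  simp only [hf] at h2
  rw [div_le_iff₀ (by positivity)] at h2
  apply le_of_sq_le_sq _ (by positivity)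
  rw [mul_pow, Real.sq_sqrt hBpos.le, ← pow_mul, mul_comm J 2]
  exact h2

/-- The part of `n` supported on primes satisfying `Q`. -/
noncomputable def part (Q : ℕ → Prop) (n : ℕ) : ℕ := (n.primeFactorsList.filter (fun p => Q p)).prod

lemma part_mul (Q : ℕ → Prop) {a b : ℕ} (ha : a ≠ 0) (hb : b ≠ 0) :
    part Q (a * b) = part Q a * part Q b := by
  unfold part
  rw [((Nat.perm_primeFactorsList_mul ha hb).filter _).prod_eq, List.filter_append, List.prod_append]

lemma part_mul_part_not (Q : ℕ → Prop) {n : ℕ} (hn : n ≠ 0) :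
    part Q n * part (fun p => ¬ Q p) n = n := by
  unfold part
  have h := List.filter_append_perm (fun p => decide (Q p)) n.primeFactorsList
  have h2 := h.prod_eq
  rw [List.prod_append, Nat.prod_primeFactorsList hn] at h2
  simpa using h2

lemma part_ne_zero (Q : ℕ → Prop) (n : ℕ) : part Q n ≠ 0 := by
  unfold part
  apply List.prod_ne_zero
  intro h
  have := Nat.prime_of_mem_primeFactorsList (List.mem_of_mem_filter h)
  exact Nat.not_prime_zero this

lemma prime_dvd_part {Q : ℕ → Prop} {n p : ℕ} (hp : p.Prime) (h : p ∣ part Q n) : Q p := by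
  unfold part at h
  rw [hp.prime.dvd_prod_iff] at h
  obtain ⟨q, hq, hpq⟩ := h
  rw [List.mem_filter] at hq
  have hq' := Nat.prime_of_mem_primeFactorsList hq.1
  rw [Nat.prime_dvd_prime_iff_eq hp hq'] at hpq
  subst hpq
  simpa using hq.2

lemma part_dvd (Q : ℕ → Prop) {n : ℕ} (hn : n ≠ 0) : part Q n ∣ n :=
  ⟨_, (part_mul_part_not Q hn).symm⟩

lemma part_coprime (Q : ℕ → Prop) (n : ℕ) : Nat.Coprime (part Q n) (part (fun p => ¬ Q p) n) := by
  apply Nat.Coprime.symm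
  apply Nat.coprime_of_dvd
  intro p hp h1 h2
  exact prime_dvd_part hp h1 (prime_dvd_part hp h2)

lemma part_prime_pow (Q : ℕ → Prop) {p : ℕ} (hp : p.Prime) (k : ℕ) :
    part Q (p ^ k) = if Q p then p ^ k else 1 := by
  unfold part
  rw [hp.primeFactorsList_pow]
  split_ifs with h
  · rw [List.filter_replicate_of_pos (by simpa using h)]; simp
  · rw [List.filter_replicate_of_neg (by simpa using h)]; simp

lemma tau_le_two_pow (t : ℕ) (ht : t ≠ 0) : t.divisors.card ≤ 2 ^ t.primeFactorsList.length := by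
  have key : ∀ L : List ℕ, (∀ p ∈ L, p.Prime) → L.prod.divisors.card ≤ 2 ^ L.length := by
    intro L
    induction L with
    | nil => simp
    | cons p L ih =>
      intro h
      rw [List.prod_cons, List.length_cons, pow_succ]
      have h1 := ih (fun q hq => h q (List.mem_cons_of_mem _ hq))
      have hp := h p List.mem_cons_self
      have h2 : p.divisors.card = 2 := by
        have := tau_prime_pow hp 1
        simpa using this
      refine (tau_mul_le _ _).trans ?_
      rw [h2, mul_comm]
      omega
  have := key t.primeFactorsList (fun p hp => Nat.prime_of_mem_primeFactorsList hp)
  rwa [Nat.prod_primeFactorsList ht] at this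

lemma rough_bound (t : ℕ) (ht : 1 ≤ t) (Y V : ℝ) (hY : 1 < Y) (hV : (t : ℝ) ≤ V)
    (hp : ∀ p : ℕ, p.Prime → p ∣ t → Y ≤ p) :
    (t.divisors.card : ℝ) ≤ Real.exp (Real.log V / Real.log Y) := by
  have h1 : (t.divisors.card : ℝ) ≤ 2 ^ t.primeFactorsList.length := by
    exact_mod_cast tau_le_two_pow t (by omega)
  have htR : (0 : ℝ) < t := by exact_mod_cast ht
  have hlY := Real.log_pos hY
  have h2 : (t.primeFactorsList.length : ℝ) * Real.log Y ≤ Real.log V := by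
    have key : ∀ L : List ℕ, (∀ p ∈ L, Y ≤ (p : ℝ)) → Y ^ L.length ≤ (L.prod : ℝ) := by
      intro L
      induction L with
      | nil => simp
      | cons p L ih =>
        intro h
        rw [List.prod_cons, List.length_cons, pow_succ', Nat.cast_mul]
        have h1 := ih (fun q hq => h q (List.mem_cons_of_mem _ hq))
        have h2 := h p List.mem_cons_self
        gcongr
    have := key t.primeFactorsList (fun p hp' => hp p (Nat.prime_of_mem_primeFactorsList hp')
      (Nat.dvd_of_mem_primeFactorsList hp'))
    rw [Nat.prod_primeFactorsList (by omega)] at this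
    rw [← Real.log_pow]
    exact Real.log_le_log (by positivity) (this.trans hV)
  refine h1.trans ?_
  have h3 : (2 : ℝ) ≤ Real.exp 1 := by linarith [Real.exp_one_gt_d9]
  calc (2 : ℝ) ^ t.primeFactorsList.length ≤ Real.exp 1 ^ t.primeFactorsList.length := by gcongr
    _ = Real.exp (t.primeFactorsList.length) := by rw [← Real.exp_nat_mul, mul_one]
    _ ≤ _ := by
      gcongr
      rw [le_div_iff₀ hlY]; exact h2

/-- nonnegative multiplicative functions bounded by `τ^m` -/
structure GoodFn (m : ℕ) (f : ℕ → ℝ) : Prop where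
  one : f 1 = 1
  nonneg : ∀ n, 0 ≤ f n
  mul : ∀ a b : ℕ, 1 ≤ a → 1 ≤ b → Nat.Coprime a b → f (a * b) = f a * f b
  le : ∀ n : ℕ, 1 ≤ n → f n ≤ (n.divisors.card : ℝ) ^ m

lemma GoodFn.mul' {m : ℕ} {f : ℕ → ℝ} (hf : GoodFn m f) {a b : ℕ} (h : Nat.Coprime a b) :
    f (a * b) = f a * f b := by
  rcases Nat.eq_zero_or_pos a with rfl | ha
  · have : b = 1 := by simpa using h
    subst this
    simp [hf.one]
  rcases Nat.eq_zero_or_pos b with rfl | hb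
  · have : a = 1 := by simpa using h
    subst this
    simp [hf.one]
  exact hf.mul a b ha hb h

lemma goodFn_tau (m : ℕ) : GoodFn m (fun n => (n.divisors.card : ℝ) ^ m) where
  one := by simp
  nonneg n := by positivity
  mul a b _ _ h := by
    rw [Nat.Coprime.card_divisors_mul h]; push_cast; rw [mul_pow]
  le n _ := le_refl _

lemma B1 (m : ℕ) : ∃ K : ℝ, 0 < K ∧ ∀ f : ℕ → ℝ, GoodFn m f → ∀ s T : Finset ℕ,
    (∀ t ∈ T, t ∈ Nat.factoredNumbers s) →
    ∑ t ∈ T, f t / t ≤ K * ∏ p ∈ s.filter Nat.Prime, (1 + f p / p) := by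
  obtain ⟨C, hC, hloc⟩ := local_series m
  obtain ⟨K, hK, hsq⟩ := sum_inv_sq
  refine ⟨Real.exp (C * K), Real.exp_pos _, ?_⟩
  intro f hf s T hT
  have hy : ∀ p : ℕ, p.Prime → (1 : ℝ) / (p : ℝ) ≤ 3 / 4 := by
    intro p hp
    have h2 : (2 : ℝ) ≤ p := by exact_mod_cast hp.two_le
    rw [div_le_iff₀ (by positivity)]
    linarith
  have hterm : ∀ p : ℕ, p.Prime → ∀ k : ℕ, f (p ^ k) / ((p ^ k : ℕ) : ℝ) ≤ ((k : ℝ) + 1) ^ m * (1 / (p : ℝ)) ^ k := by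
    intro p hp k
    have h1 := hf.le (p ^ k) (Nat.pos_of_ne_zero (pow_ne_zero _ hp.ne_zero))
    rw [tau_prime_pow hp] at h1
    push_cast at h1 ⊢
    rw [one_div, inv_pow, ← div_eq_mul_inv]
    gcongr
  have hnn : ∀ n : ℕ, 0 ≤ f n / (n : ℝ) := fun n => div_nonneg (hf.nonneg n) (Nat.cast_nonneg n)
  have hsum : ∀ {p : ℕ}, p.Prime → Summable (fun k : ℕ => f (p ^ k) / ((p ^ k : ℕ) : ℝ)) := by
    intro p hp
    exact Summable.of_nonneg_of_le (fun k => hnn _) (hterm p hp) (hloc _ (by positivity) (hy p hp)).1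
  have h := sum_le_euler (fun n => f n / (n : ℝ)) (by simp [hf.one]) hnn
    (fun {a b} hab => by
      show f (a * b) / ((a * b : ℕ) : ℝ) = f a / (a : ℝ) * (f b / (b : ℝ))
      rw [hf.mul' hab]; push_cast; rw [mul_div_mul_comm]) hsum s T hT
  refine h.trans ?_
  have hfac : ∀ p ∈ s.filter Nat.Prime, ∑' k : ℕ, f (p ^ k) / ((p ^ k : ℕ) : ℝ) ≤
      (1 + C * (1 / (p : ℝ) ^ 2)) * (1 + f p / p) := by
    intro p hp
    have hp' := (Finset.mem_filter.1 hp).2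
    obtain ⟨hs, hle⟩ := hloc (1 / (p : ℝ)) (by positivity) (hy p hp')
    have hd := hs.sub (hsum hp')
    have h2 : ∑ k ∈ Finset.range 2, (((k : ℝ) + 1) ^ m * (1 / (p : ℝ)) ^ k - f (p ^ k) / ((p ^ k : ℕ) : ℝ)) ≤
      ∑' k : ℕ, (((k : ℝ) + 1) ^ m * (1 / (p : ℝ)) ^ k - f (p ^ k) / ((p ^ k : ℕ) : ℝ)) :=
      hd.sum_le_tsum _ (fun k _ => sub_nonneg.2 (hterm p hp' k))
    rw [hs.tsum_sub (hsum hp'), Finset.sum_range_succ, Finset.sum_range_one] at h2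
    have h0 : 0 ≤ C * (1 / (p : ℝ) ^ 2) * (f p / p) := by
      have := hnn p
      positivity
    have e1 : (1 / (p : ℝ)) ^ 2 = 1 / (p : ℝ) ^ 2 := by rw [div_pow, one_pow]
    rw [e1] at hle
    generalize (∑' k : ℕ, ((k : ℝ) + 1) ^ m * (1 / (p : ℝ)) ^ k) = S1 at *
    generalize (∑' k : ℕ, f (p ^ k) / ((p ^ k : ℕ) : ℝ)) = S2 at *
    simp only [pow_zero, pow_one, hf.one, Nat.cast_zero, Nat.cast_one, zero_add, one_pow, div_one, mul_one, sub_self] at h2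
    rw [one_add_one_eq_two] at h2
    have : (1 + C * (1 / (p : ℝ) ^ 2)) * (1 + f p / p) = 1 + f p / p + C * (1 / (p : ℝ) ^ 2) + C * (1 / (p : ℝ) ^ 2) * (f p / p) := by ring
    rw [this]
    linarith
  refine (Finset.prod_le_prod (fun p _ => tsum_nonneg (fun k => hnn _)) hfac).trans ?_
  rw [Finset.prod_mul_distrib]
  have hprod : 0 ≤ ∏ p ∈ s.filter Nat.Prime, (1 + f p / p) :=
    Finset.prod_nonneg (fun p _ => by linarith [hnn p])
  apply mul_le_mul_of_nonneg_right _ hprod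
  refine (prod_le_exp _ _ (fun p _ => by positivity)).trans ?_
  rw [← Finset.mul_sum]
  gcongr
  exact hsq _

lemma two_pow_omega_le (d : ℕ) (hd : d ≠ 0) : 2 ^ d.primeFactors.card ≤ d.divisors.card := by
  rw [Nat.card_divisors hd, ← Finset.prod_const]
  apply Finset.prod_le_prod'
  intro p hp
  have := (Nat.prime_of_mem_primeFactors hp).factorization_pos_of_dvd hd (Nat.dvd_of_mem_primeFactors hp)
  omega

lemma B2 (m : ℕ) : ∃ K : ℝ, 0 < K ∧ ∀ f : ℕ → ℝ, GoodFn m f → ∀ Y d : ℕ, 1 ≤ d → ∀ T : Finset ℕ,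
    (∀ t ∈ T, t ∈ Nat.factoredNumbers (pr Y) ∧ d ∣ t) →
    ∑ t ∈ T, f t / t ≤ K * ((d.divisors.card : ℝ) ^ (2 * m + 1) / d) * ∏ p ∈ pr Y, (1 + f p / p) := by
  obtain ⟨K, hK, hB⟩ := B1 m
  refine ⟨K * K, by positivity, ?_⟩
  intro f hf Y d hd T hT
  have hnn : ∀ n : ℕ, 0 ≤ f n / (n : ℝ) := fun n => div_nonneg (hf.nonneg n) (Nat.cast_nonneg n)
  set Q : ℕ → Prop := fun p => p ∣ d with hQ
  set G : ℕ → ℕ := fun a => part Q a / d with hG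
  set H : ℕ → ℕ := fun a => part (fun p => ¬ Q p) a with hH
  have hprop : ∀ a ∈ T, a ≠ 0 ∧ d * G a = part Q a ∧ a = d * G a * H a ∧ G a ≠ 0 := by
    intro a ha
    obtain ⟨h1, h2⟩ := hT a ha
    have ha0 : a ≠ 0 := Nat.ne_zero_of_mem_factoredNumbers h1
    have hdv : d ∣ part Q a := by
      have hc : Nat.Coprime d (H a) := by
        apply Nat.Coprime.symm
        apply Nat.coprime_of_dvd
        intro p hp h3 h4
        exact prime_dvd_part hp h3 h4
      rw [← part_mul_part_not Q ha0] at h2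
      exact hc.dvd_of_dvd_mul_right h2
    have e1 : d * G a = part Q a := Nat.mul_div_cancel' hdv
    refine ⟨ha0, e1, ?_, ?_⟩
    · rw [e1]; exact (part_mul_part_not Q ha0).symm
    · intro h0
      rw [h0, mul_zero] at e1
      exact part_ne_zero Q a e1.symm
  set A := T.image G with hA
  set B := T.image H with hBdef
  have hterm : ∀ a ∈ T, f a / a ≤ ((d.divisors.card : ℝ) ^ m / d) *
      (((G a).divisors.card : ℝ) ^ m / (G a) * (f (H a) / (H a))) := by
    intro a ha
    obtain ⟨ha0, e1, e2, hg0⟩ := hprop a ha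
    have hH0 : H a ≠ 0 := part_ne_zero _ a
    have hfa : f a = f (part Q a) * f (H a) := by
      conv_lhs => rw [← part_mul_part_not Q ha0]
      exact hf.mul' (part_coprime Q a)
    have h3 : f (part Q a) ≤ (d.divisors.card : ℝ) ^ m * ((G a).divisors.card : ℝ) ^ m := by
      refine (hf.le _ (Nat.pos_of_ne_zero (part_ne_zero Q a))).trans ?_
      rw [← mul_pow, ← e1]
      apply pow_le_pow_left₀ (Nat.cast_nonneg _)
      exact_mod_cast tau_mul_le d (G a)
    have hcast : (a : ℝ) = d * (G a : ℝ) * (H a : ℝ) := by exact_mod_cast e2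
    rw [hfa]
    have hpos : (0 : ℝ) < a := by exact_mod_cast Nat.pos_of_ne_zero ha0
    calc f (part Q a) * f (H a) / a ≤ ((d.divisors.card : ℝ) ^ m * ((G a).divisors.card : ℝ) ^ m) * f (H a) / a := by
          have := hf.nonneg (H a)
          gcongr
      _ = _ := by
          rw [hcast, div_mul_div_comm, div_mul_div_comm, mul_assoc, mul_assoc]
  have hinj : Set.InjOn (fun a => (G a, H a)) T := by
    intro a ha b hb hab
    simp only [Prod.mk.injEq] at hab
    rw [(hprop a ha).2.2.1, (hprop b hb).2.2.1, hab.1, hab.2]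
  have h1 : ∑ t ∈ T, f t / t ≤ ((d.divisors.card : ℝ) ^ m / d) *
      ((∑ g ∈ A, (g.divisors.card : ℝ) ^ m / g) * ∑ b ∈ B, f b / b) := by
    refine (Finset.sum_le_sum hterm).trans ?_
    rw [← Finset.mul_sum]
    apply mul_le_mul_of_nonneg_left _ (by positivity)
    rw [Finset.sum_mul_sum, ← Finset.sum_product']
    rw [← Finset.sum_image (f := fun x : ℕ × ℕ => (x.1.divisors.card : ℝ) ^ m / x.1 * (f x.2 / x.2)) hinj]
    apply Finset.sum_le_sum_of_subset_of_nonneg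
    · intro x hx
      rw [Finset.mem_image] at hx
      obtain ⟨a, ha, rfl⟩ := hx
      exact Finset.mem_product.2 ⟨Finset.mem_image_of_mem _ ha, Finset.mem_image_of_mem _ ha⟩
    · intro x _ _
      have := hnn x.2
      positivity
  have h2 : ∑ g ∈ A, (g.divisors.card : ℝ) ^ m / g ≤ K * (d.divisors.card : ℝ) ^ (m + 1) := by
    refine (hB _ (goodFn_tau m) d.primeFactors A ?_).trans ?_
    · intro g hg
      rw [hA, Finset.mem_image] at hg
      obtain ⟨a, ha, rfl⟩ := hg
      obtain ⟨ha0, e1, e2, hg0⟩ := hprop a ha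
      rw [Nat.mem_factoredNumbers_iff_primeFactors_subset]
      refine ⟨hg0, ?_⟩
      intro p hp
      have hp' := Nat.prime_of_mem_primeFactors hp
      rw [Nat.mem_primeFactors]
      refine ⟨hp', ?_, by omega⟩
      have : p ∣ part Q a := by
        rw [← e1]; exact (Nat.dvd_of_mem_primeFactors hp).mul_left d
      exact prime_dvd_part (Q := Q) hp' this
    · gcongr
      have e : d.primeFactors.filter Nat.Prime = d.primeFactors :=
        Finset.filter_true_of_mem (fun p hp => Nat.prime_of_mem_primeFactors hp)
      rw [e]
      calc ∏ p ∈ d.primeFactors, (1 + (p.divisors.card : ℝ) ^ m / p) ≤ ∏ p ∈ d.primeFactors, (2 : ℝ) ^ (m + 1) := by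
            apply Finset.prod_le_prod
            · intro p _; positivity
            · intro p hp
              have hp' := Nat.prime_of_mem_primeFactors hp
              have : p.divisors.card = 2 := by
                have := tau_prime_pow hp' 1
                simpa using this
              rw [this]
              have h2 : (1 : ℝ) ≤ p := by exact_mod_cast hp'.one_le
              have h3 : ((2 : ℕ) : ℝ) ^ m / p ≤ 2 ^ m := by
                push_cast
                exact div_le_self (by positivity) h2
              have h4 : (1 : ℝ) ≤ 2 ^ m := one_le_pow₀ (by norm_num)
              rw [pow_succ]
              linarith
        _ = ((2 : ℝ) ^ d.primeFactors.card) ^ (m + 1) := by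
            rw [Finset.prod_const, ← pow_mul, ← pow_mul, mul_comm]
        _ ≤ _ := by
            gcongr
            exact_mod_cast two_pow_omega_le d (by omega)
  have h3 : ∑ b ∈ B, f b / b ≤ K * ∏ p ∈ pr Y, (1 + f p / p) := by
    have e : (pr Y).filter Nat.Prime = pr Y :=
      Finset.filter_true_of_mem (fun p hp => (mem_pr.1 hp).1)
    have := hB f hf (pr Y) B ?_
    · rwa [e] at this
    · intro b hb
      rw [hBdef, Finset.mem_image] at hb
      obtain ⟨a, ha, rfl⟩ := hb
      exact Nat.mem_factoredNumbers_of_dvd (hT a ha).1 (part_dvd _ (hprop a ha).1)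
  have h3' : 0 ≤ ∑ b ∈ B, f b / b := Finset.sum_nonneg (fun b _ => hnn b)
  refine h1.trans ?_
  calc _ ≤ ((d.divisors.card : ℝ) ^ m / d) * ((K * (d.divisors.card : ℝ) ^ (m + 1)) *
        (K * ∏ p ∈ pr Y, (1 + f p / p))) := by gcongr
    _ = _ := by ring

lemma B3 (m : ℕ) : ∃ K : ℝ, 0 < K ∧ ∀ f₁ f₂ : ℕ → ℝ, GoodFn m f₁ → GoodFn m f₂ → ∀ Y l : ℕ, 1 ≤ l →
    ∀ T : Finset ℕ, (∀ t ∈ T, t ∈ Nat.factoredNumbers (pr Y)) →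
    ∑ x ∈ (T ×ˢ T).filter (fun x => Nat.gcd x.1 x.2 ∣ l),
      f₁ x.1 * f₂ x.2 * ((Nat.gcd x.1 x.2 : ℝ) / (x.1 * x.2)) ≤
    K * l.divisors.card * ∏ p ∈ pr Y, ((1 + f₁ p / p) * (1 + f₂ p / p)) := by
  obtain ⟨K, hK, hB⟩ := B2 m
  obtain ⟨C, hC, htau⟩ := tau_pow_le (2 * (2 * m + 1))
  refine ⟨K * K * C, by positivity, ?_⟩
  intro f₁ f₂ hf₁ hf₂ Y l hl T hT
  have hn1 : ∀ n : ℕ, 0 ≤ f₁ n / (n : ℝ) := fun n => div_nonneg (hf₁.nonneg n) (Nat.cast_nonneg n)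
  have hn2 : ∀ n : ℕ, 0 ≤ f₂ n / (n : ℝ) := fun n => div_nonneg (hf₂.nonneg n) (Nat.cast_nonneg n)
  set P₁ := ∏ p ∈ pr Y, (1 + f₁ p / p) with hP₁
  set P₂ := ∏ p ∈ pr Y, (1 + f₂ p / p) with hP₂
  have hP₁0 : 0 ≤ P₁ := Finset.prod_nonneg (fun p _ => by linarith [hn1 p])
  have hP₂0 : 0 ≤ P₂ := Finset.prod_nonneg (fun p _ => by linarith [hn2 p])
  rw [Finset.prod_mul_distrib]
  have h1 : ∑ x ∈ (T ×ˢ T).filter (fun x => Nat.gcd x.1 x.2 ∣ l),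
      f₁ x.1 * f₂ x.2 * ((Nat.gcd x.1 x.2 : ℝ) / (x.1 * x.2)) ≤
      ∑ d ∈ l.divisors, (d : ℝ) * ((∑ a ∈ T.filter (fun a => d ∣ a), f₁ a / a) *
        ∑ b ∈ T.filter (fun b => d ∣ b), f₂ b / b) := by
    have e : ∀ d : ℕ, (d : ℝ) * ((∑ a ∈ T.filter (fun a => d ∣ a), f₁ a / a) *
        ∑ b ∈ T.filter (fun b => d ∣ b), f₂ b / b) =
        ∑ x ∈ T ×ˢ T, if d ∣ x.1 ∧ d ∣ x.2 then (d : ℝ) * (f₁ x.1 / x.1 * (f₂ x.2 / x.2)) else 0 := by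
      intro d
      rw [Finset.sum_mul_sum, ← Finset.sum_product', Finset.mul_sum, ← Finset.sum_filter]
      apply Finset.sum_congr _ (fun _ _ => rfl)
      ext x
      simp only [Finset.mem_product, Finset.mem_filter]
      tauto
    simp only [e]
    rw [Finset.sum_comm, Finset.sum_filter]
    apply Finset.sum_le_sum
    intro x _
    have hnn : ∀ d ∈ l.divisors, 0 ≤ (if d ∣ x.1 ∧ d ∣ x.2 then (d : ℝ) * (f₁ x.1 / x.1 * (f₂ x.2 / x.2)) else 0) := by
      intro d _
      have := hn1 x.1
      have := hn2 x.2
      split_ifs <;> positivity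
    split_ifs with hg
    · have := Finset.single_le_sum hnn (Nat.mem_divisors.2 ⟨hg, by omega⟩)
      rw [if_pos ⟨Nat.gcd_dvd_left _ _, Nat.gcd_dvd_right _ _⟩] at this
      refine le_trans (le_of_eq ?_) this
      rw [div_mul_div_comm]
      ring
    · exact Finset.sum_nonneg hnn
  refine h1.trans ?_
  have h2 : ∀ d ∈ l.divisors, (d : ℝ) * ((∑ a ∈ T.filter (fun a => d ∣ a), f₁ a / a) *
        ∑ b ∈ T.filter (fun b => d ∣ b), f₂ b / b) ≤ K * K * C * (P₁ * P₂) := by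
    intro d hd
    have hd1 : 1 ≤ d := Nat.pos_of_mem_divisors hd
    have hdR : (0 : ℝ) < d := by exact_mod_cast hd1
    have b1 := hB f₁ hf₁ Y d hd1 (T.filter (fun a => d ∣ a)) (fun t ht => by
      rw [Finset.mem_filter] at ht
      exact ⟨hT t ht.1, ht.2⟩)
    have b2 := hB f₂ hf₂ Y d hd1 (T.filter (fun a => d ∣ a)) (fun t ht => by
      rw [Finset.mem_filter] at ht
      exact ⟨hT t ht.1, ht.2⟩)
    have n2 : 0 ≤ ∑ b ∈ T.filter (fun b => d ∣ b), f₂ b / b := Finset.sum_nonneg (fun b _ => hn2 b)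
    rw [← hP₁] at b1
    rw [← hP₂] at b2
    calc _ ≤ (d : ℝ) * ((K * ((d.divisors.card : ℝ) ^ (2 * m + 1) / d) * P₁) *
          (K * ((d.divisors.card : ℝ) ^ (2 * m + 1) / d) * P₂)) := by gcongr
      _ = K * K * ((d.divisors.card : ℝ) ^ (2 * (2 * m + 1)) / d) * (P₁ * P₂) := by
          rw [two_mul (2 * m + 1), pow_add]
          field_simp
          try ring
      _ ≤ _ := by
          have : (d.divisors.card : ℝ) ^ (2 * (2 * m + 1)) / d ≤ C := by
            rw [div_le_iff₀ hdR]; exact htau d hd1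
          gcongr
  refine (Finset.sum_le_sum h2).trans ?_
  rw [Finset.sum_const, nsmul_eq_mul]
  exact le_of_eq (by ring)

lemma sum_inv_dvd (L : ℝ) (hL : 3 ≤ L) (n : ℕ) (hn : 1 ≤ n) (hnL : Real.log n ≤ 3 * L) :
    ∑ p ∈ n.primeFactors, (1 : ℝ) / p ≤ 8 * Real.log (Real.log L) + 21 := by
  have hL0 : 0 < L := by linarith
  have hω : (n.primeFactors.card : ℝ) ≤ 5 * L := by
    have h1 : 2 ^ n.primeFactors.card ≤ n :=
      (two_pow_omega_le n (by omega)).trans (Nat.card_divisors_le_self n)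
    have h2 : ((2 : ℝ) ^ n.primeFactors.card) ≤ n := by exact_mod_cast h1
    have h3 := Real.log_le_log (by positivity) h2
    rw [Real.log_pow] at h3
    have h4 := Real.log_two_gt_d9
    have h5 : (0 : ℝ) ≤ n.primeFactors.card := Nat.cast_nonneg _
    nlinarith
  have hle : ∀ p ∈ n.primeFactors, (1 : ℝ) / p ≤ (if p ≤ ⌊L⌋₊ then (1 : ℝ) / p else 0) + 1 / L := by
    intro p hp
    split_ifs with h
    · have : 0 < 1 / L := by positivity
      linarith
    · rw [zero_add]
      have := Nat.lt_of_floor_lt (not_le.1 h)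
      exact one_div_le_one_div_of_le hL0 this.le
  refine (Finset.sum_le_sum hle).trans ?_
  rw [Finset.sum_add_distrib, Finset.sum_const, nsmul_eq_mul, ← Finset.sum_filter]
  have h1 : ∑ p ∈ n.primeFactors.filter (fun p => p ≤ ⌊L⌋₊), (1 : ℝ) / p ≤ ∑ p ∈ pr ⌊L⌋₊, (1 : ℝ) / p := by
    apply Finset.sum_le_sum_of_subset_of_nonneg
    · intro p hp
      rw [Finset.mem_filter] at hp
      exact mem_pr.2 ⟨Nat.prime_of_mem_primeFactors hp.1, hp.2⟩
    · intro _ _ _; positivity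
  have h2 := sum_inv_le L hL
  have h3 : (n.primeFactors.card : ℝ) * (1 / L) ≤ 5 := by
    rw [mul_one_div, div_le_iff₀ hL0]; exact hω
  linarith

lemma one_sub_ge (p : ℕ) (hp : 2 ≤ p) : 1 ≤ (1 - 1 / (p : ℝ)) * Real.exp (2 * (1 / (p : ℝ))) := by
  have h2 : (2 : ℝ) ≤ p := by exact_mod_cast hp
  set t : ℝ := 1 / (p : ℝ) with ht
  have ht0 : 0 ≤ t := by positivity
  have ht1 : t ≤ 1 / 2 := one_div_le_one_div_of_le (by norm_num) h2
  have h3 := Real.add_one_le_exp (2 * t)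
  calc (1 : ℝ) ≤ (1 - t) * (2 * t + 1) := by nlinarith
    _ ≤ _ := by gcongr; linarith

lemma prod_P_le (W n : ℕ) (hW : 2 ≤ W) (S : ℝ) (hn : n ≠ 0)
    (hS : ∑ p ∈ n.primeFactors, (1 : ℝ) / p ≤ S) :
    ∏ p ∈ (pr W).filter (fun p => ¬ p ∣ n), (1 - 2 / (p : ℝ)) ≤ (Real.exp (2 * S) / Real.log W) ^ 2 := by
  have hlW : 0 < Real.log W := Real.log_pos (by exact_mod_cast hW)
  have hge : ∀ p ∈ pr W, (0 : ℝ) ≤ 1 - 1 / (p : ℝ) ∧ (0 : ℝ) ≤ 1 - 2 / (p : ℝ) := by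
    intro p hp
    have h2 : (2 : ℝ) ≤ p := by exact_mod_cast (mem_pr.1 hp).1.two_le
    have h3 : 2 / (p : ℝ) ≤ 1 := by rw [div_le_one (by linarith)]; exact h2
    have h4 : 1 / (p : ℝ) ≤ 1 := by rw [div_le_one (by linarith)]; linarith
    constructor <;> linarith
  have h1 : ∏ p ∈ (pr W).filter (fun p => ¬ p ∣ n), (1 - 2 / (p : ℝ)) ≤
      (∏ p ∈ (pr W).filter (fun p => ¬ p ∣ n), (1 - 1 / (p : ℝ))) ^ 2 := by
    rw [← Finset.prod_pow]
    apply Finset.prod_le_prod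
    · intro p hp; exact (hge p (Finset.mem_filter.1 hp).1).2
    · intro p _
      have : (1 - 1 / (p : ℝ)) ^ 2 = 1 - 2 / (p : ℝ) + (1 / (p : ℝ)) ^ 2 := by ring
      rw [this]
      have : 0 ≤ (1 / (p : ℝ)) ^ 2 := by positivity
      linarith
  refine h1.trans ?_
  apply pow_le_pow_left₀
  · exact Finset.prod_nonneg (fun p hp => (hge p (Finset.mem_filter.1 hp).1).1)
  rw [le_div_iff₀ hlW]
  have h2 := prod_one_sub_inv_le W (by omega)
  have h3 := Finset.prod_filter_mul_prod_filter_not (pr W) (fun p => p ∣ n) (fun p => 1 - 1 / (p : ℝ))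
  set A := ∏ p ∈ (pr W).filter (fun p => ¬ p ∣ n), (1 - 1 / (p : ℝ)) with hA
  set B := ∏ p ∈ (pr W).filter (fun p => p ∣ n), (1 - 1 / (p : ℝ)) with hB
  have hA0 : 0 ≤ A := Finset.prod_nonneg (fun p hp => (hge p (Finset.mem_filter.1 hp).1).1)
  have h4 : 1 ≤ B * Real.exp (2 * S) := by
    have h5 : 1 ≤ B * Real.exp (∑ p ∈ (pr W).filter (fun p => p ∣ n), 2 * (1 / (p : ℝ))) := by
      rw [Real.exp_sum, hB, ← Finset.prod_mul_distrib]
      exact Finset.one_le_prod (fun p hp => one_sub_ge p (mem_pr.1 (Finset.mem_filter.1 hp).1).1.two_le)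
    refine h5.trans ?_
    have hB0 : 0 ≤ B := Finset.prod_nonneg (fun p hp => (hge p (Finset.mem_filter.1 hp).1).1)
    apply mul_le_mul_of_nonneg_left _ hB0
    apply Real.exp_le_exp.2
    rw [← Finset.mul_sum]
    refine mul_le_mul_of_nonneg_left ?_ (by norm_num)
    refine le_trans ?_ hS
    apply Finset.sum_le_sum_of_subset_of_nonneg
    · intro p hp
      rw [Finset.mem_filter] at hp
      exact Nat.mem_primeFactors.2 ⟨(mem_pr.1 hp.1).1, hp.2, hn⟩
    · intro _ _ _; positivity
  rw [← h3] at h2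
  calc A * Real.log W ≤ A * Real.log W * (B * Real.exp (2 * S)) := le_mul_of_one_le_right (by positivity) h4
    _ = (Real.log W * (B * A)) * Real.exp (2 * S) := by ring
    _ ≤ 1 * Real.exp (2 * S) := by gcongr
    _ = _ := one_mul _

open Filter in
lemma large_x (δ : ℝ) (hδ : 0 < δ) : ∃ x₀ : ℝ, ∀ x : ℝ, x₀ ≤ x →
    3 ≤ x ∧ 3 ≤ Real.log x ∧ 1 ≤ Real.log (Real.log x) ∧
    480 * Real.log (Real.log x) ≤ Real.log x ∧
    (Real.log (Real.log x)) ^ 34 ≤ (Real.log x) ^ δ ∧ (Real.log x) ^ 2 ≤ x ^ ((1 : ℝ) / 4) := by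
  have hlog := Real.tendsto_log_atTop
  have h1 : ∀ᶠ x : ℝ in atTop, 3 ≤ x := eventually_ge_atTop 3
  have h2 : ∀ᶠ x : ℝ in atTop, 3 ≤ Real.log x := hlog.eventually_ge_atTop 3
  have h3 : ∀ᶠ x : ℝ in atTop, 1 ≤ Real.log (Real.log x) := (hlog.comp hlog).eventually_ge_atTop 1
  have h4 : ∀ᶠ y : ℝ in atTop, 480 * Real.log y ≤ y := by
    have := (Real.isLittleO_log_id_atTop.bound (show (0 : ℝ) < 1 / 480 by norm_num))
    filter_upwards [this, eventually_ge_atTop 1] with y hy hy1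
    rw [Real.norm_of_nonneg (Real.log_nonneg hy1), id, Real.norm_of_nonneg (by linarith)] at hy
    linarith
  have h5 : ∀ᶠ y : ℝ in atTop, (Real.log y) ^ 34 ≤ y ^ δ := by
    have := ((isLittleO_log_rpow_atTop (show 0 < δ / 34 by positivity)).bound (show (0 : ℝ) < 1 by norm_num))
    filter_upwards [this, eventually_ge_atTop 1] with y hy hy1
    rw [Real.norm_of_nonneg (Real.log_nonneg hy1), Real.norm_of_nonneg (by positivity), one_mul] at hy
    calc (Real.log y) ^ 34 ≤ (y ^ (δ / 34)) ^ 34 := by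
          apply pow_le_pow_left₀ (Real.log_nonneg hy1) hy
      _ = y ^ δ := by
          rw [← Real.rpow_natCast, ← Real.rpow_mul (by linarith)]
          norm_num
  have h6 : ∀ᶠ y : ℝ in atTop, (Real.log y) ^ 2 ≤ y ^ ((1 : ℝ) / 4) := by
    have := ((isLittleO_log_rpow_atTop (show (0 : ℝ) < 1 / 8 by positivity)).bound (show (0 : ℝ) < 1 by norm_num))
    filter_upwards [this, eventually_ge_atTop 1] with y hy hy1
    rw [Real.norm_of_nonneg (Real.log_nonneg hy1), Real.norm_of_nonneg (by positivity), one_mul] at hy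
    calc (Real.log y) ^ 2 ≤ (y ^ ((1 : ℝ) / 8)) ^ 2 := by
          apply pow_le_pow_left₀ (Real.log_nonneg hy1) hy
      _ = _ := by
          rw [← Real.rpow_natCast, ← Real.rpow_mul (by linarith)]
          norm_num
  have := (((((h1.and h2).and h3).and (hlog.eventually h4)).and (hlog.eventually h5)).and h6)
  obtain ⟨x₀, h⟩ := eventually_atTop.1 this
  refine ⟨x₀, fun x hx => ?_⟩
  obtain ⟨⟨⟨⟨⟨a, b⟩, c⟩, d⟩, e⟩, f⟩ := h x hx
  exact ⟨a, b, c, d, e, f⟩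

/-- sieving level -/
noncomputable def lev (x : ℝ) : ℕ := ⌊Real.exp (Real.log x / (240 * Real.log (Real.log x)))⌋₊

set_option maxHeartbeats 2000000 in
lemma sieve (δ : ℝ) (hδ : 0 < δ) : ∃ C : ℝ, 0 < C ∧ ∃ x₀ : ℝ, ∀ x : ℝ, x₀ ≤ x → ∀ a b : ℕ, 1 ≤ a → 1 ≤ b →
    (a : ℝ) ≤ x ^ ((1 : ℝ) / 4) → (b : ℝ) ≤ x ^ ((1 : ℝ) / 4) → ∀ l : ℤ, l ≠ 0 → (|l| : ℝ) ≤ x →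
    ((Nat.gcd a b : ℕ) : ℤ) ∣ l →
    (((Finset.Icc 1 ⌊x⌋₊).filter fun n : ℕ => (a ∣ n ∧ (b : ℤ) ∣ (n : ℤ) + l) ∧
      ∀ p ∈ (pr (lev x)).filter (fun p => ¬ p ∣ a * b * l.natAbs), ¬ p ∣ n ∧ ¬ (p : ℤ) ∣ (n : ℤ) + l).card : ℝ)
      ≤ C * x * ((Nat.gcd a b : ℝ) / (a * b)) * ((Real.log x) ^ δ / (Real.log x) ^ 2) := by
  obtain ⟨x₀, hx₀⟩ := large_x δ hδ
  refine ⟨480 ^ 2 * Real.exp 84 + Real.exp 88 + Real.exp 2, by positivity, x₀, ?_⟩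
  intro x hx a b ha hb hax hbx l hl hlx hdvd
  obtain ⟨hx3, hL3, hLL1, h480, hpow, hL4⟩ := hx₀ x hx
  set L := Real.log x with hL
  set LL := Real.log L with hLL
  have hL0 : 0 < L := by linarith
  have hLL0 : 0 < LL := by linarith
  have hx0 : 0 < x := by linarith
  set u := L / (240 * LL) with hu
  have hu2 : 2 ≤ u := by rw [hu, le_div_iff₀ (by positivity)]; linarith
  set W := lev x with hW
  have hWe : (W : ℝ) ≤ Real.exp u := Nat.floor_le (Real.exp_pos _).le
  have hexp2 : (4 : ℝ) ≤ Real.exp u := by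
    have h1 : Real.exp 2 ≤ Real.exp u := Real.exp_le_exp.2 hu2
    have h2 : Real.exp 2 = Real.exp 1 * Real.exp 1 := by rw [← Real.exp_add]; norm_num
    have := Real.exp_one_gt_d9
    nlinarith
  have hWlt : Real.exp u < W + 1 := Nat.lt_floor_add_one _
  have hW2 : 2 ≤ W := by
    have : (3 : ℝ) ≤ Real.exp u := by linarith
    have h3 : (2 : ℝ) < W := by
      have : (3 : ℝ) < W + 1 := by linarith
      linarith
    have : 2 < W := by exact_mod_cast h3
    omega
  have hW2R : (2 : ℝ) ≤ W := by exact_mod_cast hW2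
  have hlogW : u / 2 ≤ Real.log W := by
    have h1 : Real.exp u / 2 ≤ W := by linarith
    have h2 := Real.log_le_log (by positivity) h1
    rw [Real.log_div (Real.exp_pos _).ne' (by norm_num), Real.log_exp] at h2
    have := Real.log_two_lt_d9
    linarith
  have hlogW0 : 0 < Real.log W := by linarith
  -- the modulus
  set n := a * b * l.natAbs with hn
  have hlabs : 1 ≤ l.natAbs := Int.natAbs_pos.2 hl
  have hn1 : 1 ≤ n := Nat.mul_pos (Nat.mul_pos ha hb) hlabs
  have hx14 : x ^ ((1 : ℝ) / 4) ≤ x := by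
    conv_rhs => rw [← Real.rpow_one x]
    exact Real.rpow_le_rpow_of_exponent_le (by linarith) (by norm_num)
  have hnL : Real.log n ≤ 3 * L := by
    have : (n : ℝ) ≤ x ^ 3 := by
      rw [hn]; push_cast
      have h1 : ((l.natAbs : ℕ) : ℝ) ≤ x := by
        rw [Nat.cast_natAbs]; exact_mod_cast hlx
      calc (a : ℝ) * b * (l.natAbs : ℝ) ≤ x * x * x := by
            have := hax.trans hx14
            have := hbx.trans hx14
            gcongr
        _ = x ^ 3 := by ring
    have h2 := Real.log_le_log (by exact_mod_cast hn1) this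
    rw [Real.log_pow] at h2
    exact_mod_cast h2
  have hsumn := sum_inv_dvd L hL3 n hn1 hnL
  have hprodP := prod_P_le W n hW2 _ (by omega) hsumn
  set P := (pr W).filter (fun p => ¬ p ∣ n) with hP
  -- r
  set r := 2 * ⌈25 * LL⌉₊ with hr
  have hr1 : 50 * LL ≤ r := by
    have := Nat.le_ceil (25 * LL)
    rw [hr]; push_cast; linarith
  have hr2 : (r : ℝ) ≤ 60 * LL := by
    have := (Nat.ceil_lt_add_one (show 0 ≤ 25 * LL by positivity))
    rw [hr]; push_cast; linarith
  have hbrun := brun a b ⌊x⌋₊ ha hb l hdvd P ?_ r (by rw [hr]; exact even_two_mul _) (W : ℝ) (by linarith)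
  swap
  · intro p hp
    rw [hP, Finset.mem_filter, mem_pr] at hp
    refine ⟨hp.1.1, fun h => hp.2 ?_, fun h => hp.2 ?_, fun h => hp.2 ?_⟩
    · exact (h.mul_right b).mul_right _
    · exact (h.mul_left a).mul_right _
    · exact (Int.natCast_dvd.1 h).mul_left _
  refine hbrun.trans ?_
  have hN : ((⌊x⌋₊ : ℕ) : ℝ) ≤ x := Nat.floor_le hx0.le
  have haR : (1 : ℝ) ≤ a := by exact_mod_cast ha
  have hbR : (1 : ℝ) ≤ b := by exact_mod_cast hb
  have hlcm : ((⌊x⌋₊ : ℕ) : ℝ) / (Nat.lcm a b : ℝ) ≤ x * ((Nat.gcd a b : ℝ) / (a * b)) := by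
    have h1 : ((Nat.gcd a b : ℕ) : ℝ) * (Nat.lcm a b : ℝ) = a * b := by exact_mod_cast Nat.gcd_mul_lcm a b
    have h2 : (0 : ℝ) < Nat.gcd a b := by exact_mod_cast Nat.gcd_pos_of_pos_left b ha
    have h3 : (0 : ℝ) < Nat.lcm a b := by exact_mod_cast Nat.lcm_pos ha hb
    have h4 : ((Nat.gcd a b : ℝ) / (a * b)) = 1 / (Nat.lcm a b : ℝ) := by
      rw [← h1]; field_simp
    rw [h4, mul_one_div]
    gcongr
  set X := x * ((Nat.gcd a b : ℝ) / (a * b)) with hX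
  have hX0 : 0 ≤ X := by positivity
  have hLδ1 : 1 ≤ L ^ δ := Real.one_le_rpow (by linarith) hδ.le
  set D := L ^ δ / L ^ 2 with hD
  have hD0 : 0 ≤ D := by positivity
  -- main term
  have m1 : ∏ p ∈ P, (1 - 2 / (p : ℝ)) ≤ 480 ^ 2 * Real.exp 84 * D := by
    refine hprodP.trans ?_
    have e1 : Real.exp (2 * (8 * Real.log LL + 21)) = LL ^ 16 * Real.exp 42 := by
      rw [show 2 * (8 * Real.log LL + 21) = (16 : ℕ) * Real.log LL + 42 by push_cast; ring, Real.exp_add,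
        Real.exp_nat_mul, Real.exp_log hLL0]
    rw [show Real.log L = LL from rfl, e1]
    have e2 : LL ^ 16 * Real.exp 42 / Real.log W ≤ 480 * Real.exp 42 * (LL ^ 17 / L) := by
      have : 1 / Real.log W ≤ 480 * LL / L := by
        rw [div_le_div_iff₀ hlogW0 hL0]
        have h1 : L = u * (240 * LL) := by rw [hu]; field_simp
        rw [h1]
        nlinarith
      calc LL ^ 16 * Real.exp 42 / Real.log W = LL ^ 16 * Real.exp 42 * (1 / Real.log W) := by ring
        _ ≤ LL ^ 16 * Real.exp 42 * (480 * LL / L) := by gcongr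
        _ = _ := by ring
    calc _ ≤ (480 * Real.exp 42 * (LL ^ 17 / L)) ^ 2 := by
          apply pow_le_pow_left₀ (by positivity) e2
      _ = 480 ^ 2 * Real.exp 84 * (LL ^ 34 / L ^ 2) := by
          rw [show (84 : ℝ) = 42 + 42 by norm_num, Real.exp_add]; ring
      _ ≤ _ := by rw [hD]; gcongr
  have hsumP : ∑ p ∈ P, (1 : ℝ) / p ≤ 8 * LL + 16 := by
    refine le_trans ?_ (sum_inv_le x hx3)
    apply Finset.sum_le_sum_of_subset_of_nonneg
    · refine (Finset.filter_subset _ _).trans (pr_mono ?_)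
      apply Nat.floor_le_floor
      calc Real.exp u ≤ Real.exp L := by
            apply Real.exp_le_exp.2
            rw [hu]
            apply div_le_self hL0.le
            linarith
        _ = x := Real.exp_log hx0
    · intro _ _ _; positivity
  have m2 : Real.exp (-(r : ℝ)) * ∏ p ∈ P, (1 + Real.exp 1 * (2 / (p : ℝ))) ≤ Real.exp 88 * D := by
    have h1 : ∏ p ∈ P, (1 + Real.exp 1 * (2 / (p : ℝ))) ≤ Real.exp (2 * Real.exp 1 * (8 * LL + 16)) := by
      refine (prod_le_exp P _ (fun p _ => by positivity)).trans ?_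
      apply Real.exp_le_exp.2
      have : ∑ p ∈ P, Real.exp 1 * (2 / (p : ℝ)) = 2 * Real.exp 1 * ∑ p ∈ P, (1 : ℝ) / p := by
        rw [Finset.mul_sum]
        apply Finset.sum_congr rfl
        intro p _; ring
      rw [this]
      gcongr
    calc _ ≤ Real.exp (-(r : ℝ)) * Real.exp (2 * Real.exp 1 * (8 * LL + 16)) := by gcongr
      _ ≤ Real.exp (88 + -(2 : ℕ) * LL) := by
          rw [← Real.exp_add]
          apply Real.exp_le_exp.2
          have := Real.exp_one_lt_d9
          push_cast
          nlinarith
      _ = Real.exp 88 * (1 / L ^ 2) := by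
          rw [Real.exp_add, neg_mul, Real.exp_neg, Real.exp_nat_mul, Real.exp_log hL0, one_div]
      _ ≤ _ := by rw [hD]; gcongr
  have m3 : (W : ℝ) ^ r * ∏ p ∈ P, (1 + 2 / (W : ℝ)) ≤ Real.exp 2 * (X * D) := by
    have h1 : (W : ℝ) ^ r ≤ x ^ ((1 : ℝ) / 4) := by
      calc (W : ℝ) ^ r ≤ (Real.exp u) ^ r := pow_le_pow_left₀ (by positivity) hWe r
        _ = Real.exp (r * u) := (Real.exp_nat_mul _ _).symm
        _ ≤ Real.exp (L * (1 / 4)) := by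
            apply Real.exp_le_exp.2
            have : u * (240 * LL) = L := by rw [hu]; field_simp
            nlinarith
        _ = _ := by rw [Real.rpow_def_of_pos hx0]
    have h2 : ∏ p ∈ P, (1 + 2 / (W : ℝ)) ≤ Real.exp 2 := by
      refine (prod_le_exp P (fun _ => 2 / (W : ℝ)) (fun p _ => by positivity)).trans ?_
      apply Real.exp_le_exp.2
      rw [Finset.sum_const, nsmul_eq_mul]
      have hc : P.card ≤ W := by
        calc P.card ≤ (Finset.Icc 2 W).card := Finset.card_le_card ((Finset.filter_subset _ _).trans (Finset.filter_subset _ _))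
          _ ≤ W := by simp
      have hc' : (P.card : ℝ) ≤ W := by exact_mod_cast hc
      rw [← mul_div_assoc, div_le_iff₀ (by linarith)]
      linarith
    have h3 : x ^ ((1 : ℝ) / 4) ≤ X * D := by
      have hab : (a : ℝ) * b ≤ x ^ ((1 : ℝ) / 2) := by
        calc (a : ℝ) * b ≤ x ^ ((1 : ℝ) / 4) * x ^ ((1 : ℝ) / 4) := by gcongr
          _ = _ := by rw [← Real.rpow_add hx0]; norm_num
      have hg : (1 : ℝ) ≤ Nat.gcd a b := by exact_mod_cast Nat.gcd_pos_of_pos_left b ha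
      have hx12 : x ^ ((1 : ℝ) / 2) ≤ X := by
        rw [hX, ← mul_div_assoc, le_div_iff₀ (by positivity)]
        calc x ^ ((1 : ℝ) / 2) * (a * b) ≤ x ^ ((1 : ℝ) / 2) * x ^ ((1 : ℝ) / 2) := by gcongr
          _ = x := by rw [← Real.rpow_add hx0]; norm_num
          _ ≤ x * Nat.gcd a b := le_mul_of_one_le_right hx0.le hg
      have hDge : 1 / L ^ 2 ≤ D := by rw [hD]; gcongr
      calc x ^ ((1 : ℝ) / 4) ≤ x ^ ((1 : ℝ) / 2) * (1 / L ^ 2) := by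
            rw [mul_one_div, le_div_iff₀ (by positivity)]
            calc _ ≤ x ^ ((1 : ℝ) / 4) * x ^ ((1 : ℝ) / 4) := by gcongr
              _ = _ := by rw [← Real.rpow_add hx0]; norm_num
        _ ≤ _ := by gcongr
    calc _ ≤ x ^ ((1 : ℝ) / 4) * Real.exp 2 := by gcongr
      _ ≤ X * D * Real.exp 2 := by gcongr
      _ = _ := by ring
  calc _ ≤ X * (480 ^ 2 * Real.exp 84 * D + Real.exp 88 * D) + Real.exp 2 * (X * D) := by
        apply add_le_add _ m3
        apply mul_le_mul hlcm (add_le_add m1 m2) _ hX0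
        apply add_nonneg
        · apply Finset.prod_nonneg
          intro p hp
          have h2 : (2 : ℝ) ≤ p := by exact_mod_cast (mem_pr.1 (Finset.mem_filter.1 hp).1).1.two_le
          have h3 : 2 / (p : ℝ) ≤ 1 := by rw [div_le_one (by linarith)]; exact h2
          linarith
        · positivity
    _ = _ := by rw [hX]; ring

/-- the Y-smooth part -/
noncomputable def sp (Y n : ℕ) : ℕ := part (fun p => p ≤ Y) n

lemma sp_pos (Y n : ℕ) : 1 ≤ sp Y n := Nat.pos_of_ne_zero (part_ne_zero _ _)

lemma rankin (M : ℕ) (κ : ℝ) (hκ : 0 ≤ κ) : ∃ C : ℝ, 0 < C ∧ ∀ Y N : ℕ, ∀ η : ℝ, 0 ≤ η → η ≤ 1 / 2 →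
    η * Real.log Y ≤ κ → 3 ≤ N →
    ∑ n ∈ Finset.Icc 1 N, (sp Y n : ℝ) ^ η * (n.divisors.card : ℝ) ^ M ≤ C * N * (Real.log N) ^ (8 * 2 ^ M) := by
  obtain ⟨C, hC, hloc⟩ := local_series M
  obtain ⟨K, hK, hsq⟩ := sum_inv_sq
  refine ⟨Real.exp (2 ^ M * 16 + 2 ^ M * Real.exp κ * (2 * κ) + C * Real.exp κ ^ 2 * K), Real.exp_pos _, ?_⟩
  intro Y N η hη0 hη1 hηY hN
  set w : ℕ → ℝ := fun p => if p ≤ Y then (p : ℝ) ^ η else 1 with hw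
  have hw0 : ∀ p, 0 ≤ w p := by
    intro p; simp only [hw]; split_ifs <;> positivity
  set y : ℕ → ℝ := fun p => w p / p with hy
  have hy0 : ∀ p, 0 ≤ y p := fun p => div_nonneg (hw0 p) (Nat.cast_nonneg _)
  have hwsq : ∀ p : ℕ, p.Prime → w p ^ 2 ≤ p := by
    intro p hp
    have h1 : (1 : ℝ) ≤ p := by exact_mod_cast hp.one_le
    simp only [hw]
    split_ifs
    · rw [← Real.rpow_natCast, ← Real.rpow_mul (by positivity)]
      calc (p : ℝ) ^ (η * (2 : ℕ)) ≤ (p : ℝ) ^ (1 : ℝ) := by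
            apply Real.rpow_le_rpow_of_exponent_le h1
            push_cast; linarith
        _ = p := Real.rpow_one _
    · simpa using h1
  have hy34 : ∀ p : ℕ, p.Prime → y p ≤ 3 / 4 := by
    intro p hp
    have h2 : (2 : ℝ) ≤ p := by exact_mod_cast hp.two_le
    simp only [hy]
    rw [div_le_iff₀ (by linarith)]
    have h1 := hwsq p hp
    by_contra hcon
    push Not at hcon
    nlinarith [hw0 p]
  have hwexp : ∀ p : ℕ, p.Prime → w p ≤ Real.exp κ ∧
      w p ≤ 1 + (if p ≤ Y then Real.exp κ * (η * Real.log p) else 0) := by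
    intro p hp
    have h0 : (0 : ℝ) < p := by exact_mod_cast hp.pos
    have hl0 : 0 ≤ Real.log p := Real.log_nonneg (by exact_mod_cast hp.one_le)
    simp only [hw]
    split_ifs with h
    · have h1 : Real.log p ≤ Real.log Y := Real.log_le_log h0 (by exact_mod_cast h)
      have ht : η * Real.log p ≤ κ := le_trans (by gcongr) hηY
      have e : (p : ℝ) ^ η = Real.exp (η * Real.log p) := by
        rw [Real.rpow_def_of_pos h0, mul_comm]
      rw [e]
      have ht0 : 0 ≤ η * Real.log p := by positivity
      generalize η * Real.log p = t at *
      refine ⟨Real.exp_le_exp.2 ht, ?_⟩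
      have h2 := Real.add_one_le_exp (-t)
      rw [Real.exp_neg] at h2
      have h3 := Real.exp_pos t
      have h4 : Real.exp t ≤ 1 + Real.exp t * t := by
        have : Real.exp t * (-t + 1) ≤ Real.exp t * (Real.exp t)⁻¹ := by gcongr
        rw [mul_inv_cancel₀ h3.ne'] at this
        linarith
      refine h4.trans ?_
      have := Real.exp_le_exp.2 ht
      gcongr
    · exact ⟨Real.one_le_exp hκ, by simp⟩
  set g : ℕ → ℝ := fun n => (sp Y n : ℝ) ^ η * (n.divisors.card : ℝ) ^ M / n with hg
  have hg0 : ∀ n, 0 ≤ g n := by intro n; simp only [hg]; positivity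
  have hgpp : ∀ p : ℕ, p.Prime → ∀ k : ℕ, g (p ^ k) = ((k : ℝ) + 1) ^ M * (y p) ^ k := by
    intro p hp k
    simp only [hg, sp, hy, hw]
    rw [part_prime_pow _ hp, tau_prime_pow hp]
    split_ifs
    · push_cast
      rw [div_pow, ← Real.rpow_natCast, ← Real.rpow_natCast ((p : ℝ) ^ η), ← Real.rpow_mul (by positivity),
        ← Real.rpow_mul (by positivity), mul_comm (k : ℝ) η]
      ring
    · push_cast
      rw [Real.one_rpow, div_pow, one_pow]
      ring
  have h := sum_le_euler g (by simp [hg, sp, part]) hg0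
    (fun {a b} hab => by
      show (sp Y (a * b) : ℝ) ^ η * ((a * b).divisors.card : ℝ) ^ M / ((a * b : ℕ) : ℝ) =
        ((sp Y a : ℝ) ^ η * (a.divisors.card : ℝ) ^ M / a) * ((sp Y b : ℝ) ^ η * (b.divisors.card : ℝ) ^ M / b)
      rcases Nat.eq_zero_or_pos a with rfl | ha
      · simp
      rcases Nat.eq_zero_or_pos b with rfl | hb
      · simp
      unfold sp
      rw [part_mul _ ha.ne' hb.ne', Nat.Coprime.card_divisors_mul hab]
      push_cast
      rw [Real.mul_rpow (by positivity) (by positivity), mul_pow]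
      field_simp)
    (fun {p} hp => by
      simp only [hgpp p hp]
      exact (hloc (y p) (hy0 p) (hy34 p hp)).1) (pr N) (Finset.Icc 1 N) (by
      intro t ht
      rw [Finset.mem_Icc] at ht
      rw [Nat.mem_factoredNumbers_iff_primeFactors_subset]
      refine ⟨by omega, fun p hp => mem_pr.2 ⟨Nat.prime_of_mem_primeFactors hp, ?_⟩⟩
      exact (Nat.le_of_mem_primeFactors hp).trans ht.2)
  have hpf : (pr N).filter Nat.Prime = pr N := Finset.filter_true_of_mem (fun p hp => (mem_pr.1 hp).1)
  rw [hpf] at h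
  have hNR : (3 : ℝ) ≤ N := by exact_mod_cast hN
  have hlN : 0 < Real.log N := Real.log_pos (by linarith)
  have h1 : ∑ n ∈ Finset.Icc 1 N, (sp Y n : ℝ) ^ η * (n.divisors.card : ℝ) ^ M ≤ N * ∑ n ∈ Finset.Icc 1 N, g n := by
    rw [Finset.mul_sum]
    apply Finset.sum_le_sum
    intro n hn
    rw [Finset.mem_Icc] at hn
    have hn0 : (0 : ℝ) < n := by exact_mod_cast hn.1
    have hnN : (n : ℝ) ≤ N := by exact_mod_cast hn.2
    simp only [hg]
    rw [← mul_div_assoc, le_div_iff₀ hn0, mul_comm]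
    gcongr
  have h2 : ∏ p ∈ pr N, ∑' k, g (p ^ k) ≤ Real.exp (∑ p ∈ pr N, (2 ^ M * y p + C * y p ^ 2)) := by
    refine le_trans ?_ (prod_le_exp (pr N) _ (fun p _ => by have := hy0 p; positivity))
    apply Finset.prod_le_prod
    · intro p _; exact tsum_nonneg (fun _ => hg0 _)
    · intro p hp
      have hp' := (mem_pr.1 hp).1
      simp only [hgpp p hp']
      have := (hloc (y p) (hy0 p) (hy34 p hp')).2
      linarith
  have h3 : ∑ p ∈ pr N, (2 ^ M * y p + C * y p ^ 2) ≤
      2 ^ M * (8 * Real.log (Real.log N) + 16) + 2 ^ M * Real.exp κ * (2 * κ) + C * Real.exp κ ^ 2 * K := by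
    have hb : ∀ p ∈ pr N, 2 ^ M * y p + C * y p ^ 2 ≤ 2 ^ M * (1 / (p : ℝ)) +
        2 ^ M * Real.exp κ * η * (if p ≤ Y then Real.log p / p else 0) + C * Real.exp κ ^ 2 * (1 / (p : ℝ) ^ 2) := by
      intro p hp
      have hp' := (mem_pr.1 hp).1
      have hp0 : (0 : ℝ) < p := by exact_mod_cast hp'.pos
      obtain ⟨w1, w2⟩ := hwexp p hp'
      have a1 : y p ^ 2 ≤ Real.exp κ ^ 2 * (1 / (p : ℝ) ^ 2) := by
        simp only [hy]
        rw [div_pow, div_eq_mul_one_div]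
        have := hw0 p
        gcongr
      have a2 : y p ≤ 1 / (p : ℝ) + Real.exp κ * η * (if p ≤ Y then Real.log p / p else 0) := by
        simp only [hy]
        refine (div_le_div_of_nonneg_right w2 hp0.le).trans (le_of_eq ?_)
        split_ifs <;> ring
      have := mul_le_mul_of_nonneg_left a1 hC
      have := mul_le_mul_of_nonneg_left a2 (show (0 : ℝ) ≤ 2 ^ M by positivity)
      linarith
    refine (Finset.sum_le_sum hb).trans ?_
    rw [Finset.sum_add_distrib, Finset.sum_add_distrib, ← Finset.mul_sum, ← Finset.mul_sum, ← Finset.mul_sum, ← Finset.sum_filter]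
    have c1 : ∑ p ∈ pr N, 1 / (p : ℝ) ≤ 8 * Real.log (Real.log N) + 16 := by
      have := sum_inv_le N hNR
      rwa [Nat.floor_natCast] at this
    have c2 : η * ∑ p ∈ (pr N).filter (fun p => p ≤ Y), Real.log p / p ≤ 2 * κ := by
      have : ∑ p ∈ (pr N).filter (fun p => p ≤ Y), Real.log p / p ≤ 2 * Real.log Y := by
        refine le_trans ?_ (sum_log_div Y)
        apply Finset.sum_le_sum_of_subset_of_nonneg
        · intro p hp
          rw [Finset.mem_filter, mem_pr] at hp
          exact mem_pr.2 ⟨hp.1.1, hp.2⟩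
        · intro p hp _
          exact div_nonneg (Real.log_natCast_nonneg p) (Nat.cast_nonneg _)
      nlinarith
    have c3 := hsq (pr N)
    have d2 := mul_le_mul_of_nonneg_left c2 (show 0 ≤ 2 ^ M * Real.exp κ by positivity)
    rw [← mul_assoc] at d2
    gcongr
  have h4 : ∑ n ∈ Finset.Icc 1 N, g n ≤ Real.exp (2 ^ M * 16 + 2 ^ M * Real.exp κ * (2 * κ) + C * Real.exp κ ^ 2 * K) *
      (Real.log N) ^ (8 * 2 ^ M) := by
    refine (h.trans h2).trans ((Real.exp_le_exp.2 h3).trans (le_of_eq ?_))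
    rw [show 2 ^ M * (8 * Real.log (Real.log N) + 16) + 2 ^ M * Real.exp κ * (2 * κ) + C * Real.exp κ ^ 2 * K =
      (2 ^ M * 16 + 2 ^ M * Real.exp κ * (2 * κ) + C * Real.exp κ ^ 2 * K) + ((8 * 2 ^ M : ℕ) : ℝ) * Real.log (Real.log N) by push_cast; ring,
      Real.exp_add, Real.exp_nat_mul, Real.exp_log hlN]
  calc _ ≤ (N : ℝ) * (Real.exp (2 ^ M * 16 + 2 ^ M * Real.exp κ * (2 * κ) + C * Real.exp κ ^ 2 * K) *
      (Real.log N) ^ (8 * 2 ^ M)) := h1.trans (by gcongr)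
    _ = _ := by ring

/-- smoothness level -/
noncomputable def lvl (e x : ℝ) : ℕ := ⌊Real.exp (Real.log x / (e * Real.log (Real.log x)))⌋₊

open Filter in
lemma large_loglog (A : ℝ) (hA : 0 < A) : ∃ x₀ : ℝ, ∀ x : ℝ, x₀ ≤ x →
    A * Real.log (Real.log x) ≤ Real.log x := by
  have hlog := Real.tendsto_log_atTop
  have h4 : ∀ᶠ y : ℝ in atTop, A * Real.log y ≤ y := by
    have := (Real.isLittleO_log_id_atTop.bound (show (0 : ℝ) < 1 / A by positivity))
    filter_upwards [this, eventually_ge_atTop 1] with y hy hy1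
    rw [Real.norm_of_nonneg (Real.log_nonneg hy1), id, Real.norm_of_nonneg (by linarith)] at hy
    rw [one_div_mul_eq_div, le_div_iff₀ hA] at hy
    linarith
  obtain ⟨x₀, h⟩ := eventually_atTop.1 (hlog.eventually h4)
  exact ⟨x₀, h⟩

set_option maxHeartbeats 1000000 in
lemma large_part (m : ℕ) (e : ℝ) (he : 0 < e) : ∃ C : ℝ, 0 < C ∧ ∃ x₀ : ℝ, ∀ f₁ f₂ : ℕ → ℝ, GoodFn m f₁ → GoodFn m f₂ →
    ∀ x : ℝ, x₀ ≤ x → ∀ l : ℤ, (|l| : ℝ) ≤ x →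
    ∑ n ∈ (Finset.Icc 1 ⌊x⌋₊).filter (fun n : ℕ => 1 ≤ (n : ℤ) + l ∧
      ¬ ((sp (lvl e x) n : ℝ) ≤ x ^ ((1 : ℝ) / 4) ∧ (sp (lvl e x) ((n : ℤ) + l).toNat : ℝ) ≤ x ^ ((1 : ℝ) / 4))),
      f₁ n * f₂ ((n : ℤ) + l).toNat ≤ C * x / (Real.log x) ^ 2 := by
  set B : ℕ := 8 * 2 ^ (2 * m) with hB
  set κ : ℝ := 8 * (B + 2) / e with hκ
  have hκ0 : 0 ≤ κ := by positivity
  obtain ⟨C, hC, hR⟩ := rankin (2 * m) κ hκ0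
  obtain ⟨x₁, hx₁⟩ := large_x 1 one_pos
  obtain ⟨x₂, hx₂⟩ := large_loglog (16 * (B + 2)) (by positivity)
  refine ⟨C * 2 * 2 ^ B, by positivity, max x₁ x₂, ?_⟩
  intro f₁ f₂ hf₁ hf₂ x hx l hlx
  obtain ⟨hx3, hL3, hLL1, _, _, _⟩ := hx₁ x ((le_max_left _ _).trans hx)
  have hLLs := hx₂ x ((le_max_right _ _).trans hx)
  have hLLdef : Real.exp (Real.log (Real.log x)) = Real.log x := Real.exp_log (by linarith)
  set Y := lvl e x with hY
  have hYdef : Y = ⌊Real.exp (Real.log x / (e * Real.log (Real.log x)))⌋₊ := rfl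
  have hexpL : Real.exp (Real.log x) = x := Real.exp_log (by linarith)
  set L := Real.log x with hL
  set LL := Real.log L with hLL
  have hL0 : 0 < L := by linarith
  have hLL0 : 0 < LL := by linarith
  have hx0 : 0 < x := by linarith
  set η := κ * (e * LL) / L with hη
  have hη0 : 0 ≤ η := by positivity
  have hκe : κ * e = 8 * (B + 2) := by rw [hκ]; field_simp
  have hη1 : η ≤ 1 / 2 := by
    rw [hη, ← mul_assoc, hκe, div_le_iff₀ hL0]
    linarith
  have hηY : η * Real.log Y ≤ κ := by
    have h1 : Real.log Y ≤ L / (e * LL) := by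
      rcases Nat.eq_zero_or_pos Y with h0 | h0
      · rw [h0, Nat.cast_zero, Real.log_zero]; positivity
      · have : (Y : ℝ) ≤ Real.exp (L / (e * LL)) := Nat.floor_le (Real.exp_pos _).le
        have := Real.log_le_log (by exact_mod_cast h0) this
        rwa [Real.log_exp] at this
    calc η * Real.log Y ≤ η * (L / (e * LL)) := by gcongr
      _ = κ := by rw [hη]; field_simp
  set N := ⌊2 * x⌋₊ with hN
  have hNle : (N : ℝ) ≤ 2 * x := Nat.floor_le (by positivity)
  have hN3 : 3 ≤ N := Nat.le_floor (by push_cast; linarith)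
  have hNR : (3 : ℝ) ≤ N := by exact_mod_cast hN3
  have hS := hR Y N η hη0 hη1 hηY hN3
  set H : ℕ → ℝ := fun n => (sp Y n : ℝ) ^ η * (n.divisors.card : ℝ) ^ (2 * m) with hH
  have hH0 : ∀ n, 0 ≤ H n := by intro n; simp only [hH]; positivity
  have hlogN : Real.log N ≤ 2 * L := by
    have h1 := Real.log_le_log (by linarith) hNle
    rw [Real.log_mul (by norm_num) hx0.ne'] at h1
    have := Real.log_two_lt_d9
    linarith
  have hlogN0 : 0 ≤ Real.log N := Real.log_nonneg (by linarith)
  have hS2 : ∑ n ∈ Finset.Icc 1 N, H n ≤ C * 2 * 2 ^ B * x * L ^ B := by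
    refine hS.trans ?_
    calc C * N * Real.log N ^ B ≤ C * (2 * x) * (2 * L) ^ B := by gcongr
      _ = _ := by rw [mul_pow]; ring
  have hxη : x ^ (-(η / 8)) = 1 / L ^ (B + 2) := by
    rw [Real.rpow_def_of_pos hx0, ← hL]
    have : L * -(η / 8) = -(((B + 2 : ℕ) : ℝ) * LL) := by
      have : L * η = 8 * (B + 2) * LL := by rw [← hκe, hη]; field_simp
      push_cast
      linarith
    rw [this, Real.exp_neg, Real.exp_nat_mul, hLLdef, one_div]
  set F := (Finset.Icc 1 ⌊x⌋₊).filter (fun n : ℕ => 1 ≤ (n : ℤ) + l ∧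
      ¬ ((sp Y n : ℝ) ≤ x ^ ((1 : ℝ) / 4) ∧ (sp Y ((n : ℤ) + l).toNat : ℝ) ≤ x ^ ((1 : ℝ) / 4))) with hF
  have hterm : ∀ n ∈ F, f₁ n * f₂ ((n : ℤ) + l).toNat ≤
      1 / L ^ (B + 2) * (1 / 2) * (H n + H ((n : ℤ) + l).toNat) := by
    intro n hn
    rw [hF, Finset.mem_filter, Finset.mem_Icc] at hn
    obtain ⟨⟨hn1, hnx⟩, hnl, hbig⟩ := hn
    set n' := ((n : ℤ) + l).toNat with hn'
    have hn'1 : 1 ≤ n' := by omega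
    have hs1 : (1 : ℝ) ≤ sp Y n := by exact_mod_cast sp_pos Y n
    have hs2 : (1 : ℝ) ≤ sp Y n' := by exact_mod_cast sp_pos Y n'
    have hprod : x ^ ((1 : ℝ) / 4) ≤ (sp Y n : ℝ) * sp Y n' := by
      rw [not_and_or, not_le, not_le] at hbig
      rcases hbig with h | h
      · exact h.le.trans (le_mul_of_one_le_right (by linarith) hs2)
      · exact h.le.trans (le_mul_of_one_le_left (by linarith) hs1)
    have h1 : x ^ (η / 8) ≤ (sp Y n : ℝ) ^ (η / 2) * (sp Y n' : ℝ) ^ (η / 2) := by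
      rw [← Real.mul_rpow (by positivity) (by positivity)]
      calc x ^ (η / 8) = (x ^ ((1 : ℝ) / 4)) ^ (η / 2) := by
            rw [← Real.rpow_mul hx0.le]; congr 1; ring
        _ ≤ _ := by gcongr
    have h1' : 1 ≤ x ^ (-(η / 8)) * ((sp Y n : ℝ) ^ (η / 2) * (sp Y n' : ℝ) ^ (η / 2)) := by
      rw [Real.rpow_neg hx0.le, ← div_eq_inv_mul, le_div_iff₀ (by positivity), one_mul]
      exact h1
    have hHsq : ∀ k : ℕ, H k = ((sp Y k : ℝ) ^ (η / 2) * (k.divisors.card : ℝ) ^ m) ^ 2 := by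
      intro k
      simp only [hH]
      rw [mul_pow, ← Real.rpow_natCast ((sp Y k : ℝ) ^ (η / 2)), ← Real.rpow_mul (by positivity), mul_comm 2 m, pow_mul]
      congr 2
      push_cast; ring
    have a1 := hf₁.le n hn1
    have a2 := hf₂.le n' hn'1
    have b1 := hf₁.nonneg n
    have b2 := hf₂.nonneg n'
    rw [← hxη]
    have hxp : 0 < x ^ (-(η / 8)) := by positivity
    rw [hHsq, hHsq]
    set s1 := (sp Y n : ℝ) ^ (η / 2)
    set s2 := (sp Y n' : ℝ) ^ (η / 2)
    set t1 := (n.divisors.card : ℝ) ^ m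
    set t2 := (n'.divisors.card : ℝ) ^ m
    have ht1 : 0 ≤ t1 := by positivity
    have ht2 : 0 ≤ t2 := by positivity
    calc f₁ n * f₂ n' ≤ t1 * t2 := by gcongr
      _ ≤ t1 * t2 * (x ^ (-(η / 8)) * (s1 * s2)) := le_mul_of_one_le_right (by positivity) h1'
      _ = x ^ (-(η / 8)) * ((s1 * t1) * (s2 * t2)) := by ring
      _ ≤ x ^ (-(η / 8)) * ((1 / 2) * ((s1 * t1) ^ 2 + (s2 * t2) ^ 2)) := by
          apply mul_le_mul_of_nonneg_left _ hxp.le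
          nlinarith [sq_nonneg (s1 * t1 - s2 * t2)]
      _ = _ := by ring
  refine (Finset.sum_le_sum hterm).trans ?_
  rw [← Finset.mul_sum, Finset.sum_add_distrib]
  have hFx : ∀ n ∈ F, (1 ≤ n ∧ (n : ℝ) ≤ x) ∧ 1 ≤ (n : ℤ) + l := by
    intro n hn
    rw [hF, Finset.mem_filter, Finset.mem_Icc] at hn
    exact ⟨⟨hn.1.1, (Nat.le_floor_iff hx0.le).1 hn.1.2⟩, hn.2.1⟩
  have S1 : ∑ n ∈ F, H n ≤ ∑ n ∈ Finset.Icc 1 N, H n := by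
    apply Finset.sum_le_sum_of_subset_of_nonneg
    · intro n hn
      obtain ⟨⟨h1, h2⟩, _⟩ := hFx n hn
      exact Finset.mem_Icc.2 ⟨h1, Nat.le_floor (by linarith)⟩
    · intro n _ _; exact hH0 n
  have S2 : ∑ n ∈ F, H ((n : ℤ) + l).toNat ≤ ∑ n ∈ Finset.Icc 1 N, H n := by
    have hinj : Set.InjOn (fun n : ℕ => ((n : ℤ) + l).toNat) F := by
      intro a ha b hb hab
      have := (hFx a ha).2
      have := (hFx b hb).2
      simp only at hab
      omega
    rw [← Finset.sum_image (f := H) hinj]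
    apply Finset.sum_le_sum_of_subset_of_nonneg
    · intro k hk
      obtain ⟨n, hn, rfl⟩ := Finset.mem_image.1 hk
      obtain ⟨⟨h1, h2⟩, h3⟩ := hFx n hn
      refine Finset.mem_Icc.2 ⟨by omega, Nat.le_floor ?_⟩
      have h5 : ((((n : ℤ) + l).toNat : ℤ) : ℝ) = (n : ℝ) + (l : ℝ) := by
        rw [Int.toNat_of_nonneg (by omega)]; push_cast; ring
      have h6 : (l : ℝ) ≤ x := (le_abs_self _).trans hlx
      have h7 : ((((n : ℤ) + l).toNat : ℕ) : ℝ) = (n : ℝ) + (l : ℝ) := by exact_mod_cast h5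
      rw [h7]; linarith
    · intro n _ _; exact hH0 n
  calc _ ≤ 1 / L ^ (B + 2) * (1 / 2) * (C * 2 * 2 ^ B * x * L ^ B + C * 2 * 2 ^ B * x * L ^ B) := by
        have := S1.trans hS2
        have := S2.trans hS2
        gcongr
    _ = _ := by
        rw [pow_add]; field_simp; try ring

lemma f_le_smooth (m : ℕ) (f : ℕ → ℝ) (hf : GoodFn m f) (Y n : ℕ) (hn : 1 ≤ n) (z V : ℝ) (hz : 1 < z)
    (hzY : z ≤ Y + 1) (hV : (n : ℝ) ≤ V) :
    f n ≤ f (sp Y n) * (Real.exp (Real.log V / Real.log z)) ^ m := by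
  set t := part (fun p => ¬ p ≤ Y) n with ht
  have ht1 : 1 ≤ t := Nat.pos_of_ne_zero (part_ne_zero _ _)
  have hmul : sp Y n * t = n := part_mul_part_not (fun p => p ≤ Y) (by omega)
  have htn : t ≤ n := Nat.le_of_dvd hn ⟨sp Y n, by rw [mul_comm]; exact hmul.symm⟩
  have hb := rough_bound t ht1 z V hz (le_trans (by exact_mod_cast htn) hV) (by
    intro p hp hpt
    have h1 : ¬ p ≤ Y := prime_dvd_part (Q := fun p => ¬ p ≤ Y) hp hpt
    have h2 : Y + 1 ≤ p := by omega
    have h3 : (Y : ℝ) + 1 ≤ p := by exact_mod_cast h2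
    linarith)
  have e : f n = f (sp Y n) * f t := by
    conv_lhs => rw [← hmul]
    exact hf.mul' (part_coprime _ n)
  rw [e]
  apply mul_le_mul_of_nonneg_left _ (hf.nonneg _)
  refine (hf.le t ht1).trans ?_
  exact pow_le_pow_left₀ (Nat.cast_nonneg _) hb m

lemma lvl_mono {e e' x : ℝ} (he : 0 < e) (hee : e ≤ e') (hL : 0 ≤ Real.log x) (hLL : 0 < Real.log (Real.log x)) :
    lvl e' x ≤ lvl e x := by
  apply Nat.floor_le_floor
  apply Real.exp_le_exp.2
  gcongr

set_option maxHeartbeats 1000000 in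
lemma main_part (m : ℕ) (e δ : ℝ) (he : 0 < e) (he1 : e ≤ 1) (hδ : 0 < δ) : ∃ C : ℝ, 0 < C ∧ ∃ x₀ : ℝ,
    ∀ f₁ f₂ : ℕ → ℝ, GoodFn m f₁ → GoodFn m f₂ →
    ∀ x : ℝ, x₀ ≤ x → ∀ l : ℤ, l ≠ 0 → (|l| : ℝ) ≤ x →
    ∑ n ∈ (Finset.Icc 1 ⌊x⌋₊).filter (fun n : ℕ => 1 ≤ (n : ℤ) + l ∧
      ((sp (lvl e x) n : ℝ) ≤ x ^ ((1 : ℝ) / 4) ∧ (sp (lvl e x) ((n : ℤ) + l).toNat : ℝ) ≤ x ^ ((1 : ℝ) / 4))),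
      f₁ n * f₂ ((n : ℤ) + l).toNat ≤ C * x * (((Real.log x) ^ δ / (Real.log x) ^ 2) * (Real.log x) ^ (4 * e * m)) *
      l.natAbs.divisors.card * ∏ p ∈ pr (lvl e x), ((1 + f₁ p / p) * (1 + f₂ p / p)) := by
  obtain ⟨C₁, hC₁, x₁, hx₁⟩ := sieve δ hδ
  obtain ⟨C₂, hC₂, hB3⟩ := B3 m
  obtain ⟨x₂, hx₂⟩ := large_x δ hδ
  refine ⟨C₁ * C₂, by positivity, max x₁ x₂, ?_⟩
  intro f₁ f₂ hf₁ hf₂ x hx l hl hlx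
  have hsieve := hx₁ x ((le_max_left _ _).trans hx)
  obtain ⟨hx3, hL3, hLL1, h480, -, -⟩ := hx₂ x ((le_max_right _ _).trans hx)
  have hWY : lev x ≤ lvl e x := lvl_mono (e' := 240) he (by linarith) (by linarith) (by linarith)
  have hYz : Real.exp (Real.log x / (e * Real.log (Real.log x))) < (lvl e x : ℝ) + 1 := Nat.lt_floor_add_one _
  set Y := lvl e x with hY
  set L := Real.log x with hL
  set LL := Real.log L with hLL
  have hL0 : 0 < L := by linarith
  have hLL0 : 0 < LL := by linarith
  have hx0 : 0 < x := by linarith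
  set D := L ^ δ / L ^ 2 with hD
  have hD0 : 0 ≤ D := by positivity
  set l' := l.natAbs with hl'
  have hl'1 : 1 ≤ l' := Int.natAbs_pos.2 hl
  set F := (Finset.Icc 1 ⌊x⌋₊).filter (fun n : ℕ => 1 ≤ (n : ℤ) + l ∧
      ((sp Y n : ℝ) ≤ x ^ ((1 : ℝ) / 4) ∧ (sp Y ((n : ℤ) + l).toNat : ℝ) ≤ x ^ ((1 : ℝ) / 4))) with hF
  have hFx : ∀ n ∈ F, (1 ≤ n ∧ (n : ℝ) ≤ x) ∧ 1 ≤ (n : ℤ) + l ∧ ((((n : ℤ) + l).toNat : ℕ) : ℝ) ≤ 2 * x := by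
    intro n hn
    rw [hF, Finset.mem_filter, Finset.mem_Icc] at hn
    have h2 := (Nat.le_floor_iff hx0.le).1 hn.1.2
    refine ⟨⟨hn.1.1, h2⟩, hn.2.1, ?_⟩
    have h5 : ((((n : ℤ) + l).toNat : ℤ) : ℝ) = (n : ℝ) + (l : ℝ) := by
      rw [Int.toNat_of_nonneg (by omega)]; push_cast; ring
    have h6 : (l : ℝ) ≤ x := (le_abs_self _).trans hlx
    have h7 : ((((n : ℤ) + l).toNat : ℕ) : ℝ) = (n : ℝ) + (l : ℝ) := by exact_mod_cast h5
    rw [h7]; linarith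
  -- rough parts
  set R := (Real.exp (Real.log (2 * x) / Real.log (Real.exp (L / (e * LL))))) ^ m with hR
  have hR0 : 0 ≤ R := by positivity
  have hRle : R ≤ L ^ (2 * e * m) := by
    rw [hR, Real.log_exp]
    have h1 : Real.log (2 * x) / (L / (e * LL)) ≤ LL * (2 * e) := by
      rw [div_le_iff₀ (by positivity)]
      have : LL * (2 * e) * (L / (e * LL)) = 2 * L := by field_simp
      rw [this, Real.log_mul (by norm_num) hx0.ne']
      have := Real.log_two_lt_d9
      linarith
    calc _ ≤ (Real.exp (LL * (2 * e))) ^ m := by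
          apply pow_le_pow_left₀ (Real.exp_pos _).le
          exact Real.exp_le_exp.2 h1
      _ = _ := by
          rw [← Real.rpow_def_of_pos hL0, ← Real.rpow_natCast, ← Real.rpow_mul hL0.le]
  have hz1 : 1 < Real.exp (L / (e * LL)) := by
    rw [Real.one_lt_exp_iff]; positivity
  have hterm : ∀ n ∈ F, f₁ n * f₂ ((n : ℤ) + l).toNat ≤
      R * R * (f₁ (sp Y n) * f₂ (sp Y ((n : ℤ) + l).toNat)) := by
    intro n hn
    obtain ⟨⟨h1, h2⟩, h3, h4⟩ := hFx n hn
    have a1 := f_le_smooth m f₁ hf₁ Y n h1 _ (2 * x) hz1 hYz.le (by linarith)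
    have a2 := f_le_smooth m f₂ hf₂ Y ((n : ℤ) + l).toNat (by omega) _ (2 * x) hz1 hYz.le h4
    calc _ ≤ (f₁ (sp Y n) * R) * (f₂ (sp Y ((n : ℤ) + l).toNat) * R) :=
          mul_le_mul a1 a2 (hf₂.nonneg _) (mul_nonneg (hf₁.nonneg _) hR0)
      _ = _ := by ring
  refine (Finset.sum_le_sum hterm).trans ?_
  rw [← Finset.mul_sum]
  set T := (Finset.Icc 1 ⌊x ^ ((1 : ℝ) / 4)⌋₊).filter (fun t => t ∈ Nat.factoredNumbers (pr Y)) with hT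
  set U := (T ×ˢ T).filter (fun y => Nat.gcd y.1 y.2 ∣ l') with hU
  have hspdvd : ∀ n : ℕ, 1 ≤ n → sp Y n ∣ n := fun n hn => part_dvd _ (by omega)
  have hdvd' : ∀ n ∈ F, sp Y n ∣ n ∧ ((sp Y ((n : ℤ) + l).toNat : ℕ) : ℤ) ∣ (n : ℤ) + l := by
    intro n hn
    obtain ⟨⟨h1, h2⟩, h3, h4⟩ := hFx n hn
    refine ⟨hspdvd n h1, ?_⟩
    have := hspdvd ((n : ℤ) + l).toNat (by omega)
    have h5 : ((sp Y ((n : ℤ) + l).toNat : ℕ) : ℤ) ∣ ((((n : ℤ) + l).toNat : ℕ) : ℤ) := by exact_mod_cast this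
    rwa [Int.toNat_of_nonneg (by omega)] at h5
  have hTm : ∀ n : ℕ, 1 ≤ n → (sp Y n : ℝ) ≤ x ^ ((1 : ℝ) / 4) → sp Y n ∈ T := by
    intro n hn hs
    rw [hT, Finset.mem_filter, Finset.mem_Icc]
    refine ⟨⟨sp_pos Y n, Nat.le_floor hs⟩, ?_⟩
    rw [Nat.mem_factoredNumbers_iff_primeFactors_subset]
    refine ⟨part_ne_zero _ _, fun p hp => ?_⟩
    have hp' := Nat.prime_of_mem_primeFactors hp
    exact mem_pr.2 ⟨hp', prime_dvd_part (Q := fun p => p ≤ Y) hp' (Nat.dvd_of_mem_primeFactors hp)⟩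
  have hmaps : ∀ n ∈ F, (sp Y n, sp Y ((n : ℤ) + l).toNat) ∈ U := by
    intro n hn
    obtain ⟨⟨h1, h2⟩, h3, h4⟩ := hFx n hn
    obtain ⟨d1, d2⟩ := hdvd' n hn
    rw [hF, Finset.mem_filter] at hn
    rw [hU, Finset.mem_filter, Finset.mem_product]
    refine ⟨⟨hTm n h1 hn.2.2.1, hTm _ (by omega) hn.2.2.2⟩, ?_⟩
    rw [hl', ← Int.natCast_dvd]
    simp only
    set a := sp Y n
    set b := sp Y ((n : ℤ) + l).toNat
    have g1 : ((Nat.gcd a b : ℕ) : ℤ) ∣ (n : ℤ) := by exact_mod_cast (Nat.gcd_dvd_left a b).trans d1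
    have g2 : ((Nat.gcd a b : ℕ) : ℤ) ∣ (n : ℤ) + l :=
      (Int.natCast_dvd_natCast.2 (Nat.gcd_dvd_right a b)).trans d2
    exact (dvd_add_right g1).1 g2
  rw [← Finset.sum_fiberwise_of_maps_to hmaps]
  have hfib : ∀ y ∈ U, ∑ n ∈ F.filter (fun n => (sp Y n, sp Y ((n : ℤ) + l).toNat) = y),
      f₁ (sp Y n) * f₂ (sp Y ((n : ℤ) + l).toNat) ≤
      C₁ * x * D * (f₁ y.1 * f₂ y.2 * ((Nat.gcd y.1 y.2 : ℝ) / (y.1 * y.2))) := by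
    rintro ⟨a, b⟩ hy
    have e1 : ∀ n ∈ F.filter (fun n => (sp Y n, sp Y ((n : ℤ) + l).toNat) = (a, b)),
        f₁ (sp Y n) * f₂ (sp Y ((n : ℤ) + l).toNat) = f₁ a * f₂ b := by
      intro n hn
      have := (Finset.mem_filter.1 hn).2
      rw [Prod.mk.injEq] at this
      rw [this.1, this.2]
    rw [Finset.sum_congr rfl e1, Finset.sum_const, nsmul_eq_mul]
    rw [hU, Finset.mem_filter, Finset.mem_product] at hy
    obtain ⟨⟨ha, hb⟩, hg⟩ := hy
    simp only at ha hb hg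
    rw [hT, Finset.mem_filter, Finset.mem_Icc] at ha hb
    have hcnt := hsieve a b ha.1.1 hb.1.1 ((Nat.le_floor_iff (by positivity)).1 ha.1.2)
      ((Nat.le_floor_iff (by positivity)).1 hb.1.2) l hl hlx (Int.natCast_dvd.2 hg)
    have hcard : (F.filter (fun n => (sp Y n, sp Y ((n : ℤ) + l).toNat) = (a, b))).card ≤
        ((Finset.Icc 1 ⌊x⌋₊).filter fun n : ℕ => (a ∣ n ∧ (b : ℤ) ∣ (n : ℤ) + l) ∧
      ∀ p ∈ (pr (lev x)).filter (fun p => ¬ p ∣ a * b * l.natAbs), ¬ p ∣ n ∧ ¬ (p : ℤ) ∣ (n : ℤ) + l).card := by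
      apply Finset.card_le_card
      intro n hn
      rw [Finset.mem_filter, Prod.mk.injEq] at hn
      obtain ⟨hnF, rfl, rfl⟩ := hn
      obtain ⟨⟨h1, h2⟩, h3, h4⟩ := hFx n hnF
      rw [Finset.mem_filter]
      refine ⟨(Finset.mem_filter.1 hnF).1, hdvd' n hnF, ?_⟩
      intro p hp
      rw [Finset.mem_filter, mem_pr] at hp
      have hpY : p ≤ Y := hp.1.2.trans hWY
      have key : ∀ k : ℕ, 1 ≤ k → ¬ p ∣ sp Y k → ¬ p ∣ k := by
        intro k hk h5 h6
        have hmul : sp Y k * part (fun p => ¬ p ≤ Y) k = k := part_mul_part_not (fun p => p ≤ Y) (by omega)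
        rw [← hmul] at h6
        rcases (Nat.Prime.dvd_mul hp.1.1).1 h6 with h7 | h7
        · exact h5 h7
        · exact prime_dvd_part (Q := fun p => ¬ p ≤ Y) hp.1.1 h7 hpY
      constructor
      · apply key n h1
        intro h
        exact hp.2 ((h.mul_right _).mul_right _)
      · intro h
        have h8 : p ∣ ((n : ℤ) + l).toNat := by
          have : (p : ℤ) ∣ ((((n : ℤ) + l).toNat : ℕ) : ℤ) := by
            rwa [Int.toNat_of_nonneg (by omega)]
          exact_mod_cast this
        refine key _ (by omega) ?_ h8
        intro h
        exact hp.2 ((h.mul_left _).mul_right _)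
    have hcard' : ((F.filter (fun n => (sp Y n, sp Y ((n : ℤ) + l).toNat) = (a, b))).card : ℝ) ≤
      C₁ * x * ((Nat.gcd a b : ℝ) / (a * b)) * D := le_trans (by exact_mod_cast hcard) hcnt
    have n1 := hf₁.nonneg a
    have n2 := hf₂.nonneg b
    calc _ ≤ C₁ * x * ((Nat.gcd a b : ℝ) / (a * b)) * D * (f₁ a * f₂ b) := by gcongr
      _ = _ := by ring
  have hb3 := hB3 f₁ f₂ hf₁ hf₂ Y l' hl'1 T (fun t ht => (Finset.mem_filter.1 ht).2)
  have hsum := Finset.sum_le_sum hfib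
  rw [← Finset.mul_sum] at hsum
  set PP := ∏ p ∈ pr Y, ((1 + f₁ p / p) * (1 + f₂ p / p)) with hPP
  have hPP0 : 0 ≤ PP := Finset.prod_nonneg (fun p _ => by
    have := hf₁.nonneg p
    have := hf₂.nonneg p
    positivity)
  have hRR : R * R ≤ L ^ (4 * e * m) := by
    calc R * R ≤ L ^ (2 * e * m) * L ^ (2 * e * m) := by gcongr
      _ = _ := by rw [← Real.rpow_add hL0]; congr 1; ring
  calc _ ≤ R * R * (C₁ * x * D * (C₂ * l'.divisors.card * PP)) := by
        apply mul_le_mul_of_nonneg_left _ (by positivity)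
        exact hsum.trans (mul_le_mul_of_nonneg_left hb3 (by positivity))
    _ ≤ L ^ (4 * e * m) * (C₁ * x * D * (C₂ * l'.divisors.card * PP)) := by
        apply mul_le_mul_of_nonneg_right hRR
        positivity
    _ = _ := by ring

lemma prod_lvl (m : ℕ) (ε e : ℝ) (hε : 0 < ε) (hε1 : ε < 1) (he : 0 < e) (hee : e ≤ ε) : ∃ C : ℝ, 0 < C ∧
    ∀ f₁ f₂ : ℕ → ℝ, GoodFn m f₁ → GoodFn m f₂ → ∀ x : ℝ, 3 ≤ Real.log x → 1 ≤ Real.log (Real.log x) →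
    480 * Real.log (Real.log x) ≤ Real.log x →
    ∏ p ∈ pr (lvl e x), ((1 + f₁ p / p) * (1 + f₂ p / p)) ≤
      C * ∏ p ∈ pr (lvl ε x), ((1 + f₁ p / p) * (1 + f₂ p / p)) := by
  refine ⟨Real.exp (2 * 2 ^ m * (4 * (ε / e))), Real.exp_pos _, ?_⟩
  intro f₁ f₂ hf₁ hf₂ x hL3 hLL1 h480
  have hle : lvl ε x ≤ lvl e x := lvl_mono he hee (by linarith) (by linarith)
  have hY : (lvl e x : ℝ) ≤ Real.exp (Real.log x / (e * Real.log (Real.log x))) := Nat.floor_le (Real.exp_pos _).le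
  have hZ : Real.exp (Real.log x / (ε * Real.log (Real.log x))) < (lvl ε x : ℝ) + 1 := Nat.lt_floor_add_one _
  set Y := lvl e x
  set Z := lvl ε x
  set L := Real.log x
  set LL := Real.log L
  have hL0 : 0 < L := by linarith
  have hLL0 : 0 < LL := by linarith
  set u := L / (ε * LL) with hu
  have hu2 : 2 ≤ u := by
    rw [hu, le_div_iff₀ (by positivity)]
    nlinarith
  have hexp2 : (4 : ℝ) ≤ Real.exp u := by
    have h1 : Real.exp 2 ≤ Real.exp u := Real.exp_le_exp.2 hu2
    have h2 : Real.exp 2 = Real.exp 1 * Real.exp 1 := by rw [← Real.exp_add]; norm_num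
    have := Real.exp_one_gt_d9
    nlinarith
  have hZ2 : 2 ≤ Z := by
    have h3 : (2 : ℝ) < Z := by linarith
    have : 2 < Z := by exact_mod_cast h3
    omega
  have hlogZ : u / 2 ≤ Real.log Z := by
    have h1 : Real.exp u / 2 ≤ Z := by linarith
    have h2 := Real.log_le_log (by positivity) h1
    rw [Real.log_div (Real.exp_pos _).ne' (by norm_num), Real.log_exp] at h2
    have := Real.log_two_lt_d9
    linarith
  have hlogY : Real.log Y ≤ L / (e * LL) := by
    have h0 : (0 : ℝ) < Y := by
      have : 0 < Y := by omega
      exact_mod_cast this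
    have := Real.log_le_log h0 hY
    rwa [Real.log_exp] at this
  have hsum := sum_inv_range Z Y hZ2
  have hratio : 2 * Real.log Y / Real.log Z ≤ 4 * (ε / e) := by
    rw [div_le_iff₀ (by linarith)]
    calc 2 * Real.log Y ≤ 2 * (L / (e * LL)) := by gcongr
      _ = 4 * (ε / e) * (u / 2) := by rw [hu]; field_simp; norm_num
      _ ≤ _ := by gcongr
  have hfp : ∀ f : ℕ → ℝ, GoodFn m f → ∀ p : ℕ, p.Prime → f p ≤ 2 ^ m := by
    intro f hf p hp
    have := hf.le p hp.one_le
    have h2 := tau_prime_pow hp 1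
    rw [pow_one] at h2
    rw [h2] at this
    norm_num at this
    exact this
  have hnn : ∀ p : ℕ, 0 ≤ f₁ p / p ∧ 0 ≤ f₂ p / p := fun p =>
    ⟨div_nonneg (hf₁.nonneg p) (Nat.cast_nonneg _), div_nonneg (hf₂.nonneg p) (Nat.cast_nonneg _)⟩
  rw [← Finset.prod_sdiff (pr_mono hle)]
  apply mul_le_mul_of_nonneg_right
  · calc ∏ p ∈ pr Y \ pr Z, ((1 + f₁ p / p) * (1 + f₂ p / p)) ≤ ∏ p ∈ pr Y \ pr Z, Real.exp (2 * 2 ^ m * (1 / (p : ℝ))) := by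
          apply Finset.prod_le_prod
          · intro p _
            have := hnn p
            exact mul_nonneg (by linarith) (by linarith)
          · intro p hp
            have hp' := (mem_pr.1 (Finset.mem_sdiff.1 hp).1).1
            have hp0 : (0 : ℝ) < p := by exact_mod_cast hp'.pos
            have key : ∀ f : ℕ → ℝ, GoodFn m f → 1 + f p / p ≤ Real.exp (2 ^ m * (1 / (p : ℝ))) := by
              intro f hf
              have h1 : f p / p ≤ 2 ^ m * (1 / (p : ℝ)) := by
                rw [mul_one_div]
                have := hfp f hf p hp'
                gcongr
              linarith [Real.add_one_le_exp (2 ^ m * (1 / (p : ℝ)))]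
            calc _ ≤ Real.exp (2 ^ m * (1 / (p : ℝ))) * Real.exp (2 ^ m * (1 / (p : ℝ))) :=
                  mul_le_mul (key f₁ hf₁) (key f₂ hf₂) (by linarith [hnn p]) (Real.exp_pos _).le
              _ = _ := by rw [← Real.exp_add]; congr 1; ring
      _ = Real.exp (2 * 2 ^ m * ∑ p ∈ pr Y \ pr Z, (1 / (p : ℝ))) := by
          rw [← Real.exp_sum, Finset.mul_sum]
      _ ≤ _ := by
          apply Real.exp_le_exp.2
          have := hsum.trans hratio
          gcongr
  · apply Finset.prod_nonneg
    intro p _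
    have := hnn p
    exact mul_nonneg (by linarith) (by linarith)

lemma final_bound (m : ℕ) (hm : 1 ≤ m) (ε : ℝ) (hε0 : 0 < ε) (hε1 : ε < 1) :
    ∃ C : ℝ, 0 < C ∧ ∃ x₀ : ℝ, ∀ f₁ f₂ : ℕ → ℝ, GoodFn m f₁ → GoodFn m f₂ →
      ∀ x : ℝ, x₀ ≤ x → ∀ l : ℤ, l ≠ 0 → (|l| : ℝ) ≤ x →
      ∑ n ∈ (Finset.Icc 1 ⌊x⌋₊).filter (fun n : ℕ => 1 ≤ (n : ℤ) + l), f₁ n * f₂ ((n : ℤ) + l).toNat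
        ≤ C * x * Real.log x ^ ε *
          ((∏ p ∈ pr (lvl ε x), (1 + f₁ p / p) * (1 + f₂ p / p)) / Real.log x ^ 2) *
          (l.natAbs.divisors.card : ℝ) := by
  have hmR : (1 : ℝ) ≤ m := by exact_mod_cast hm
  set e := ε / (8 * m) with he
  have he0 : 0 < e := by positivity
  have hee : e ≤ ε := by
    rw [he]; apply div_le_self hε0.le; linarith
  obtain ⟨C₁, hC₁, x₁, h₁⟩ := large_part m e he0
  obtain ⟨C₂, hC₂, x₂, h₂⟩ := main_part m e (ε / 2) he0 (by linarith) (by linarith)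
  obtain ⟨C₃, hC₃, h₃⟩ := prod_lvl m ε e hε0 hε1 he0 hee
  obtain ⟨x₃, h₄⟩ := large_x 1 one_pos
  refine ⟨C₁ + C₂ * C₃, by positivity, max x₁ (max x₂ x₃), ?_⟩
  intro f₁ f₂ hf₁ hf₂ x hx l hl hlx
  have hxx := (le_max_right _ _).trans hx
  have a1 := h₁ f₁ f₂ hf₁ hf₂ x ((le_max_left _ _).trans hx) l hlx
  have a2 := h₂ f₁ f₂ hf₁ hf₂ x ((le_max_left _ _).trans hxx) l hl hlx
  obtain ⟨hx3, hL3, hLL1, h480, -, -⟩ := h₄ x ((le_max_right _ _).trans hxx)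
  have a3 := h₃ f₁ f₂ hf₁ hf₂ x hL3 hLL1 h480
  set L := Real.log x with hL
  have hL0 : 0 < L := by linarith
  have hx0 : 0 < x := by linarith
  have hnn : ∀ p : ℕ, 0 ≤ f₁ p / p ∧ 0 ≤ f₂ p / p := fun p =>
    ⟨div_nonneg (hf₁.nonneg p) (Nat.cast_nonneg _), div_nonneg (hf₂.nonneg p) (Nat.cast_nonneg _)⟩
  have hP1 : 1 ≤ ∏ p ∈ pr (lvl ε x), (1 + f₁ p / p) * (1 + f₂ p / p) := by
    apply Finset.one_le_prod
    intro p _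
    have := hnn p
    nlinarith [this.1, this.2]
  have hτ : (1 : ℝ) ≤ l.natAbs.divisors.card := by
    have : 0 < l.natAbs.divisors.card := Finset.card_pos.2 ⟨1, Nat.one_mem_divisors.2 (by simpa using hl)⟩
    exact_mod_cast this
  rw [← Finset.sum_filter_add_sum_filter_not ((Finset.Icc 1 ⌊x⌋₊).filter (fun n : ℕ => 1 ≤ (n : ℤ) + l))
    (fun n : ℕ => ((sp (lvl e x) n : ℝ) ≤ x ^ ((1 : ℝ) / 4) ∧ (sp (lvl e x) ((n : ℤ) + l).toNat : ℝ) ≤ x ^ ((1 : ℝ) / 4))),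
    Finset.filter_filter, Finset.filter_filter]
  refine (add_le_add a2 a1).trans ?_
  have hexp : L ^ (ε / 2) / L ^ 2 * L ^ (4 * e * m) = L ^ ε / L ^ 2 := by
    rw [div_mul_eq_mul_div, ← Real.rpow_add hL0]
    congr 2
    rw [he]; field_simp; ring
  rw [hexp]
  set P := ∏ p ∈ pr (lvl ε x), (1 + f₁ p / p) * (1 + f₂ p / p) with hP
  set τ := (l.natAbs.divisors.card : ℝ) with hτd
  have hLε : 1 ≤ L ^ ε := Real.one_le_rpow (by linarith) hε0.le
  have b1 : C₁ * x / L ^ 2 ≤ C₁ * x / L ^ 2 * (L ^ ε * P * τ) := by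
    apply le_mul_of_one_le_right (by positivity)
    have : 1 ≤ L ^ ε * P := by nlinarith
    nlinarith
  have b2 : C₂ * x * (L ^ ε / L ^ 2) * τ * ∏ p ∈ pr (lvl e x), ((1 + f₁ p / p) * (1 + f₂ p / p)) ≤
      C₂ * x * (L ^ ε / L ^ 2) * τ * (C₃ * P) := by
    apply mul_le_mul_of_nonneg_left a3
    positivity
  refine (add_le_add b2 b1).trans (le_of_eq ?_)
  ring

lemma goodFn_norm (m : ℕ) (lam : ℕ → ℂ) (h1 : lam 1 = 1)
    (hmul : ∀ a b : ℕ, 1 ≤ a → 1 ≤ b → Nat.Coprime a b → lam (a * b) = lam a * lam b)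
    (hle : ∀ n : ℕ, 1 ≤ n → ‖lam n‖ ≤ tauM m n) : GoodFn m (fun n => ‖lam n‖) where
  one := by simp [h1]
  nonneg n := norm_nonneg _
  mul a b ha hb hab := by rw [hmul a b ha hb hab, norm_mul]
  le n hn := (hle n hn).trans (by exact_mod_cast tauM_le m n hn)

/-- Theorem 2 of the paper: for multiplicative `λ₁, λ₂` bounded by `τ_m`, any
`0 < ε < 1`, any sufficiently large `x` and any nonzero integer shift `ℓ` with `|ℓ| ≤ x`,
`Σ_{n ≤ x} |λ₁(n) λ₂(n + ℓ)| ≪ x (log x)^ε M(x) τ(|ℓ|)` where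
`M(x) = (log x)^{-2} Π_{p ≤ z} (1 + |λ₁(p)|/p)(1 + |λ₂(p)|/p)` and
`z = exp(log x / (ε log log x))`. -/
theorem stmt0 (m : ℕ) (hm : 1 ≤ m) (ε : ℝ) (hε0 : 0 < ε) (hε1 : ε < 1) :
    ∃ C > (0 : ℝ), ∃ x₀ : ℝ, ∀ lam₁ lam₂ : ℕ → ℂ,
      lam₁ 1 = 1 → lam₂ 1 = 1 →
      (∀ a b : ℕ, 1 ≤ a → 1 ≤ b → Nat.Coprime a b → lam₁ (a * b) = lam₁ a * lam₁ b) →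
      (∀ a b : ℕ, 1 ≤ a → 1 ≤ b → Nat.Coprime a b → lam₂ (a * b) = lam₂ a * lam₂ b) →
      (∀ n : ℕ, 1 ≤ n → ‖lam₁ n‖ ≤ tauM m n) →
      (∀ n : ℕ, 1 ≤ n → ‖lam₂ n‖ ≤ tauM m n) →
      ∀ x : ℝ, x₀ ≤ x → ∀ ℓ : ℤ, ℓ ≠ 0 → (|ℓ| : ℝ) ≤ x →
      (∑ n ∈ (Finset.Icc 1 ⌊x⌋₊ : Finset ℕ).filter fun n : ℕ => 1 ≤ (n : ℤ) + ℓ,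
          ‖lam₁ n‖ * ‖lam₂ ((n : ℤ) + ℓ).toNat‖)
        ≤ C * x * Real.log x ^ ε *
          ((∏ p ∈ (Finset.Icc 2 ⌊Real.exp (Real.log x / (ε * Real.log (Real.log x)))⌋₊).filter
                Nat.Prime, (1 + ‖lam₁ p‖ / p) * (1 + ‖lam₂ p‖ / p)) / Real.log x ^ 2) *
          (ℓ.natAbs.divisors.card : ℝ) := by
  obtain ⟨C, hC, x₀, h⟩ := final_bound m hm ε hε0 hε1
  refine ⟨C, hC, x₀, ?_⟩
  intro lam₁ lam₂ h1 h2 m1 m2 l1 l2 x hx l hl hlx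
  exact h _ _ (goodFn_norm m lam₁ h1 m1 l1) (goodFn_norm m lam₂ h2 m2 l2) x hx l hl hlx
end

section
/- For every integer m ≥ 1 and every real ε with 0 < ε < 1 there exists a constant C > 0 (depending only on m and ε) such that the following holds. Let λ₁, λ₂ : ℕ₊ → ℂ be multiplicative functions satisfying |λᵢ(n)| ≤ τ_m(n) for all n ≥ 1 and i = 1, 2. Let x ≥ exp(exp(exp((4 + m⁴)/(2ε)))), set s := ε log log x, z := x^{1/s} and y := x^ε, and let ℓ be a nonzero integer with |ℓ| ≤ x. Then the sum of |λ₁(n) λ₂(n + ℓ)| over those positive integers n ≤ x with n + ℓ ≥ 1 for which the z-smooth part of n exceeds y or the z-smooth part of n + ℓ exceeds y is at most C · x / (log x)². -/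
open scoped Classical

/-- The `z`-smooth part of a positive integer `n`: the product of `p ^ v_p(n)` over the
primes `p ≤ z` dividing `n`, i.e. the largest `z`-smooth divisor of `n`. -/
noncomputable def smoothPart (z : ℝ) (n : ℕ) : ℕ :=
  ∏ p ∈ n.primeFactors.filter fun p : ℕ => (p : ℝ) ≤ z, p ^ n.factorization p

/-- primes up to `z` -/
noncomputable def PP (z : ℝ) : Finset ℕ := (Finset.range (⌊z⌋₊ + 1)).filter Nat.Prime

/-- log of the smooth part -/
noncomputable def ww (z : ℝ) (n : ℕ) : ℝ := ∑ p ∈ PP z, (n.factorization p : ℝ) * Real.log p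

lemma mem_PP {z : ℝ} (hz : 0 ≤ z) {p : ℕ} : p ∈ PP z ↔ p.Prime ∧ (p : ℝ) ≤ z := by
  unfold PP
  rw [Finset.mem_filter, Finset.mem_range, Nat.lt_succ_iff, Nat.le_floor_iff hz]
  tauto

lemma ww_mul (z : ℝ) {a b : ℕ} (ha : a ≠ 0) (hb : b ≠ 0) : ww z (a * b) = ww z a + ww z b := by
  unfold ww
  rw [← Finset.sum_add_distrib]
  refine Finset.sum_congr rfl fun p _ => ?_
  rw [Nat.factorization_mul ha hb]
  simp [add_mul]

lemma ww_nonneg (z : ℝ) (n : ℕ) : 0 ≤ ww z n :=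
  Finset.sum_nonneg fun p _ => mul_nonneg (Nat.cast_nonneg _) (Real.log_natCast_nonneg p)

lemma ww_prime {z : ℝ} {p : ℕ} (hp : p.Prime) (hpz : p ∈ PP z) : ww z p = Real.log p := by
  unfold ww
  rw [Finset.sum_eq_single p]
  · simp [hp.factorization_self]
  · intro q hq hqp
    rw [hp.factorization]
    simp [hqp.symm]
  · exact fun h => absurd hpz h

lemma ww_le_log (z : ℝ) (n : ℕ) : ww z n ≤ Real.log n := by
  rw [Real.log_nat_eq_sum_factorization, Finsupp.sum]
  unfold ww
  rw [← Finset.sum_filter_add_sum_filter_not (PP z) (fun p => p ∈ n.factorization.support)]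
  have h2 : ∑ p ∈ (PP z).filter (fun p => ¬ p ∈ n.factorization.support),
      (n.factorization p : ℝ) * Real.log p = 0 := by
    refine Finset.sum_eq_zero fun p hp => ?_
    rw [Finset.mem_filter] at hp
    have := Finsupp.notMem_support_iff.mp hp.2
    rw [this]; simp
  rw [h2, add_zero]
  refine Finset.sum_le_sum_of_subset_of_nonneg ?_ ?_
  · intro p hp
    exact (Finset.mem_filter.mp hp).2
  · intro p _ _
    exact mul_nonneg (Nat.cast_nonneg _) (Real.log_natCast_nonneg p)

lemma log_smoothPart {z : ℝ} (hz : 0 ≤ z) (n : ℕ) : Real.log (smoothPart z n) = ww z n := by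
  unfold smoothPart ww
  push_cast
  rw [Real.log_prod]
  · simp only [Real.log_pow]
    refine Finset.sum_subset ?_ ?_
    · intro p hp
      rw [Finset.mem_filter] at hp
      exact (mem_PP hz).mpr ⟨Nat.prime_of_mem_primeFactors hp.1, hp.2⟩
    · intro p hp hp'
      rw [mem_PP hz] at hp
      have : p ∉ n.primeFactors := fun h => hp' (Finset.mem_filter.mpr ⟨h, hp.2⟩)
      rw [← Nat.support_factorization] at this
      rw [Finsupp.notMem_support_iff.mp this]; simp
  · intro p hp
    rw [Finset.mem_filter] at hp
    have := (Nat.prime_of_mem_primeFactors hp.1).pos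
    positivity

lemma smoothPart_pos (z : ℝ) (n : ℕ) : 0 < smoothPart z n := by
  unfold smoothPart
  refine Finset.prod_pos fun p hp => ?_
  rw [Finset.mem_filter] at hp
  exact pow_pos (Nat.prime_of_mem_primeFactors hp.1).pos _

lemma factorial_val {p : ℕ} (hp : p.Prime) (n : ℕ) : n / p ≤ (n.factorial).factorization p := by
  have h := Nat.factorization_factorial_mul (n := n / p) hp
  have h1 : (p * (n / p)).factorial ∣ n.factorial :=
    Nat.factorial_dvd_factorial (Nat.mul_div_le n p)
  have h2 := (Nat.factorization_le_iff_dvd (Nat.factorial_ne_zero _) (Nat.factorial_ne_zero _)).mpr h1 p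
  omega

lemma mertens {z : ℝ} (hz : 1 ≤ z) :
    ∑ p ∈ PP z, Real.log p / p ≤ Real.log z + 2 := by
  have hz0 : 0 ≤ z := by linarith
  set n := ⌊z⌋₊ with hn
  have hn1 : 1 ≤ n := Nat.le_floor (by simpa using hz)
  have hnR : (1 : ℝ) ≤ n := by exact_mod_cast hn1
  have hth : ∑ p ∈ PP z, Real.log p ≤ Real.log 4 * n := by
    have := Chebyshev.theta_le_log4_mul_x (x := (n : ℝ)) (by positivity)
    rw [Chebyshev.theta_eq_sum_Icc, Nat.floor_natCast] at this
    refine le_trans (le_of_eq ?_) this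
    refine Finset.sum_congr ?_ fun _ _ => rfl
    ext p
    simp [PP, hn]
  have h1 : (n : ℝ) * ∑ p ∈ PP z, Real.log p / p ≤ ww z n.factorial + ∑ p ∈ PP z, Real.log p := by
    unfold ww
    rw [← Finset.sum_add_distrib, Finset.mul_sum]
    refine Finset.sum_le_sum fun p hp => ?_
    have hpp := ((mem_PP hz0).mp hp).1
    have hv : (n / p : ℕ) ≤ (n.factorial).factorization p := factorial_val hpp n
    have hv' : (n : ℝ) / p ≤ (n.factorial).factorization p + 1 := by
      have hlt : (n : ℝ) / p < (n / p : ℕ) + 1 := by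
        have hp0 : (0 : ℝ) < p := by exact_mod_cast hpp.pos
        rw [div_lt_iff₀ hp0]
        have := Nat.lt_div_mul_add (a := n) hpp.pos
        have h' : n < (n / p + 1) * p := by rw [add_mul, one_mul]; exact this
        exact_mod_cast h'
      have : ((n / p : ℕ) : ℝ) ≤ (n.factorial).factorization p := by exact_mod_cast hv
      linarith
    have hl : 0 ≤ Real.log p := Real.log_natCast_nonneg p
    calc (n : ℝ) * (Real.log p / p) = (n / p) * Real.log p := by ring
      _ ≤ ((n.factorial).factorization p + 1) * Real.log p := by gcongr
      _ = _ := by ring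
  have h2 : ww z n.factorial ≤ n * Real.log n := by
    refine (ww_le_log z _).trans ?_
    have : ((n.factorial : ℕ) : ℝ) ≤ (n : ℝ) ^ n := by exact_mod_cast Nat.factorial_le_pow n
    calc Real.log (n.factorial : ℕ) ≤ Real.log ((n : ℝ) ^ n) :=
          Real.log_le_log (by exact_mod_cast Nat.factorial_pos n) this
      _ = n * Real.log n := Real.log_pow _ _
  have h4 : Real.log 4 ≤ 2 := by
    have : Real.log 4 = 2 * Real.log 2 := by
      rw [show (4 : ℝ) = 2 ^ 2 by norm_num, Real.log_pow]; norm_num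
    have := Real.log_two_lt_d9
    linarith
  have h3 : Real.log n ≤ Real.log z := Real.log_le_log (by positivity) (Nat.floor_le hz0)
  have h5 : (n : ℝ) * ∑ p ∈ PP z, Real.log p / p ≤ n * (Real.log n + 2) := by
    nlinarith
  have := le_of_mul_le_mul_left h5 (by positivity)
  linarith

/-- the weighted harmonic sum -/
noncomputable def SS (z : ℝ) (N : ℕ) (a : ℝ) : ℝ :=
  ∑ d ∈ Finset.Icc 1 N, Real.exp (a * ww z d) / d

lemma SS_nonneg (z : ℝ) (N : ℕ) (a : ℝ) : 0 ≤ SS z N a :=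
  Finset.sum_nonneg fun _ _ => by positivity

lemma sqrt_aux {p : ℕ} (hp : 2 ≤ p) {a : ℝ} (ha : a ≤ 1 / 2) :
    Real.exp (a * Real.log p) / p ≤ 3 / 4 := by
  have hp' : (2 : ℝ) ≤ p := by exact_mod_cast hp
  have hl : Real.log 2 ≤ Real.log p := Real.log_le_log (by norm_num) hp'
  have h2 := Real.log_two_gt_d9
  rw [div_eq_mul_inv, ← Real.exp_log (show (0 : ℝ) < (p : ℝ)⁻¹ by positivity), Real.log_inv,
    ← Real.exp_add]
  have h3 : Real.exp (a * Real.log p + -Real.log p) ≤ Real.exp (-(1 / 2) * Real.log 2) := by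
    apply Real.exp_le_exp.mpr; nlinarith
  refine h3.trans ?_
  have h4 : Real.exp (-(1 / 2) * Real.log 2) ^ 2 = 1 / 2 := by
    rw [← Real.exp_nat_mul]
    have : ((2 : ℕ) : ℝ) * (-(1 / 2) * Real.log 2) = - Real.log 2 := by push_cast; ring
    rw [this, Real.exp_neg, Real.exp_log (by norm_num)]; norm_num
  nlinarith [Real.exp_pos (-(1 / 2) * Real.log 2)]

lemma TT_le {z : ℝ} (N : ℕ) {a : ℝ} (ha : a ≤ 1 / 2) {p : ℕ}
    (hp : p.Prime) (hpz : p ∈ PP z) :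
    ∑ d ∈ Finset.Icc 1 N, (d.factorization p : ℝ) * (Real.exp (a * ww z d) / d)
      ≤ 4 * (Real.exp (a * Real.log p) / p) * SS z N a := by
  set T := ∑ d ∈ Finset.Icc 1 N, (d.factorization p : ℝ) * (Real.exp (a * ww z d) / d) with hT
  set q := Real.exp (a * Real.log p) / p with hq
  have hq0 : 0 ≤ q := by positivity
  have hq1 : q ≤ 3 / 4 := sqrt_aux hp.two_le ha
  have hS := SS_nonneg z N a
  have key : T ≤ q * (SS z N a + T) := by
    have h1 : T ≤ ∑ d ∈ (Finset.Icc 1 N).image (fun e => p * e),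
        (d.factorization p : ℝ) * (Real.exp (a * ww z d) / d) := by
      rw [hT, ← Finset.sum_filter_of_ne (p := fun d => p ∣ d)]
      · refine Finset.sum_le_sum_of_subset_of_nonneg ?_ fun _ _ _ => by positivity
        intro d hd
        rw [Finset.mem_filter, Finset.mem_Icc] at hd
        obtain ⟨⟨hd1, hdN⟩, e, rfl⟩ := hd
        refine Finset.mem_image.mpr ⟨e, ?_, rfl⟩
        rw [Finset.mem_Icc]
        have he : e ≠ 0 := by rintro rfl; simp at hd1
        exact ⟨Nat.one_le_iff_ne_zero.mpr he, (Nat.le_mul_of_pos_left e hp.pos).trans hdN⟩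
      · intro d hd hne
        by_contra hnd
        rw [Nat.factorization_eq_zero_of_not_dvd hnd] at hne
        simp at hne
    rw [Finset.sum_image (fun x _ y _ h => Nat.eq_of_mul_eq_mul_left hp.pos h)] at h1
    refine h1.trans (le_of_eq ?_)
    rw [hT, SS, ← Finset.sum_add_distrib, Finset.mul_sum]
    refine Finset.sum_congr rfl fun e he => ?_
    rw [Finset.mem_Icc] at he
    have he0 : e ≠ 0 := by omega
    rw [Nat.factorization_mul hp.ne_zero he0, ww_mul z hp.ne_zero he0, ww_prime hp hpz, mul_add,
      Real.exp_add]
    have hp0 : (p : ℝ) ≠ 0 := by exact_mod_cast hp.ne_zero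
    have he0' : (e : ℝ) ≠ 0 := by exact_mod_cast he0
    simp only [Finsupp.add_apply, hp.factorization_self]
    rw [hq]
    push_cast
    field_simp
  nlinarith [mul_nonneg hq0 hS]

lemma SS_step {z : ℝ} (N : ℕ) {a b κ : ℝ} (hz : 1 ≤ Real.log z) (hz1 : 1 ≤ z)
    (hba : b ≤ a) (ha0 : 0 ≤ a) (ha : a ≤ 1 / 2) (haκ : a * Real.log z ≤ κ)
    (hs : (a - b) * (12 * Real.exp κ * Real.log z) ≤ 1 / 2) : SS z N a ≤ 2 * SS z N b := by
  have hz0 : 0 ≤ z := by linarith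
  have hS := SS_nonneg z N a
  have h1 : SS z N a - SS z N b ≤ (a - b) * ∑ d ∈ Finset.Icc 1 N,
      ww z d * (Real.exp (a * ww z d) / d) := by
    unfold SS
    rw [← Finset.sum_sub_distrib, Finset.mul_sum]
    refine Finset.sum_le_sum fun d _ => ?_
    have hw := ww_nonneg z d
    have he : Real.exp (b * ww z d) = Real.exp (a * ww z d) * Real.exp (-((a - b) * ww z d)) := by
      rw [← Real.exp_add]; ring_nf
    have h2 := Real.add_one_le_exp (-((a - b) * ww z d))
    rw [he, ← sub_div, ← mul_div_assoc, ← mul_div_assoc]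
    gcongr
    nlinarith [Real.exp_pos (a * ww z d)]
  have h2 : ∑ d ∈ Finset.Icc 1 N, ww z d * (Real.exp (a * ww z d) / d)
      ≤ 12 * Real.exp κ * Real.log z * SS z N a := by
    have e1 : ∑ d ∈ Finset.Icc 1 N, ww z d * (Real.exp (a * ww z d) / d)
        = ∑ p ∈ PP z, Real.log p * ∑ d ∈ Finset.Icc 1 N,
            (d.factorization p : ℝ) * (Real.exp (a * ww z d) / d) := by
      simp_rw [Finset.mul_sum]
      rw [Finset.sum_comm]
      refine Finset.sum_congr rfl fun d _ => ?_
      have hw : ∀ X : ℝ, ww z d * X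
          = (∑ p ∈ PP z, (d.factorization p : ℝ) * Real.log p) * X := fun _ => rfl
      rw [hw, Finset.sum_mul]
      refine Finset.sum_congr rfl fun p _ => by ring
    rw [e1]
    calc _ ≤ ∑ p ∈ PP z, 4 * Real.exp κ * SS z N a * (Real.log p / p) := by
          refine Finset.sum_le_sum fun p hp => ?_
          have hp' := (mem_PP hz0).mp hp
          have hl : 0 ≤ Real.log p := Real.log_natCast_nonneg p
          have hp0 : (0 : ℝ) < p := by exact_mod_cast hp'.1.pos
          have hle : Real.log p ≤ Real.log z := Real.log_le_log hp0 hp'.2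
          have hexp : Real.exp (a * Real.log p) ≤ Real.exp κ := by
            apply Real.exp_le_exp.mpr; nlinarith
          calc _ ≤ Real.log p * (4 * (Real.exp (a * Real.log p) / p) * SS z N a) := by
                gcongr; exact TT_le N ha hp'.1 hp
            _ ≤ Real.log p * (4 * (Real.exp κ / p) * SS z N a) := by gcongr
            _ = _ := by ring
      _ = 4 * Real.exp κ * SS z N a * ∑ p ∈ PP z, Real.log p / p := by rw [Finset.mul_sum]
      _ ≤ 4 * Real.exp κ * SS z N a * (3 * Real.log z) := by
          gcongr
          have := mertens hz1
          linarith
      _ = _ := by ring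
  have h3 : (a - b) * ∑ d ∈ Finset.Icc 1 N, ww z d * (Real.exp (a * ww z d) / d)
      ≤ (a - b) * (12 * Real.exp κ * Real.log z * SS z N a) := by
    apply mul_le_mul_of_nonneg_left h2; linarith
  nlinarith [mul_le_mul_of_nonneg_right hs hS]

lemma SS_zero (z : ℝ) (N : ℕ) : SS z N 0 ≤ 1 + Real.log N := by
  have := harmonic_le_one_add_log N
  rw [harmonic_eq_sum_Icc] at this
  push_cast at this
  unfold SS
  simpa using this

lemma SS_bound {κ : ℝ} (hκ : 1 ≤ κ) : ∃ k : ℕ, ∀ z : ℝ, ∀ N : ℕ, 2 * κ ≤ Real.log z → 1 ≤ z →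
    SS z N (κ / Real.log z) ≤ 2 ^ k * (1 + Real.log N) := by
  obtain ⟨k, hk⟩ := exists_nat_ge (24 * κ * Real.exp κ)
  refine ⟨k, fun z N hz hz1 => ?_⟩
  have hk0 : (0 : ℝ) < k := lt_of_lt_of_le (by positivity) hk
  have hlz : 0 < Real.log z := by linarith
  have main : ∀ j : ℕ, j ≤ k → SS z N (j * (κ / (k * Real.log z))) ≤ 2 ^ j * (1 + Real.log N) := by
    intro j
    induction j with
    | zero => intro _; simpa using SS_zero z N
    | succ j ih =>
      intro hj
      have ih' := ih (by omega)
      have hjk : ((j + 1 : ℕ) : ℝ) ≤ k := by exact_mod_cast hj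
      have e : ((j + 1 : ℕ) : ℝ) * (κ / (k * Real.log z)) * Real.log z ≤ κ := by
        have : ((j + 1 : ℕ) : ℝ) * (κ / (k * Real.log z)) * Real.log z
          = ((j + 1 : ℕ) : ℝ) / k * κ := by field_simp
        rw [this]
        have : ((j + 1 : ℕ) : ℝ) / k ≤ 1 := (div_le_one hk0).mpr hjk
        nlinarith
      have hst := SS_step (z := z) N (a := ((j + 1 : ℕ) : ℝ) * (κ / (k * Real.log z)))
        (b := (j : ℝ) * (κ / (k * Real.log z))) (κ := κ) (by linarith) hz1
        (by gcongr; simp) (by positivity) (by nlinarith) e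
        (by
          have : (((j + 1 : ℕ) : ℝ) * (κ / (k * Real.log z)) - (j : ℝ) * (κ / (k * Real.log z)))
            * (12 * Real.exp κ * Real.log z) = (24 * κ * Real.exp κ) / k * (1 / 2) := by
            push_cast; field_simp; ring
          rw [this]
          have : (24 * κ * Real.exp κ) / k ≤ 1 := (div_le_one hk0).mpr hk
          linarith)
      rw [pow_succ]
      linarith
  have := main k le_rfl
  have e : (k : ℝ) * (κ / (k * Real.log z)) = κ / Real.log z := by field_simp
  rwa [e] at this

lemma split_dvd {ι : Type*} (s : Finset ι) (t : ι → ℕ) : ∀ a : ℕ, a ∣ ∏ i ∈ s, t i →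
    ∃ u : ι → ℕ, (∀ i ∈ s, u i ∣ t i) ∧ ∏ i ∈ s, u i = a := by
  induction s using Finset.induction_on with
  | empty =>
    intro a ha
    exact ⟨fun _ => 1, by simp, by simpa [eq_comm] using ha⟩
  | insert j s hj ih =>
    intro a ha
    rw [Finset.prod_insert hj] at ha
    obtain ⟨a₁, a₂, h1, h2, rfl⟩ := exists_dvd_and_dvd_of_dvd_mul ha
    obtain ⟨u, hu, hp⟩ := ih a₂ h2
    refine ⟨fun i => if i = j then a₁ else u i, ?_, ?_⟩
    · intro i hi
      by_cases hij : i = j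
      · subst hij; simpa using h1
      · simp only [hij, if_false]
        exact hu i (Finset.mem_of_mem_insert_of_ne hi hij)
    · rw [Finset.prod_insert hj, if_pos rfl, ← hp]
      congr 1
      refine Finset.prod_congr rfl fun i hi => ?_
      rw [if_neg]
      rintro rfl; exact hj hi

lemma mem_tau {m n : ℕ} (hn : n ≠ 0) {t : Fin m → ℕ} :
    t ∈ ((Fintype.piFinset fun _ : Fin m => Finset.Icc 1 n).filter fun t => ∏ i, t i = n)
      ↔ ∏ i, t i = n := by
  rw [Finset.mem_filter, Fintype.mem_piFinset]
  refine ⟨fun h => h.2, fun h => ⟨fun i => ?_, h⟩⟩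
  have hd : t i ∣ n := h ▸ Finset.dvd_prod_of_mem t (Finset.mem_univ i)
  rw [Finset.mem_Icc]
  exact ⟨Nat.pos_of_dvd_of_pos hd (Nat.pos_of_ne_zero hn), Nat.le_of_dvd (Nat.pos_of_ne_zero hn) hd⟩

lemma tau_mul_le_s1 (m : ℕ) {a b : ℕ} (ha : a ≠ 0) (hb : b ≠ 0) :
    tauM m (a * b) ≤ tauM m a * tauM m b := by
  unfold tauM
  rw [← Finset.card_product]
  have hex : ∀ t : Fin m → ℕ, ∃ u v : Fin m → ℕ, ∏ i, t i = a * b →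
      ((∏ i, u i = a ∧ ∏ i, v i = b) ∧ ∀ i, t i = u i * v i) := by
    intro t
    by_cases h : ∏ i, t i = a * b
    · obtain ⟨u, hu, hp⟩ := split_dvd Finset.univ t a (h ▸ dvd_mul_right a b)
      choose! v hv using hu
      refine ⟨u, v, fun _ => ⟨⟨hp, ?_⟩, fun i => hv i (Finset.mem_univ i)⟩⟩
      have : a * ∏ i, v i = a * b := by
        rw [← h, ← hp, ← Finset.prod_mul_distrib]
        exact (Finset.prod_congr rfl fun i hi => hv i hi).symm
      exact Nat.eq_of_mul_eq_mul_left (Nat.pos_of_ne_zero ha) this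
    · exact ⟨t, t, fun h' => absurd h' h⟩
  choose u v huv using hex
  refine Finset.card_le_card_of_injOn (fun t => (u t, v t)) ?_ ?_
  · intro t ht
    have ht' := (mem_tau (mul_ne_zero ha hb)).mp ht
    have := (huv t ht').1
    exact Finset.mem_product.mpr ⟨(mem_tau ha).mpr this.1, (mem_tau hb).mpr this.2⟩
  · intro t ht t' ht' he
    have h1 := (huv t ((mem_tau (mul_ne_zero ha hb)).mp ht)).2
    have h2 := (huv t' ((mem_tau (mul_ne_zero ha hb)).mp ht')).2
    simp only [Prod.mk.injEq] at he
    funext i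
    rw [h1, h2, he.1, he.2]

lemma sum_tau_le (m N : ℕ) (G : ℕ → ℝ) (hG0 : ∀ n, 0 ≤ G n) (hG1 : G 1 ≤ 1)
    (hG : ∀ a b, a ≠ 0 → b ≠ 0 → G (a * b) ≤ G a * G b) :
    ∑ n ∈ Finset.Icc 1 N, (tauM m n : ℝ) * G n ≤ (∑ n ∈ Finset.Icc 1 N, G n) ^ m := by
  have hprod : ∀ (s : Finset (Fin m)) (t : Fin m → ℕ), (∀ i, t i ≠ 0) →
      G (∏ i ∈ s, t i) ≤ ∏ i ∈ s, G (t i) := by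
    intro s t ht
    induction s using Finset.induction_on with
    | empty => simpa using hG1
    | insert j s hj ih =>
      rw [Finset.prod_insert hj, Finset.prod_insert hj]
      refine (hG _ _ (ht j) (Finset.prod_ne_zero_iff.mpr fun i _ => ht i)).trans ?_
      exact mul_le_mul_of_nonneg_left ih (hG0 _)
  have hR : (∑ n ∈ Finset.Icc 1 N, G n) ^ m
      = ∑ t ∈ Fintype.piFinset fun _ : Fin m => Finset.Icc 1 N, ∏ i, G (t i) := by
    rw [← Finset.prod_univ_sum]
    simp
  rw [hR]
  have hL : ∀ n ∈ Finset.Icc 1 N, (tauM m n : ℝ) * G n ≤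
      ∑ t ∈ (Fintype.piFinset fun _ : Fin m => Finset.Icc 1 N).filter (fun t => ∏ i, t i = n),
        ∏ i, G (t i) := by
    intro n hn
    rw [Finset.mem_Icc] at hn
    unfold tauM
    rw [← nsmul_eq_mul, ← Finset.sum_const]
    calc _ ≤ ∑ t ∈ ((Fintype.piFinset fun _ : Fin m => Finset.Icc 1 n).filter
              fun t => ∏ i, t i = n), ∏ i, G (t i) := by
          refine Finset.sum_le_sum fun t ht => ?_
          rw [Finset.mem_filter, Fintype.mem_piFinset] at ht
          rw [← ht.2]
          refine hprod _ t fun i => ?_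
          have := (Finset.mem_Icc.mp (ht.1 i)).1
          omega
      _ ≤ _ := by
          refine Finset.sum_le_sum_of_subset_of_nonneg ?_ fun t _ _ =>
            Finset.prod_nonneg fun i _ => hG0 _
          refine Finset.filter_subset_filter _ ?_
          refine Fintype.piFinset_subset _ _ fun _ => Finset.Icc_subset_Icc le_rfl hn.2
  refine (Finset.sum_le_sum hL).trans ?_
  refine Finset.sum_fiberwise_le_sum_of_sum_fiber_nonneg ?_
  intro n _
  exact Finset.sum_nonneg fun t _ => Finset.prod_nonneg fun i _ => hG0 _

lemma tau_one_le (m : ℕ) : tauM m 1 ≤ 1 := by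
  unfold tauM
  refine (Finset.card_filter_le _ _).trans ?_
  simp

lemma ww_one (z : ℝ) : ww z 1 = 0 := by simp [ww]

lemma sum_tau_sq (m N : ℕ) (z a : ℝ) :
    ∑ n ∈ Finset.Icc 1 N, (tauM m n : ℝ) ^ 2 * (Real.exp (a * ww z n) / n)
      ≤ (SS z N a) ^ (m * m) := by
  have hE : ∀ c d : ℕ, c ≠ 0 → d ≠ 0 → Real.exp (a * ww z (c * d)) / ((c * d : ℕ) : ℝ)
      = Real.exp (a * ww z c) / c * (Real.exp (a * ww z d) / d) := by
    intro c d hc hd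
    rw [ww_mul z hc hd, mul_add, Real.exp_add]
    push_cast
    rw [mul_div_mul_comm]
  have h1 := sum_tau_le m N (fun n => Real.exp (a * ww z n) / n) (fun n => by positivity)
    (by simp [ww_one]) (fun c d hc hd => (hE c d hc hd).le)
  have h2 := sum_tau_le m N (fun n => (tauM m n : ℝ) * (Real.exp (a * ww z n) / n))
    (fun n => by positivity)
    (by simpa [ww_one] using tau_one_le m)
    (fun c d hc hd => by
      rw [hE c d hc hd]
      have : (tauM m (c * d) : ℝ) ≤ tauM m c * tauM m d := by exact_mod_cast tau_mul_le_s1 m hc hd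
      calc _ ≤ (tauM m c * tauM m d : ℝ) * (Real.exp (a * ww z c) / c * (Real.exp (a * ww z d) / d)) := by
            gcongr
        _ = _ := by ring)
  calc _ = ∑ n ∈ Finset.Icc 1 N, (tauM m n : ℝ) * (tauM m n * (Real.exp (a * ww z n) / n)) := by
        refine Finset.sum_congr rfl fun n _ => by ring
    _ ≤ _ := h2
    _ ≤ ((SS z N a) ^ m) ^ m := by
        refine pow_le_pow_left₀ (Finset.sum_nonneg fun n _ => by positivity) h1 m
    _ = _ := by rw [pow_mul]

/-- Rankin bound. -/
lemma rankin_s1 (m N : ℕ) {z a W : ℝ} (ha : 0 ≤ a) :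
    ∑ n ∈ (Finset.Icc 1 N).filter (fun n => W ≤ ww z n), (tauM m n : ℝ) ^ 2
      ≤ N * Real.exp (-(a * W)) * (SS z N a) ^ (m * m) := by
  calc _ ≤ ∑ n ∈ (Finset.Icc 1 N).filter (fun n => W ≤ ww z n),
        N * Real.exp (-(a * W)) * ((tauM m n : ℝ) ^ 2 * (Real.exp (a * ww z n) / n)) := by
        refine Finset.sum_le_sum fun n hn => ?_
        rw [Finset.mem_filter, Finset.mem_Icc] at hn
        have hn0 : (0 : ℝ) < n := by exact_mod_cast hn.1.1
        have hnN : (n : ℝ) ≤ N := by exact_mod_cast hn.1.2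
        have h1 : 1 ≤ (N : ℝ) / n := (one_le_div hn0).mpr hnN
        have h2 : 1 ≤ Real.exp (-(a * W)) * Real.exp (a * ww z n) := by
          rw [← Real.exp_add]
          apply Real.one_le_exp
          nlinarith [hn.2]
        calc (tauM m n : ℝ) ^ 2 = (tauM m n : ℝ) ^ 2 * (1 * 1) := by ring
          _ ≤ (tauM m n : ℝ) ^ 2 * ((N : ℝ) / n * (Real.exp (-(a * W)) * Real.exp (a * ww z n))) := by
            gcongr
          _ = _ := by ring
    _ ≤ ∑ n ∈ Finset.Icc 1 N,
        N * Real.exp (-(a * W)) * ((tauM m n : ℝ) ^ 2 * (Real.exp (a * ww z n) / n)) :=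
        Finset.sum_le_sum_of_subset_of_nonneg (Finset.filter_subset _ _)
          fun _ _ _ => by positivity
    _ ≤ _ := by
        rw [← Finset.mul_sum]
        gcongr
        exact sum_tau_sq m N z a

lemma comb (m N M : ℕ) (hMN : M ≤ N) (ℓ : ℤ) (hN : ∀ n : ℕ, n ≤ M → (n : ℤ) + ℓ ≤ N)
    (bad : ℕ → Prop) (K : ℝ) (hK : 0 < K) (F₁ F₂ : ℕ → ℝ)
    (h1 : ∀ n, 1 ≤ n → F₁ n ≤ tauM m n) (h2 : ∀ n, 1 ≤ n → F₂ n ≤ tauM m n)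
    (h20 : ∀ n, 0 ≤ F₂ n) (s : Finset ℕ)
    (hs : ∀ n ∈ s, 1 ≤ n ∧ n ≤ M ∧ 1 ≤ (n : ℤ) + ℓ ∧ (bad n ∨ bad ((n : ℤ) + ℓ).toNat)) :
    ∑ n ∈ s, F₁ n * F₂ ((n : ℤ) + ℓ).toNat ≤
      2 * (K * ∑ k ∈ (Finset.Icc 1 N).filter bad, (tauM m k : ℝ) ^ 2
        + K⁻¹ * ∑ k ∈ Finset.Icc 1 N, (tauM m k : ℝ) ^ 2) := by
  set H : ℕ → ℝ := fun k => K * (if bad k then (tauM m k : ℝ) ^ 2 else 0)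
    + K⁻¹ * (tauM m k : ℝ) ^ 2 with hH
  have hH0 : ∀ k, 0 ≤ H k := by
    intro k
    simp only [hH]
    have : 0 ≤ (if bad k then (tauM m k : ℝ) ^ 2 else 0) := by split_ifs <;> positivity
    positivity
  have hsum : ∑ k ∈ Finset.Icc 1 N, H k = K * ∑ k ∈ (Finset.Icc 1 N).filter bad, (tauM m k : ℝ) ^ 2
        + K⁻¹ * ∑ k ∈ Finset.Icc 1 N, (tauM m k : ℝ) ^ 2 := by
    simp only [hH]
    rw [Finset.sum_add_distrib, ← Finset.mul_sum, ← Finset.mul_sum, Finset.sum_filter]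
  rw [← hsum, two_mul]
  have hyoung : ∀ u v : ℝ, u * v ≤ K * u ^ 2 + K⁻¹ * v ^ 2 := by
    intro u v
    have h : K * u ^ 2 + K⁻¹ * v ^ 2 - u * v = K⁻¹ * ((K * u - v / 2) ^ 2 + 3 / 4 * v ^ 2) := by
      field_simp; ring
    have : 0 ≤ K⁻¹ * ((K * u - v / 2) ^ 2 + 3 / 4 * v ^ 2) := by positivity
    linarith
  calc _ ≤ ∑ n ∈ s, (H n + H ((n : ℤ) + ℓ).toNat) := by
        refine Finset.sum_le_sum fun n hn => ?_
        obtain ⟨hn1, -, hn2, hb⟩ := hs n hn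
        have hn2' : 1 ≤ ((n : ℤ) + ℓ).toNat := by omega
        set n' := ((n : ℤ) + ℓ).toNat with hn'
        have hle : F₁ n * F₂ n' ≤ tauM m n * tauM m n' :=
          mul_le_mul (h1 n hn1) (h2 n' hn2') (h20 _) (Nat.cast_nonneg _)
        refine hle.trans ?_
        rcases hb with hb | hb
        · have := hyoung (tauM m n) (tauM m n')
          have e1 : 0 ≤ K * (if bad n' then (tauM m n' : ℝ) ^ 2 else 0) := by
            split_ifs <;> positivity
          have e2 : 0 ≤ K⁻¹ * (tauM m n : ℝ) ^ 2 := by positivity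
          simp only [hH, if_pos hb]
          linarith
        · have := hyoung (tauM m n') (tauM m n)
          have e1 : 0 ≤ K * (if bad n then (tauM m n : ℝ) ^ 2 else 0) := by
            split_ifs <;> positivity
          have e2 : 0 ≤ K⁻¹ * (tauM m n' : ℝ) ^ 2 := by positivity
          simp only [hH, if_pos hb]
          linarith
    _ = ∑ n ∈ s, H n + ∑ n ∈ s, H ((n : ℤ) + ℓ).toNat := Finset.sum_add_distrib
    _ ≤ _ := by
        refine add_le_add ?_ ?_
        · refine Finset.sum_le_sum_of_subset_of_nonneg ?_ fun _ _ _ => hH0 _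
          intro n hn
          obtain ⟨hn1, hn2, -, -⟩ := hs n hn
          exact Finset.mem_Icc.mpr ⟨hn1, hn2.trans hMN⟩
        · rw [← Finset.sum_image (f := H) (g := fun n : ℕ => ((n : ℤ) + ℓ).toNat)]
          · refine Finset.sum_le_sum_of_subset_of_nonneg ?_ fun _ _ _ => hH0 _
            intro k hk
            obtain ⟨n, hn, rfl⟩ := Finset.mem_image.mp hk
            obtain ⟨hn1, hn2, hn3, -⟩ := hs n hn
            have := hN n hn2
            refine Finset.mem_Icc.mpr ⟨?_, ?_⟩ <;> omega
          · intro n hn n' hn' he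
            obtain ⟨-, -, hn3, -⟩ := hs n hn
            obtain ⟨-, -, hn3', -⟩ := hs n' hn'
            simp only at he
            omega

lemma total_bound (m N : ℕ) :
    ∑ k ∈ Finset.Icc 1 N, (tauM m k : ℝ) ^ 2 ≤ N * (1 + Real.log N) ^ (m * m) := by
  have h := rankin_s1 m N (z := 1) (a := 0) (W := 0) le_rfl
  rw [Finset.filter_true_of_mem (fun n _ => ww_nonneg 1 n)] at h
  refine h.trans ?_
  simp only [zero_mul, neg_zero, Real.exp_zero, mul_one]
  gcongr
  · exact SS_nonneg _ _ _
  · exact SS_zero 1 N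

/-- The bound of §4.2: the contribution `𝒮^y(x)` of those `n ≤ x` for which the `z`-smooth
part of `n` or of `n + ℓ` exceeds `y = x^ε` is `O(x / (log x)²)`, where `z = x^{1/s}`,
`s = ε log log x`, uniformly over multiplicative `λ₁, λ₂` bounded by `τ_m` and nonzero
shifts `|ℓ| ≤ x`, for `x ≥ exp(exp(exp((4 + m⁴)/(2ε))))`. -/
theorem stmt1 (m : ℕ) (hm : 1 ≤ m) (ε : ℝ) (hε0 : 0 < ε) (hε1 : ε < 1) :
    ∃ C > (0 : ℝ), ∀ lam₁ lam₂ : ℕ → ℂ,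
      lam₁ 1 = 1 → lam₂ 1 = 1 →
      (∀ a b : ℕ, 1 ≤ a → 1 ≤ b → Nat.Coprime a b → lam₁ (a * b) = lam₁ a * lam₁ b) →
      (∀ a b : ℕ, 1 ≤ a → 1 ≤ b → Nat.Coprime a b → lam₂ (a * b) = lam₂ a * lam₂ b) →
      (∀ n : ℕ, 1 ≤ n → ‖lam₁ n‖ ≤ tauM m n) →
      (∀ n : ℕ, 1 ≤ n → ‖lam₂ n‖ ≤ tauM m n) →
      ∀ x : ℝ, Real.exp (Real.exp (Real.exp ((4 + (m : ℝ) ^ 4) / (2 * ε)))) ≤ x →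
      ∀ ℓ : ℤ, ℓ ≠ 0 → (|ℓ| : ℝ) ≤ x →
      (∑ n ∈ (Finset.Icc 1 ⌊x⌋₊ : Finset ℕ).filter fun n : ℕ =>
            1 ≤ (n : ℤ) + ℓ ∧
            (x ^ ε < (smoothPart (x ^ (1 / (ε * Real.log (Real.log x)))) n : ℝ) ∨
             x ^ ε < (smoothPart (x ^ (1 / (ε * Real.log (Real.log x))))
                        ((n : ℤ) + ℓ).toNat : ℝ)),
          ‖lam₁ n‖ * ‖lam₂ ((n : ℤ) + ℓ).toNat‖)
        ≤ C * x / Real.log x ^ 2 := by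
  set M := m * m with hM
  set κ : ℝ := (2 * M + 4) / ε ^ 2 with hκ
  have hκ1 : 1 ≤ κ := by
    rw [hκ, le_div_iff₀ (by positivity)]
    have : ε ^ 2 ≤ 1 := by nlinarith
    have : (0 : ℝ) ≤ M := Nat.cast_nonneg _
    linarith
  obtain ⟨k, hk⟩ := SS_bound hκ1
  obtain ⟨L1, hL1⟩ : ∃ L1 : ℝ, ∀ L ≥ L1, ‖Real.log L‖ ≤ 1 / (2 * κ * ε) * ‖id L‖ :=
    Filter.eventually_atTop.mp (Real.isLittleO_log_id_atTop.bound (by positivity))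
  set L0 := max 1 L1 with hL0
  have hL01 : 1 ≤ L0 := le_max_left _ _
  refine ⟨8 * 3 ^ M * L0 ^ (M + 2) + 4 * ((2 ^ k * 3) ^ M + 3 ^ M), by positivity, ?_⟩
  intro lam₁ lam₂ _ _ _ _ hl1 hl2 x hx ℓ _ hℓx
  set L := Real.log x with hL
  set c := (4 + (m : ℝ) ^ 4) / (2 * ε) with hc
  have hc0 : 0 < c := by positivity
  have hx0 : 0 < x := lt_of_lt_of_le (Real.exp_pos _) hx
  have hLc : Real.exp (Real.exp c) ≤ L := (Real.le_log_iff_exp_le hx0).mpr hx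
  have hLpos : 0 < L := lt_of_lt_of_le (Real.exp_pos _) hLc
  have hLLc : Real.exp c ≤ Real.log L := (Real.le_log_iff_exp_le hLpos).mpr hLc
  have hLL : 0 < Real.log L := lt_of_lt_of_le (Real.exp_pos _) hLLc
  have hL1' : 1 ≤ L := le_trans (Real.one_le_exp (Real.exp_pos _).le) hLc
  have hx1 : 1 ≤ x := le_trans (Real.one_le_exp (Real.exp_pos _).le) hx
  set z := x ^ (1 / (ε * Real.log L)) with hz
  have hz0 : 0 < z := Real.rpow_pos_of_pos hx0 _
  have hz1 : 1 ≤ z := Real.one_le_rpow hx1 (by positivity)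
  have hlogz : Real.log z = L / (ε * Real.log L) := by
    rw [hz, Real.log_rpow hx0]; ring
  set N := ⌊2 * x⌋₊ with hN
  have hNx : (N : ℝ) ≤ 2 * x := Nat.floor_le (by positivity)
  have hN1 : 1 ≤ N := Nat.le_floor (by push_cast; linarith)
  have hlogN0 : 0 ≤ 1 + Real.log N := by
    have := Real.log_natCast_nonneg N; linarith
  have hlogN : 1 + Real.log N ≤ 3 * L := by
    have h1 : Real.log N ≤ Real.log (2 * x) :=
      Real.log_le_log (by exact_mod_cast hN1) hNx
    rw [Real.log_mul (by norm_num) hx0.ne'] at h1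
    have := Real.log_two_lt_d9
    linarith
  have hQ : ∑ k ∈ Finset.Icc 1 N, (tauM m k : ℝ) ^ 2 ≤ 2 * x * (3 * L) ^ M := by
    refine (total_bound m N).trans ?_
    gcongr
  have hcomb : ∀ K : ℝ, 0 < K → _ := fun K hK => comb m N ⌊x⌋₊
    (Nat.floor_le_floor (by linarith)) ℓ
    (by
      intro n hn
      have h1 : (n : ℝ) ≤ x := (Nat.le_floor_iff hx0.le).mp hn
      have h2 : (ℓ : ℝ) ≤ x := (le_abs_self _).trans hℓx
      by_cases h0 : (n : ℤ) + ℓ ≤ 0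
      · omega
      · have h3 : ((n : ℤ) + ℓ).toNat ≤ N := by
          refine Nat.le_floor ?_
          have : ((((n : ℤ) + ℓ).toNat : ℤ) : ℝ) = ((n : ℤ) + ℓ : ℤ) := by
            rw [Int.toNat_of_nonneg (by omega)]
          rw [Int.cast_natCast] at this
          rw [this]; push_cast; linarith
        omega)
    (fun n => ε * L ≤ ww z n) K hK (fun n => ‖lam₁ n‖) (fun n => ‖lam₂ n‖) hl1 hl2
    (fun n => norm_nonneg _)
    ((Finset.Icc 1 ⌊x⌋₊ : Finset ℕ).filter fun n : ℕ =>
            1 ≤ (n : ℤ) + ℓ ∧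
            (x ^ ε < (smoothPart z n : ℝ) ∨
             x ^ ε < (smoothPart z ((n : ℤ) + ℓ).toNat : ℝ)))
    (by
      have hbad : ∀ n : ℕ, x ^ ε < (smoothPart z n : ℝ) → ε * L ≤ ww z n := by
        intro n hn
        rw [← log_smoothPart hz0.le, hL, ← Real.log_rpow hx0]
        exact Real.log_le_log (Real.rpow_pos_of_pos hx0 _) hn.le
      intro n hn
      rw [Finset.mem_filter, Finset.mem_Icc] at hn
      exact ⟨hn.1.1, hn.1.2, hn.2.1, hn.2.2.imp (hbad _) (hbad _)⟩)
  have hT : (0 : ℝ) ≤ 8 * 3 ^ M * L0 ^ (M + 2) := by positivity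
  have hT' : (0 : ℝ) ≤ 4 * ((2 ^ k * 3) ^ M + 3 ^ M) := by positivity
  rw [le_div_iff₀ (by positivity)]
  by_cases hlarge : L0 ≤ L
  · have hlog := hL1 L ((le_max_right _ _).trans hlarge)
    simp only [id, Real.norm_eq_abs, abs_of_pos hLpos, abs_of_pos hLL] at hlog
    have hzκ : 2 * κ ≤ Real.log z := by
      rw [hlogz, le_div_iff₀ (by positivity)]
      have e : 1 / (2 * κ * ε) * L * (2 * κ * ε) = L := by field_simp
      have := mul_le_mul_of_nonneg_right hlog (show 0 ≤ 2 * κ * ε by positivity)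
      rw [e] at this
      linarith
    have hSS := hk z N hzκ hz1
    have hlz : 0 < Real.log z := by linarith
    have hR := rankin_s1 m N (z := z) (a := κ / Real.log z) (W := ε * L) (by positivity)
    have hexp : Real.exp (-(κ / Real.log z * (ε * L))) = (L ^ (2 * M + 4))⁻¹ := by
      have e : κ / Real.log z * (ε * L) = ((2 * M + 4 : ℕ) : ℝ) * Real.log L := by
        rw [hlogz, hκ]; push_cast; field_simp
      rw [e, Real.exp_neg, Real.exp_nat_mul, Real.exp_log hLpos]
    have hR' : ∑ n ∈ (Finset.Icc 1 N).filter (fun n => ε * L ≤ ww z n), (tauM m n : ℝ) ^ 2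
        ≤ 2 * x * (L ^ (2 * M + 4))⁻¹ * (2 ^ k * (3 * L)) ^ M := by
      refine hR.trans ?_
      rw [hexp]
      gcongr
      · exact pow_nonneg (SS_nonneg _ _ _) _
      · exact SS_nonneg _ _ _
      · exact hSS.trans (mul_le_mul_of_nonneg_left hlogN (by positivity))
    have hfin := hcomb (L ^ (M + 2)) (by positivity)
    calc _ ≤ 2 * (L ^ (M + 2) * (2 * x * (L ^ (2 * M + 4))⁻¹ * (2 ^ k * (3 * L)) ^ M)
          + (L ^ (M + 2))⁻¹ * (2 * x * (3 * L) ^ M)) * L ^ 2 := by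
          refine mul_le_mul_of_nonneg_right (hfin.trans ?_) (by positivity)
          gcongr
      _ = 4 * ((2 ^ k * 3) ^ M + 3 ^ M) * x := by
          have e1 : L ^ (2 * M + 4) = L ^ M * L ^ M * L ^ 2 * L ^ 2 := by ring
          rw [← mul_assoc (2 ^ k : ℝ) 3 L, mul_pow (2 ^ k * 3 : ℝ) L, mul_pow 3 L, e1, pow_add L M 2]
          field_simp
          ring
      _ ≤ _ := by nlinarith
  · push Not at hlarge
    have hfin := hcomb 1 one_pos
    have hsub : ∑ n ∈ (Finset.Icc 1 N).filter (fun n => ε * L ≤ ww z n), (tauM m n : ℝ) ^ 2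
        ≤ ∑ n ∈ Finset.Icc 1 N, (tauM m n : ℝ) ^ 2 :=
      Finset.sum_le_sum_of_subset_of_nonneg (Finset.filter_subset _ _)
          fun _ _ _ => by positivity
    calc _ ≤ (2 * (1 * (2 * x * (3 * L) ^ M) + 1⁻¹ * (2 * x * (3 * L) ^ M))) * L ^ 2 := by
          refine mul_le_mul_of_nonneg_right (hfin.trans ?_) (by positivity)
          gcongr
          exact hsub.trans hQ
      _ = 8 * 3 ^ M * L ^ (M + 2) * x := by rw [mul_pow]; ring
      _ ≤ 8 * 3 ^ M * L0 ^ (M + 2) * x := by gcongr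
      _ ≤ _ := by nlinarith
end
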